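/- Let n be an integer with 28 < n ≤ 1000 and let F_n be the n-th Fibonacci number. Then the only integer solutions (x, y) of x·(x − F_n·y)·(x − 2^n·y) − y³ = ±1 are the trivial solutions (1,0), (−1,0), (0,1), (0,−1), (F_n,1), (−F_n,−1), (2^n,1), (−2^n,−1). -/

import Mathlib

section T1sec
open Finset Polynomial in
theorem zero_est (K L R S : ℕ) (p : ℕ → ℕ → ℝ) (α γ : ℝ) (q : ℤ)
    (hα : 0 < α) (hα1 : α ≠ 1) (hγ : 0 < γ) (hS : (S:ℤ) ≤ |q|) (hRS : K * L ≤ R * S)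
    (hK : 0 < K)
    (hz : ∀ r < R, ∀ s < S + L, ∑ k ∈ range K, ∑ l ∈ range L,
      p k l * ((s:ℝ) + r * q)^k * (α^s * γ^r)^l = 0) :
    ∀ k < K, ∀ l < L, p k l = 0 := by
  classical
  set P : ℕ → ℝ[X] := fun l => ∑ k ∈ range K, C (p k l) * X ^ k with hP
  have hPdeg : ∀ l, (P l).natDegree ≤ K - 1 := by
    intro l
    apply natDegree_sum_le_of_forall_le
    intro k hk
    have := mem_range.1 hk
    exact (natDegree_C_mul_X_pow_le _ _).trans (by omega)
  have hPcoeff : ∀ l, ∀ k < K, (P l).coeff k = p k l := by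
    intro l k hk
    simp only [hP, finsetSum_coeff, coeff_C_mul_X_pow]
    simp [hk]
  have hPev : ∀ l x, (P l).eval x = ∑ k ∈ range K, p k l * x ^ k := by
    intro l x
    simp [hP, eval_finsetSum]
  set J := (range L).filter (fun l => P l ≠ 0) with hJ
  by_cases hJe : J = ∅
  · intro k hk l hl
    have : P l = 0 := by
      by_contra h
      have : l ∈ J := by simp [hJ, hl, h]
      simp [hJe] at this
    rw [← hPcoeff l k hk, this, coeff_zero]
  exfalso
  have hJc : J.card ≤ L := (card_filter_le _ _).trans (by simp)
  have hJpos : 0 < J.card := Finset.card_pos.2 (Finset.nonempty_iff_ne_empty.2 hJe)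
  set j := J.card with hj
  let e : Fin j ≃ J := J.equivFin.symm
  let ℓ : Fin j → ℕ := fun c => (e c : ℕ)
  have hℓJ : ∀ c, ℓ c ∈ J := fun c => (e c).2
  have hℓinj : Function.Injective ℓ := fun c d h => e.injective (Subtype.ext h)
  have hℓL : ∀ c, ℓ c < L := fun c => by have := hℓJ c; simp [hJ] at this; exact this.1
  have hℓP : ∀ c, P (ℓ c) ≠ 0 := fun c => by have := hℓJ c; simp [hJ] at this; exact this.2
  let M0 : Matrix (Fin j) (Fin j) ℝ[X] := Matrix.of fun i c =>
    C ((α ^ (ℓ c)) ^ (i:ℕ)) * (P (ℓ c)).comp (X + C ((i:ℕ):ℝ))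
  let ex : Fin j → ℕ := fun c => K - 1 - (P (ℓ c)).natDegree
  let M1 : Matrix (Fin j) (Fin j) ℝ[X] := Matrix.of fun i c => X ^ (ex c) * M0 i c
  have hdet : M1.det = (∏ c, X ^ (ex c)) * M0.det := Matrix.det_mul_row (fun c => X ^ (ex c)) M0
  have hM1deg : ∀ i c, (M1 i c).natDegree ≤ K - 1 := by
    intro i c
    have h1 : (M0 i c).natDegree ≤ (P (ℓ c)).natDegree := by
      refine (natDegree_C_mul_le _ _).trans ?_
      have h9 : ((P (ℓ c)).comp (X + C ((i:ℕ):ℝ))).natDegree = (P (ℓ c)).natDegree := by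
        rw [natDegree_comp, natDegree_X_add_C, mul_one]
      exact h9.le
    calc (M1 i c).natDegree ≤ ex c + (M0 i c).natDegree := by
          refine natDegree_mul_le.trans ?_
          exact Nat.add_le_add_right (natDegree_X_pow_le _) _
      _ ≤ K - 1 := by have := hPdeg (ℓ c); simp only [ex]; omega
  have hM1coeff : ∀ i c, (M1 i c).coeff (K - 1) = (P (ℓ c)).leadingCoeff * (α ^ (ℓ c)) ^ (i:ℕ) := by
    intro i c
    have h1 : K - 1 = (P (ℓ c)).natDegree + ex c := by
      have := hPdeg (ℓ c); simp only [ex]; omega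
    have h2 : (M1 i c).coeff (K-1) = (M0 i c).coeff (P (ℓ c)).natDegree := by
      conv_lhs => rw [h1]
      simp only [M1, Matrix.of_apply]
      exact coeff_X_pow_mul _ _ _
    rw [h2]
    simp only [M0, Matrix.of_apply, coeff_C_mul]
    have h3 : ((P (ℓ c)).comp (X + C ((i:ℕ):ℝ))).coeff (P (ℓ c)).natDegree
        = (P (ℓ c)).leadingCoeff := by
      have hnd : ((P (ℓ c)).comp (X + C ((i:ℕ):ℝ))).natDegree = (P (ℓ c)).natDegree := by
        rw [natDegree_comp, natDegree_X_add_C, mul_one]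
      have := leadingCoeff_comp (p := P (ℓ c)) (q := X + C ((i:ℕ):ℝ))
        (by rw [natDegree_X_add_C]; exact one_ne_zero)
      rw [leadingCoeff, hnd] at this
      rw [this, leadingCoeff_X_add_C, one_pow, mul_one]
    rw [h3]; ring
  have hcoeffdet : M1.det.coeff (j * (K - 1)) =
      (Matrix.of fun i c : Fin j => (P (ℓ c)).leadingCoeff * (α ^ (ℓ c)) ^ (i:ℕ)).det := by
    rw [Matrix.det_apply, Matrix.det_apply, finsetSum_coeff]
    refine Finset.sum_congr rfl fun σ _ => ?_
    rw [coeff_smul]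
    congr 1
    have := coeff_prod_of_natDegree_le (s := (Finset.univ : Finset (Fin j)))
      (f := fun i => M1 (σ i) i) (n := K - 1) (fun i _ => hM1deg _ _)
    simp only [Finset.card_univ, Fintype.card_fin] at this
    rw [this]
    refine Finset.prod_congr rfl fun i _ => ?_
    rw [hM1coeff]; rfl
  have hαinj : Function.Injective fun c : Fin j => α ^ (ℓ c) := by
    intro c d h
    exact hℓinj (pow_right_injective₀ hα hα1 h)
  have hne : M1.det.coeff (j * (K - 1)) ≠ 0 := by
    rw [hcoeffdet]
    rw [Matrix.det_mul_row (fun c => (P (ℓ c)).leadingCoeff)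
      (fun i c : Fin j => (α ^ (ℓ c)) ^ (i:ℕ))]
    apply mul_ne_zero
    · exact Finset.prod_ne_zero_iff.2 fun c _ => leadingCoeff_ne_zero.2 (hℓP c)
    · have : (fun i c : Fin j => (α ^ (ℓ c)) ^ (i:ℕ)) =
        (Matrix.vandermonde fun c : Fin j => α ^ (ℓ c)).transpose := by
        ext i c; rfl
      rw [this, Matrix.det_transpose]
      exact Matrix.det_vandermonde_ne_zero_iff.2 hαinj
  have hD : M1.det ≠ 0 := fun h => hne (by rw [h, coeff_zero])
  have hDdeg : M1.det.natDegree ≤ j * (K - 1) := by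
    rw [Matrix.det_apply]
    apply natDegree_sum_le_of_forall_le
    intro σ _
    refine (natDegree_smul_le _ _).trans ?_
    refine (natDegree_prod_le _ _).trans ?_
    refine (Finset.sum_le_sum fun i _ => hM1deg (σ i) i).trans ?_
    simp
  have hroot : ∀ r < R, ∀ s < S, M1.det.IsRoot ((s:ℝ) + r * q) := by
    intro r hr s hs
    set x : ℝ := (s:ℝ) + r * q
    rw [IsRoot, hdet, eval_mul]
    have : M0.det.eval x = 0 := by
      have h1 : M0.det.eval x = (M0.map (eval x)).det := by
        have := RingHom.map_det (evalRingHom x) M0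
        simpa using this
      rw [h1]
      apply Matrix.exists_mulVec_eq_zero_iff.1
      refine ⟨fun c => (α ^ s * γ ^ r) ^ (ℓ c), ?_, ?_⟩
      · intro h
        have := congrFun h ⟨0, hJpos⟩
        simp only [Pi.zero_apply] at this
        have h2 : 0 < (α ^ s * γ ^ r) ^ (ℓ ⟨0, hJpos⟩) := by positivity
        linarith
      · ext i
        simp only [Matrix.mulVec, dotProduct, Matrix.map_apply, M0, Matrix.of_apply, Pi.zero_apply,
          eval_mul, eval_C, eval_comp, eval_add, eval_X]
        have h3 := hz r hr (s + i) (by have := i.2; omega)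
        rw [Finset.sum_comm] at h3
        have h4 : ∀ l, ∑ k ∈ range K, p k l * (((s + (i:ℕ) : ℕ):ℝ) + r * q)^k *
            (α^(s+(i:ℕ)) * γ^r)^l = (α ^ l) ^ (i:ℕ) * (P l).eval (x + ((i:ℕ):ℝ)) *
            (α ^ s * γ ^ r) ^ l := by
          intro l
          rw [hPev, Finset.mul_sum, Finset.sum_mul]
          refine Finset.sum_congr rfl fun k _ => ?_
          have : (((s + (i:ℕ) : ℕ):ℝ) + r * q) = x + ((i:ℕ):ℝ) := by
            simp only [x]; push_cast; ring
          rw [this, pow_add]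
          have e1 : (α ^ s * α ^ (i:ℕ) * γ ^ r) ^ l = (α^l)^(i:ℕ) * (α ^ s * γ ^ r) ^ l := by
            rw [← pow_mul, mul_comm l, pow_mul]
            rw [← mul_pow]; ring
          rw [e1]; ring
        simp only [h4] at h3
        have h5 : ∑ l ∈ J, (α ^ l) ^ (i:ℕ) * (P l).eval (x + ((i:ℕ):ℝ)) *
            (α ^ s * γ ^ r) ^ l = 0 := by
          rw [← h3, hJ]
          apply Finset.sum_subset (Finset.filter_subset _ _)
          intro l hl hnl
          have : P l = 0 := by
            by_contra hh
            exact hnl (by simp only [Finset.mem_filter]; exact ⟨hl, hh⟩)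
          rw [this]; simp
        rw [← Finset.sum_coe_sort] at h5
        rw [← Equiv.sum_comp e] at h5
        exact h5
    rw [this, mul_zero]
  have hinj : Set.InjOn (fun rs : ℕ × ℕ => (rs.2:ℝ) + rs.1 * q)
      ((range R ×ˢ range S : Finset (ℕ × ℕ)) : Set (ℕ × ℕ)) := by
    rintro ⟨r, s⟩ h1 ⟨r', s'⟩ h2 h
    simp only [Finset.coe_product, Set.mem_prod, Finset.mem_coe, mem_range] at h1 h2
    have h3 : (s:ℤ) + r * q = s' + r' * q := by
      have : ((s:ℝ) + r * q) = s' + r' * q := h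
      exact_mod_cast this
    have h4 : ((r:ℤ) - r') * q = s' - s := by linarith
    have h5 : |(s':ℤ) - s| < |q| := by
      rw [abs_lt]; constructor <;> omega
    have h6 : (r:ℤ) - r' = 0 := by
      by_contra h7
      have : 1 ≤ |(r:ℤ) - r'| := Int.one_le_abs h7
      rw [← h4, abs_mul] at h5
      nlinarith [abs_nonneg q]
    rw [h6] at h4
    ext
    · simp; omega
    · simp; omega
  have hcard := Finset.card_image_of_injOn hinj
  have hsub : (range R ×ˢ range S).image (fun rs : ℕ × ℕ => (rs.2:ℝ) + rs.1 * q) ⊆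
      M1.det.roots.toFinset := by
    intro x hx
    obtain ⟨⟨r, s⟩, h1, rfl⟩ := Finset.mem_image.1 hx
    simp only [Finset.mem_product, mem_range] at h1
    rw [Multiset.mem_toFinset, mem_roots hD]
    exact hroot r h1.1 s h1.2
  have h1 := Finset.card_le_card hsub
  rw [hcard, Finset.card_product, card_range, card_range] at h1
  have h2 := (Multiset.toFinset_card_le M1.det.roots).trans (card_roots' M1.det)
  have h3 : j * (K - 1) < K * L := by
    have : j * (K - 1) < j * K := Nat.mul_lt_mul_of_pos_left (by omega) hJpos
    calc j * (K-1) < j * K := this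
      _ ≤ L * K := Nat.mul_le_mul_right _ hJc
      _ = K * L := mul_comm _ _
  omega
end T1sec

section T2sec
open Finset in
theorem pigeon {ι : Type} [Fintype ι] [DecidableEq ι] (M H ν : ℕ) (A : ℝ) (hA : 0 < A) (hH : 1 ≤ H)
    (hM : 0 < M) (hν : 2 ≤ ν) (hN : Fintype.card ι = ν * M) (a : Fin M → ι → ℝ)
    (ha : ∀ m t, |a m t| ≤ A) :
    ∃ p : ι → ℤ, p ≠ 0 ∧ (∀ t, |p t| ≤ H) ∧
      ∀ m, |∑ t, a m t * p t| ≤ 2 * (Fintype.card ι) * A * H / (H:ℝ) ^ ν := by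
  classical
  set N := Fintype.card ι with hNdef
  have hNpos : 0 < N := by rw [hN]; positivity
  have hHr : (1:ℝ) ≤ H := by exact_mod_cast hH
  set B : ℝ := N * A * H with hB
  have hBpos : 0 < B := by
    have : (0:ℝ) < N := by exact_mod_cast hNpos
    positivity
  set G : ℝ := (H:ℝ)^ν with hG
  have hGpos : 0 < G := by positivity
  let lin : (ι → Fin (H+1)) → Fin M → ℝ := fun x m => ∑ t, a m t * ((x t : ℕ):ℝ)
  have hlin : ∀ x m, |lin x m| ≤ B := by
    intro x m
    calc |lin x m| ≤ ∑ t, |a m t * ((x t : ℕ):ℝ)| := Finset.abs_sum_le_sum_abs _ _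
      _ ≤ ∑ t : ι, A * H := by
        apply Finset.sum_le_sum
        intro t _
        rw [abs_mul]
        have h1 : |((x t : ℕ):ℝ)| ≤ H := by
          rw [abs_of_nonneg (by positivity)]
          have := (x t).2
          exact_mod_cast (by omega : (x t : ℕ) ≤ H)
        exact mul_le_mul (ha m t) h1 (abs_nonneg _) hA.le
      _ = B := by simp [hB, hNdef]; ring
  let box : (ι → Fin (H+1)) → Fin M → ℕ := fun x m => ⌊(lin x m + B) * G / (2*B)⌋₊
  have hbox : ∀ x m, box x m < H^ν + 1 := by
    intro x m
    have h1 := (abs_le.1 (hlin x m)).2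
    have : (lin x m + B) * G / (2*B) ≤ G := by
      rw [div_le_iff₀ (by positivity)]
      nlinarith
    have h2 : box x m ≤ ⌊G⌋₊ := Nat.floor_le_floor this
    have h3 : ⌊G⌋₊ = H^ν := by
      rw [hG]; exact_mod_cast Nat.floor_natCast (H^ν)
    omega
  let f : (ι → Fin (H+1)) → (Fin M → Fin (H^ν+1)) := fun x m => ⟨box x m, hbox x m⟩
  have hcard : Fintype.card (Fin M → Fin (H^ν+1)) < Fintype.card (ι → Fin (H+1)) := by
    simp only [Fintype.card_fun, Fintype.card_fin]
    rw [← hNdef, hN, pow_mul]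
    apply Nat.pow_lt_pow_left _ (by omega)
    obtain ⟨k, rfl⟩ : ∃ k, ν = k + 2 := ⟨ν - 2, by omega⟩
    have h1 : H^(k+2) = H^k * H^2 := pow_add _ _ _
    have h2 : (H+1)^(k+2) = (H+1)^k * (H+1)^2 := pow_add _ _ _
    have h3 : H^k ≤ (H+1)^k := Nat.pow_le_pow_left (by omega) _
    have h4 : 1 ≤ (H+1)^k := Nat.one_le_pow _ _ (by omega)
    rw [h1, h2]
    calc H^k * H^2 + 1 ≤ (H+1)^k*H^2 + 1 := by gcongr
      _ < (H+1)^k * (H+1)^2 := by nlinarith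
  obtain ⟨x, y, hxy, hf⟩ := Fintype.exists_ne_map_eq_of_card_lt f hcard
  refine ⟨fun t => ((x t : ℕ):ℤ) - ((y t:ℕ):ℤ), ?_, ?_, ?_⟩
  · intro h
    apply hxy
    funext t
    have := congrFun h t
    simp only [Pi.zero_apply] at this
    exact Fin.ext (by omega)
  · intro t
    have h1 := (x t).2
    have h2 := (y t).2
    show |((x t : ℕ):ℤ) - ((y t:ℕ):ℤ)| ≤ H
    rw [abs_le]; constructor <;> omega
  · intro m
    have h1 : box x m = box y m := by
      have := congrFun hf m
      exact congrArg Fin.val this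
    have e : ∑ t, a m t * (((((x t : ℕ):ℤ) - ((y t:ℕ):ℤ)) : ℤ) : ℝ) = lin x m - lin y m := by
      simp only [lin]
      rw [← Finset.sum_sub_distrib]
      refine Finset.sum_congr rfl fun t _ => ?_
      push_cast; ring
    rw [e]
    have hx0 : 0 ≤ (lin x m + B) * G / (2*B) := by
      have := (abs_le.1 (hlin x m)).1
      apply div_nonneg (mul_nonneg (by linarith) hGpos.le) (by linarith)
    have hy0 : 0 ≤ (lin y m + B) * G / (2*B) := by
      have := (abs_le.1 (hlin y m)).1
      apply div_nonneg (mul_nonneg (by linarith) hGpos.le) (by linarith)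
    have a1 := Nat.floor_le hx0
    have a2 := Nat.lt_floor_add_one ((lin x m + B) * G / (2*B))
    have b1 := Nat.floor_le hy0
    have b2 := Nat.lt_floor_add_one ((lin y m + B) * G / (2*B))
    have h1' : ⌊(lin x m + B) * G / (2*B)⌋₊ = ⌊(lin y m + B) * G / (2*B)⌋₊ := h1
    rw [h1'] at a1 a2
    have c1 : |(lin x m + B) * G / (2*B) - (lin y m + B) * G / (2*B)| ≤ 1 := by
      rw [abs_le]; constructor <;> linarith
    have c2 : (lin x m + B) * G / (2*B) - (lin y m + B) * G / (2*B) =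
        (lin x m - lin y m) * (G / (2*B)) := by ring
    rw [c2, abs_mul, abs_of_pos (show 0 < G/(2*B) by positivity)] at c1
    rw [show 2 * (N:ℝ) * A * H = 2 * B by rw [hB]; ring]
    rw [le_div_iff₀ hGpos]
    have : |lin x m - lin y m| * (G / (2*B)) * (2*B) ≤ 1 * (2*B) := by gcongr
    have e2 : |lin x m - lin y m| * (G / (2*B)) * (2*B) = |lin x m - lin y m| * G := by
      field_simp
    linarith
end T2sec

section T3sec
open Finset

theorem exp_tail0 (y : ℝ) (hy : 0 ≤ y) (J : ℕ) :
    Real.exp y - ∑ j ∈ range J, y^j / (j.factorial:ℝ) ≤ Real.exp (16*y) / 16^J := by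
  have h1 : HasSum (fun n : ℕ => y^n / (n.factorial:ℝ)) (Real.exp y) := by
    have := NormedSpace.expSeries_div_hasSum_exp (𝔸 := ℝ) y
    rwa [← Real.exp_eq_exp_ℝ] at this
  have h2 := h1.tendsto_sum_nat
  have h3 : Real.exp y ≤ ∑ j ∈ range J, y^j / (j.factorial:ℝ) + Real.exp (16*y) / 16^J := by
    refine le_of_tendsto h2 ?_
    filter_upwards [Filter.eventually_ge_atTop J] with n hn
    have e : n = J + (n - J) := by omega
    rw [e, Finset.sum_range_add]
    gcongr
    rw [le_div_iff₀ (by positivity), Finset.sum_mul]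
    have h4 := Real.sum_le_exp_of_nonneg (x := 16*y) (by positivity) (J + (n-J))
    refine le_trans ?_ h4
    rw [Finset.sum_range_add]
    refine le_trans ?_ (le_add_of_nonneg_left (Finset.sum_nonneg fun i _ => by positivity))
    apply Finset.sum_le_sum
    intro i _
    rw [div_mul_eq_mul_div, mul_pow 16 y, mul_comm ((16:ℝ)^(J+i))]
    gcongr
    · norm_num
    · omega
  linarith

theorem exp_tail (w E : ℝ) (J : ℕ) (hw : |w| ≤ E) :
    |Real.exp w - ∑ j ∈ range J, w^j / (j.factorial:ℝ)| ≤ Real.exp (17*E) / 16^J := by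
  have hE : 0 ≤ E := (abs_nonneg _).trans hw
  have h1 := Complex.norm_exp_sub_sum_le_exp_norm_sub_sum (w:ℂ) J
  have h2 : ‖Complex.exp (w:ℂ) - ∑ m ∈ range J, (w:ℂ)^m / (m.factorial:ℂ)‖
      = |Real.exp w - ∑ j ∈ range J, w^j / (j.factorial:ℝ)| := by
    rw [← Real.norm_eq_abs, ← Complex.norm_real]; push_cast; rfl
  rw [h2, Complex.norm_real, Real.norm_eq_abs] at h1
  refine h1.trans ((exp_tail0 _ (abs_nonneg _) J).trans ?_)
  gcongr
  linarith [abs_nonneg w]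

theorem smallF (K L M H : ℕ) (lam Z E : ℝ) (hZ : 1 ≤ Z) (hE : L * (Z * |lam|) ≤ E) (hH : 1 ≤ H)
    (hM : 0 < M) (hKM : K ≤ M) (hN : K * L = 24 * M) :
    ∃ p : ℕ → ℕ → ℤ, (∃ k < K, ∃ l < L, p k l ≠ 0) ∧ (∀ k l, |p k l| ≤ H) ∧
      ∀ x : ℝ, |x| ≤ Z → |∑ k ∈ range K, ∑ l ∈ range L, (p k l:ℝ) * x^k * Real.exp (l * (lam * x))|
        ≤ M * (2 * (K * L) * (Z^K * Real.exp E) * H / (H:ℝ)^24) +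
          (K * L) * (H * (Z^K * (Real.exp (17*E) / 16^(M-K)))) := by
  have hZ0 : 0 < Z := by linarith
  let a : Fin M → (Fin K × Fin L) → ℝ := fun m t =>
    if (t.1:ℕ) ≤ m then Z^(t.1:ℕ) * (((t.2:ℕ):ℝ) * (lam * Z))^((m:ℕ)-t.1) / (((m:ℕ)-t.1).factorial:ℝ) else 0
  have hlE : ∀ l : ℕ, l < L → ∀ t : ℝ, |t| ≤ 1 → |(l:ℝ) * (lam * Z) * t| ≤ E := by
    intro l hl t ht
    refine le_trans ?_ hE
    rw [abs_mul, abs_mul, abs_mul, abs_of_pos hZ0, abs_of_nonneg (by positivity : (0:ℝ) ≤ l)]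
    have : (l:ℝ) ≤ L := by exact_mod_cast hl.le
    calc (l:ℝ) * (|lam| * Z) * |t| ≤ (l:ℝ) * (|lam| * Z) * 1 := by gcongr
      _ = l * (Z * |lam|) := by ring
      _ ≤ _ := by gcongr
  have ha : ∀ m t, |a m t| ≤ Z^K * Real.exp E := by
    intro m t
    simp only [a]
    split_ifs with h
    · have h1 : |((t.2:ℕ):ℝ) * (lam * Z)| ≤ E := by simpa using hlE t.2 t.2.2 1 (by simp)
      rw [mul_div_assoc, abs_mul, abs_of_pos (pow_pos hZ0 _)]
      apply mul_le_mul
      · exact pow_le_pow_right₀ hZ t.1.2.le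
      · rw [abs_div, abs_pow, Nat.abs_cast]
        refine (Real.pow_div_factorial_le_exp _ (abs_nonneg _) _).trans ?_
        exact Real.exp_le_exp.2 h1
      · positivity
      · positivity
    · rw [abs_zero]; positivity
  obtain ⟨p, hp0, hpH, hps⟩ := pigeon (ι := Fin K × Fin L) M H 24 (Z^K * Real.exp E) (by positivity) hH hM
    (by norm_num) (by simp [hN]) a ha
  let P : ℕ → ℕ → ℤ := fun k l => if h : k < K ∧ l < L then p (⟨k, h.1⟩, ⟨l, h.2⟩) else 0
  have hP : ∀ t : Fin K × Fin L, P t.1 t.2 = p t := by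
    intro t
    simp only [P]
    rw [dif_pos ⟨t.1.2, t.2.2⟩]
  refine ⟨P, ?_, ?_, ?_⟩
  · obtain ⟨t, ht⟩ := Function.ne_iff.1 hp0
    exact ⟨t.1, t.1.2, t.2, t.2.2, by rw [hP]; exact ht⟩
  · intro k l
    simp only [P]
    split_ifs
    · exact hpH _
    · simp
  intro x hx
  set t := x / Z with ht
  have hxt : x = Z * t := by rw [ht]; field_simp
  have ht1 : |t| ≤ 1 := by
    rw [ht, abs_div, abs_of_pos hZ0, div_le_one hZ0]; exact hx
  have hsum : ∑ k ∈ range K, ∑ l ∈ range L, (P k l:ℝ) * x^k * Real.exp (l * (lam * x))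
      = ∑ s : Fin K × Fin L, (p s:ℝ) * x^(s.1:ℕ) * Real.exp ((s.2:ℕ) * (lam * x)) := by
    rw [Fintype.sum_prod_type, Finset.sum_range]
    refine Finset.sum_congr rfl fun k _ => ?_
    rw [Finset.sum_range]
    refine Finset.sum_congr rfl fun l _ => ?_
    rw [← hP (k,l)]
  have hkey : ∀ s : Fin K × Fin L, |x^(s.1:ℕ) * Real.exp ((s.2:ℕ) * (lam * x)) - ∑ m : Fin M, t^(m:ℕ) * a m s|
      ≤ Z^K * (Real.exp (17*E) / 16^(M-K)) := by
    intro s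
    have hkK := s.1.2
    have e1 : ∑ m : Fin M, t^(m:ℕ) * a m s = x^(s.1:ℕ) *
        ∑ j ∈ range (M - s.1), (((s.2:ℕ):ℝ) * (lam * Z) * t)^j / (j.factorial:ℝ) := by
      have : ∑ m : Fin M, t^(m:ℕ) * a m s = ∑ m ∈ range M, t^m * (if (s.1:ℕ) ≤ m then
          Z^(s.1:ℕ) * (((s.2:ℕ):ℝ) * (lam * Z))^(m-s.1) / ((m-s.1).factorial:ℝ) else 0) := by
        rw [Finset.sum_range]
      rw [this]
      have hM' : M = s.1 + (M - s.1) := by omega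
      conv_lhs => rw [hM']
      rw [Finset.sum_range_add, Finset.sum_eq_zero, zero_add, Finset.mul_sum]
      · refine Finset.sum_congr rfl fun j _ => ?_
        rw [if_pos (by omega), Nat.add_sub_cancel_left, hxt, mul_pow Z t, mul_pow _ t, pow_add]
        ring
      · intro m hm
        rw [if_neg (by have := Finset.mem_range.1 hm; omega), mul_zero]
    rw [e1]
    have e2 : ((s.2:ℕ):ℝ) * (lam * x) = ((s.2:ℕ):ℝ) * (lam * Z) * t := by rw [hxt]; ring
    rw [e2, ← mul_sub, abs_mul]
    have h1 := exp_tail _ E (M - s.1) (hlE s.2 s.2.2 t ht1)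
    apply mul_le_mul
    · rw [abs_pow]
      calc |x|^(s.1:ℕ) ≤ Z^(s.1:ℕ) := pow_le_pow_left₀ (abs_nonneg _) hx _
        _ ≤ Z^K := pow_le_pow_right₀ hZ s.1.2.le
    · refine h1.trans ?_
      apply div_le_div_of_nonneg_left (by positivity) (by positivity)
      exact pow_le_pow_right₀ (by norm_num) (by omega)
    · positivity
    · positivity
  rw [hsum]
  have e3 : ∑ s : Fin K × Fin L, (p s:ℝ) * x^(s.1:ℕ) * Real.exp ((s.2:ℕ) * (lam * x)) =
      ∑ m : Fin M, t^(m:ℕ) * (∑ s, a m s * (p s:ℝ)) + ∑ s : Fin K × Fin L, (p s:ℝ) *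
        (x^(s.1:ℕ) * Real.exp ((s.2:ℕ) * (lam * x)) - ∑ m : Fin M, t^(m:ℕ) * a m s) := by
    have : ∑ m : Fin M, t^(m:ℕ) * (∑ s, a m s * (p s:ℝ)) = ∑ s : Fin K × Fin L, (p s:ℝ) * ∑ m : Fin M, t^(m:ℕ) * a m s := by
      simp only [Finset.mul_sum]
      rw [Finset.sum_comm]
      refine Finset.sum_congr rfl fun _ _ => Finset.sum_congr rfl fun _ _ => by ring
    rw [this, ← Finset.sum_add_distrib]
    refine Finset.sum_congr rfl fun _ _ => by ring
  rw [e3]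
  refine (abs_add_le _ _).trans (add_le_add ?_ ?_)
  · refine (Finset.abs_sum_le_sum_abs _ _).trans ?_
    calc _ ≤ ∑ m : Fin M, (2 * (K * L) * (Z^K * Real.exp E) * H / (H:ℝ)^24) := by
          apply Finset.sum_le_sum
          intro m _
          rw [abs_mul, abs_pow]
          have := hps m
          simp only [Fintype.card_prod, Fintype.card_fin, Nat.cast_mul] at this
          calc _ ≤ 1 * _ := mul_le_mul (pow_le_one₀ (abs_nonneg _) ht1) this (abs_nonneg _) (by norm_num)
            _ = _ := one_mul _
      _ = _ := by simp
  · refine (Finset.abs_sum_le_sum_abs _ _).trans ?_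
    calc _ ≤ ∑ s : Fin K × Fin L, ((H:ℝ) * (Z^K * (Real.exp (17*E) / 16^(M-K)))) := by
          apply Finset.sum_le_sum
          intro s _
          rw [abs_mul]
          apply mul_le_mul _ (hkey s) (abs_nonneg _) (by positivity)
          exact_mod_cast hpH s
      _ = _ := by simp
end T3sec

section T4sec
open Finset

def Liou (e1 e2 nu de : ℝ) (h : ℕ) : Prop :=
  ∀ (s : Finset (ℕ × ℕ)) (c a b : ℕ × ℕ → ℤ) (f g : ℕ × ℕ → ℕ) (B : ℝ) (X Y : ℕ), 1 ≤ B →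
    ∑ t ∈ s, |(c t : ℝ)| ≤ B → (∀ t ∈ s, |a t| + |b t| ≤ X) → (∀ t ∈ s, f t + g t ≤ Y) →
    |∑ t ∈ s, (c t : ℝ) * e1 ^ (a t) * e2 ^ (b t) * nu ^ (f t) * de ^ (g t)| *
      (B * Real.exp (2 * h * X + h * Y)) ^ 8 < 1 →
    ∑ t ∈ s, (c t : ℝ) * e1 ^ (a t) * e2 ^ (b t) * nu ^ (f t) * de ^ (g t) = 0

theorem transc_core (e1 e2 nu de : ℝ) (h : ℕ) (he1 : 0 < e1) (he2 : 0 < e2) (hnu : 0 < nu)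
    (hde : 0 < de) (hdeh : de ≤ Real.exp h) (hL : Liou e1 e2 nu de h)
    (u1 u2 v2 q : ℤ) (p : ℕ) (al ga lam eps E Z : ℝ)
    (hal : al = e1 ^ u1 * e2 ^ (p:ℤ)) (hal1 : al ≠ 1)
    (hga : ga = (nu / de) * e1 ^ (-u2) * e2 ^ (-v2))
    (hlam : lam = Real.log al) (heps : |q * lam - Real.log ga| ≤ eps)
    (K L M R S H X : ℕ) (hH : 1 ≤ H) (hM : 0 < M) (hKM : K ≤ M) (hN : K * L = 24 * M)
    (hRS : K * L ≤ R * S) (hSq : (S:ℤ) ≤ |q|) (hZ1 : 1 ≤ Z)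
    (hZ : (S:ℝ) + L + R * |(q:ℝ)| ≤ Z) (hE : L * (Z * |lam|) ≤ E) (hLR : L * R * eps ≤ 1)
    (hX : (L:ℤ) * ((S + L) * (|u1| + p) + R * (|u2| + |v2|)) ≤ X)
    (hfin : (M * (2 * (K * L) * (Z^K * Real.exp E) * H / (H:ℝ)^24) +
          (K * L) * (H * (Z^K * (Real.exp (17*E) / 16^(M-K)))) +
          (K * L) * (H * (Z^K * (Real.exp E * (2 * (L * R * eps)))))) * Real.exp (h * (L * R)) *
          ((K * L) * (H * Z^K) * Real.exp (2 * h * X + h * (L * R))) ^ 8 < 1) : False := by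
  have halpos : 0 < al := by rw [hal]; positivity
  have hgapos : 0 < ga := by rw [hga]; positivity
  have hKpos : 0 < K := by
    rcases Nat.eq_zero_or_pos K with h0 | h0
    · rw [h0] at hN; omega
    · exact h0
  have hLpos : 0 < L := by
    rcases Nat.eq_zero_or_pos L with h0 | h0
    · rw [h0] at hN; omega
    · exact h0
  obtain ⟨P, hP0, hPH, hPs⟩ := smallF K L M H lam Z E hZ1 hE hH hM hKM hN
  have heps0 : 0 ≤ eps := (abs_nonneg _).trans heps
  have hZ0 : 0 < Z := by linarith
  obtain ⟨k0, hk0, l0, hl0, hne⟩ := hP0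
  apply hne
  have := zero_est K L R S (fun k l => (P k l : ℝ)) al ga q halpos hal1 hgapos hSq hRS hKpos ?_
    k0 hk0 l0 hl0
  · exact_mod_cast this
  intro r hr s hs
  set x : ℝ := (s:ℝ) + r * q with hx
  have hxZ : |x| ≤ Z := by
    refine le_trans ?_ hZ
    have h1 : (s:ℝ) ≤ S + L := by exact_mod_cast hs.le
    have h2 : (r:ℝ) ≤ R := by exact_mod_cast hr.le
    calc |x| ≤ |(s:ℝ)| + |(r:ℝ) * q| := abs_add_le _ _
      _ = s + r * |(q:ℝ)| := by rw [abs_mul]; simp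
      _ ≤ _ := by gcongr
  set V := ∑ k ∈ range K, ∑ l ∈ range L, (P k l : ℝ) * x ^ k * (al ^ s * ga ^ r) ^ l with hV
  set F := ∑ k ∈ range K, ∑ l ∈ range L, (P k l:ℝ) * x^k * Real.exp (l * (lam * x)) with hF
  have hFb := hPs x hxZ
  have hterm : ∀ k < K, ∀ l < L, |(P k l : ℝ) * x^k| ≤ H * Z^K := by
    intro k hk l hl
    rw [abs_mul, abs_pow]
    apply mul_le_mul
    · exact_mod_cast hPH k l
    · calc |x|^k ≤ Z^k := pow_le_pow_left₀ (abs_nonneg _) hxZ _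
        _ ≤ Z^K := pow_le_pow_right₀ hZ1 hk.le
    · positivity
    · positivity
  have hdiff : |V - F| ≤ (K * L) * (H * (Z^K * (Real.exp E * (2 * (L * R * eps))))) := by
    rw [hV, hF, ← Finset.sum_sub_distrib]
    refine (Finset.abs_sum_le_sum_abs _ _).trans ?_
    calc _ ≤ ∑ k ∈ range K, ∑ l ∈ range L, (H * (Z^K * (Real.exp E * (2 * (L * R * eps))))) := by
          apply Finset.sum_le_sum
          intro k hk
          rw [← Finset.sum_sub_distrib]
          refine (Finset.abs_sum_le_sum_abs _ _).trans ?_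
          apply Finset.sum_le_sum
          intro l hl
          have hk' := mem_range.1 hk
          have hl' := mem_range.1 hl
          rw [← mul_sub, abs_mul, ← mul_assoc (H:ℝ)]
          apply mul_le_mul (hterm k hk' l hl') _ (abs_nonneg _) (by positivity)
          have hla : al = Real.exp lam := by rw [hlam, Real.exp_log halpos]
          set mu := Real.log ga with hmu
          have hga' : ga = Real.exp mu := by rw [hmu, Real.exp_log hgapos]
          have e1 : (al ^ s * ga ^ r) ^ l = Real.exp (l * (lam * x)) *
              Real.exp (l * r * (mu - q * lam)) := by
            rw [hla, hga', ← Real.exp_nat_mul, ← Real.exp_nat_mul, ← Real.exp_add,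
              ← Real.exp_nat_mul, ← Real.exp_add, hx]
            congr 1; ring
          rw [e1, ← mul_sub_one, abs_mul, Real.abs_exp]
          have hll : (l:ℝ) ≤ L := by exact_mod_cast hl'.le
          have hrr : (r:ℝ) ≤ R := by exact_mod_cast hr.le
          have h4 : |(l:ℝ) * r * (mu - q * lam)| ≤ L * R * eps := by
            rw [abs_mul, abs_mul, Nat.abs_cast, Nat.abs_cast, abs_sub_comm]
            gcongr
          apply mul_le_mul _ _ (abs_nonneg _) (Real.exp_pos _).le
          · apply Real.exp_le_exp.2
            refine le_trans (le_abs_self _) (le_trans ?_ hE)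
            rw [abs_mul, abs_mul, Nat.abs_cast, mul_comm |lam|]
            gcongr
          · calc _ ≤ 2 * |(l:ℝ) * r * (mu - q * lam)| := Real.abs_exp_sub_one_le (h4.trans hLR)
              _ ≤ _ := by gcongr
      _ = _ := by simp; ring
  have hVb : |V| ≤ M * (2 * (K * L) * (Z^K * Real.exp E) * H / (H:ℝ)^24) +
          (K * L) * (H * (Z^K * (Real.exp (17*E) / 16^(M-K)))) +
          (K * L) * (H * (Z^K * (Real.exp E * (2 * (L * R * eps))))) := by
    have : V = F + (V - F) := by ring
    rw [this]
    exact (abs_add_le _ _).trans (add_le_add hFb hdiff)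
  have hL' := hL (range K ×ˢ range L) (fun t => P t.1 t.2 * ((s:ℤ) + r * q)^t.1)
    (fun t => t.2 * (s * u1 - r * u2)) (fun t => t.2 * (s * p - r * v2))
    (fun t => t.2 * r) (fun t => L * R - t.2 * r) ((K * L) * (H * Z^K)) X (L * R)
  have hB1 : 1 ≤ ((K:ℝ) * L) * (H * Z^K) := by
    have h1 : (1:ℝ) ≤ K := by exact_mod_cast hKpos
    have h2 : (1:ℝ) ≤ L := by exact_mod_cast hLpos
    have h3 : (1:ℝ) ≤ H := by exact_mod_cast hH
    have h4 : (1:ℝ) ≤ Z^K := one_le_pow₀ hZ1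
    exact one_le_mul_of_one_le_of_one_le (one_le_mul_of_one_le_of_one_le h1 h2)
      (one_le_mul_of_one_le_of_one_le h3 h4)
  have hlr : ∀ l < L, l * r ≤ L * R := fun l hl => Nat.mul_le_mul hl.le hr.le
  have hsumeq : ∑ t ∈ range K ×ˢ range L, (((P t.1 t.2 * ((s:ℤ) + r * q)^t.1 : ℤ)):ℝ) *
      e1 ^ ((t.2:ℤ) * (s * u1 - r * u2)) * e2 ^ ((t.2:ℤ) * (s * p - r * v2)) *
      nu ^ (t.2 * r) * de ^ (L * R - t.2 * r) = V * de ^ (L * R) := by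
    rw [hV, Finset.sum_product, Finset.sum_mul]
    refine Finset.sum_congr rfl fun k _ => ?_
    rw [Finset.sum_mul]
    refine Finset.sum_congr rfl fun l hl => ?_
    have hl' := mem_range.1 hl
    have hd : de ^ (L * R) = de ^ (L * R - l * r) * de ^ (l * r) := by
      rw [← pow_add]; congr 1; have := hlr l hl'; omega
    rw [hd]
    have e3 : (al ^ s * ga ^ r) ^ l = e1 ^ ((l:ℤ) * (s * u1 - r * u2)) *
        e2 ^ ((l:ℤ) * (s * p - r * v2)) * nu ^ (l * r) / de ^ (l * r) := by
      rw [hal, hga]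
      have n1 := he1.ne'
      have n2 := he2.ne'
      rw [mul_pow, mul_pow, mul_pow, mul_pow, mul_pow, mul_pow, mul_pow, div_pow, div_pow]
      simp only [← zpow_natCast, ← zpow_mul]
      have f1 : e1 ^ ((l:ℤ) * (s * u1 - r * u2)) = e1 ^ (u1 * s * l) * e1 ^ (-u2 * r * l) := by
        rw [← zpow_add₀ n1]; congr 1; ring
      have f2 : e2 ^ ((l:ℤ) * (s * p - r * v2)) = e2 ^ ((p:ℤ) * s * l) * e2 ^ (-v2 * r * l) := by
        rw [← zpow_add₀ n2]; congr 1; ring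
      rw [f1, f2]
      push_cast
      rw [mul_comm (l:ℤ) r]
      ring
    rw [e3]
    push_cast
    rw [← hx]
    field_simp
  have hc : ∑ t ∈ range K ×ˢ range L, |(((P t.1 t.2 * ((s:ℤ) + r * q)^t.1 : ℤ)):ℝ)|
      ≤ (K * L) * (H * Z^K) := by
    calc _ ≤ ∑ t ∈ range K ×ˢ range L, ((H:ℝ) * Z^K) := by
          apply Finset.sum_le_sum
          intro t ht
          have := Finset.mem_product.1 ht
          have h5 := hterm t.1 (mem_range.1 this.1) t.2 (mem_range.1 this.2)
          push_cast
          exact h5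
      _ = _ := by simp
  have hexp : ∀ t ∈ range K ×ˢ range L, |(t.2:ℤ) * (s * u1 - r * u2)| + |(t.2:ℤ) * (s * p - r * v2)| ≤ X := by
    intro t ht
    have := Finset.mem_product.1 ht
    have hl' := mem_range.1 this.2
    refine le_trans ?_ hX
    have hll : (t.2:ℤ) ≤ L := by exact_mod_cast hl'.le
    have hrr : (r:ℤ) ≤ R := by exact_mod_cast hr.le
    have hss : (s:ℤ) ≤ S + L := by exact_mod_cast hs.le
    have a1 : |(s:ℤ) * u1 - r * u2| ≤ s * |u1| + r * |u2| := by
      refine (abs_sub _ _).trans ?_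
      rw [abs_mul, abs_mul, Nat.abs_cast, Nat.abs_cast]
    have a2 : |(s:ℤ) * p - r * v2| ≤ s * p + r * |v2| := by
      refine (abs_sub _ _).trans ?_
      rw [abs_mul, abs_mul, Nat.abs_cast, Nat.abs_cast, Nat.abs_cast]
    rw [abs_mul, abs_mul, Nat.abs_cast, ← mul_add]
    have a3 : (0:ℤ) ≤ |u1| := abs_nonneg _
    have a4 : (0:ℤ) ≤ |u2| := abs_nonneg _
    have a5 : (0:ℤ) ≤ |v2| := abs_nonneg _
    calc (t.2:ℤ) * (|(s:ℤ) * u1 - r * u2| + |(s:ℤ) * p - r * v2|)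
        ≤ L * ((s * |u1| + r * |u2|) + (s * p + r * |v2|)) := by gcongr
      _ = L * (s * (|u1| + p) + r * (|u2| + |v2|)) := by ring
      _ ≤ _ := by gcongr
  have hfg : ∀ t ∈ range K ×ˢ range L, t.2 * r + (L * R - t.2 * r) ≤ L * R := by
    intro t ht
    have := Finset.mem_product.1 ht
    have := hlr t.2 (mem_range.1 this.2)
    omega
  have hres := hL' hB1 hc hexp hfg ?_
  · rw [hsumeq] at hres
    have hdd : de ^ (L * R) ≠ 0 := by positivity
    exact (mul_eq_zero.1 hres).resolve_right hdd
  · rw [hsumeq]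
    refine lt_of_le_of_lt ?_ hfin
    push_cast
    have hd2 : de ^ (L * R) ≤ Real.exp (h * (L * R)) := by
      calc de ^ (L * R) ≤ (Real.exp h)^(L * R) := pow_le_pow_left₀ hde.le hdeh _
        _ = _ := by rw [← Real.exp_nat_mul]; push_cast; congr 1; ring
    rw [abs_mul, abs_of_pos (pow_pos hde _)]
    gcongr
end T4sec

section T5sec
open Finset

theorem fin_numeric (W KL M2 ZK eE e17 H p16 w3 eh ex : ℝ) (hW : 4 ≤ W) (hKL : KL ≤ W) (hKL0 : 0 ≤ KL)
    (hM0 : 0 ≤ M2) (hM2 : 2 * M2 ≤ W) (hZ0 : 0 ≤ ZK) (hZ : ZK ≤ W^4) (hE0 : 0 ≤ eE) (hE : eE ≤ W)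
    (h170 : 0 ≤ e17) (h17 : e17 ≤ W) (hH : H = W^6) (hp : W^127 ≤ p16) (hw0 : 0 ≤ w3)
    (hw : w3 * W^111 ≤ 1) (he0 : 0 ≤ eh) (he : eh ≤ W) (hx0 : 0 ≤ ex) (hx : ex ≤ W) :
    (M2 * (2 * KL * (ZK * eE) * H / H^24) + KL * (H * (ZK * (e17 / p16))) +
      KL * (H * (ZK * (eE * w3)))) * eh * (KL * (H * ZK) * ex) ^ 8 < 1 := by
  have hW0 : 0 < W := by linarith
  have hp0 : 0 < p16 := lt_of_lt_of_le (by positivity) hp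
  have hw' : w3 ≤ 1 / W^111 := by rw [le_div_iff₀ (by positivity)]; exact hw
  subst hH
  have t1 : M2 * (2 * KL * (ZK * eE) * W^6 / (W^6)^24) ≤ W^13 / W^144 := by
    rw [← pow_mul]
    calc _ = (2 * M2) * (KL * (ZK * eE) * W^6) / W^(6*24) := by ring
      _ ≤ W * (W * (W^4 * W) * W^6) / W^(6*24) := by gcongr
      _ = _ := by ring
  have t2 : KL * (W^6 * (ZK * (e17 / p16))) ≤ W^12 / W^127 := by
    calc _ ≤ W * (W^6 * (W^4 * (W / W^127))) := by gcongr
      _ = _ := by ring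
  have t3 : KL * (W^6 * (ZK * (eE * w3))) ≤ W^12 / W^111 := by
    calc _ ≤ W * (W^6 * (W^4 * (W * (1 / W^111)))) := by gcongr
      _ = _ := by ring
  have t4 : (KL * (W^6 * ZK) * ex)^8 ≤ W^96 := by
    calc _ ≤ (W * (W^6 * W^4) * W)^8 := by gcongr
      _ = _ := by ring
  calc _ ≤ (W^13 / W^144 + W^12 / W^127 + W^12 / W^111) * W * W^96 := by gcongr
    _ = 1/W^34 + 1/W^18 + 1/W^2 := by field_simp
    _ ≤ 1/W + 1/W + 1/W := by
      have : ∀ k : ℕ, 1 ≤ k → 1/W^k ≤ 1/W := by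
        intro k hk
        apply one_div_le_one_div_of_le hW0
        calc W = W^1 := (pow_one _).symm
          _ ≤ W^k := pow_le_pow_right₀ (by linarith) hk
      exact add_le_add (add_le_add (this _ (by norm_num)) (this _ (by norm_num))) (this _ (by norm_num))
    _ < 1 := by
      have : 1/W ≤ 1/4 := one_div_le_one_div_of_le (by norm_num) hW
      linarith

theorem key_pow (m : ℕ) (hm : 84 ≤ m) : 129024 * m * 2000 * (768 * m)^3 ≤ 2^m := by
  induction m, hm using Nat.le_induction with
  | base => norm_num
  | succ k hk ih =>
    have h1 : (k+1)^4 ≤ 2 * k^4 := by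
      have : 1 * 84 ≤ k := by omega
      nlinarith [pow_pos (show 0 < k by omega) 3, pow_pos (show 0 < k by omega) 2, Nat.mul_le_mul hk (le_refl (k^3)), Nat.mul_le_mul hk (le_refl (k^2)), Nat.mul_le_mul hk (le_refl (k))]
    calc 129024 * (k+1) * 2000 * (768 * (k+1))^3 = (129024*2000*768^3) * (k+1)^4 := by ring
      _ ≤ (129024*2000*768^3) * (2 * k^4) := by gcongr
      _ = 2 * (129024 * k * 2000 * (768 * k)^3) := by ring
      _ ≤ 2 * 2^k := by gcongr
      _ = 2^(k+1) := by ring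
end T5sec

section T6sec
open Finset

theorem nat_aux1 (m K : ℕ) (hm : 84 ≤ m) (hK : 8000 ≤ K) : K + 1 ≤ m * K := by nlinarith
theorem nat_aux2 (m K : ℕ) (hm : 84 ≤ m) (hK : 8000 ≤ K) : K + m ≤ m * K := by nlinarith

set_option maxHeartbeats 4000000 in
theorem transc_mid (e1 e2 nu de : ℝ) (h : ℕ) (he1 : 0 < e1) (he2 : 0 < e2) (hnu : 0 < nu)
    (hde : 0 < de) (hdeh : de ≤ Real.exp h) (hLi : Liou e1 e2 nu de h)
    (u1 u2 v2 q : ℤ) (p : ℕ) (al ga lam eps V : ℝ)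
    (hal : al = e1 ^ u1 * e2 ^ (p:ℤ)) (hal1 : al ≠ 1)
    (hga : ga = (nu / de) * e1 ^ (-u2) * e2 ^ (-v2))
    (hlam : lam = Real.log al) (heps : |q * lam - Real.log ga| ≤ eps)
    (m : ℕ) (hm : 84 ≤ m) (hh1 : 1 ≤ h) (hh2 : h ≤ 2000)
    (hp1 : 1 ≤ p) (hpT : (p:ℝ) ≤ 2^m) (hq1 : (4:ℝ)^m ≤ 2 * |(q:ℝ)|)
    (hq2 : (p:ℝ) * |(q:ℝ)| ≤ 2 * 8^(m+1)) (hu1 : |u1| ≤ p)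
    (hu2 : |(u2:ℝ)| + |(v2:ℝ)| ≤ 2 * p + |(q:ℝ)| / 2^m)
    (hl : |lam| ≤ 5 * h / 2^m) (hV : (p:ℝ) * |(q:ℝ)| ≤ 2 * V) (he : eps ≤ Real.exp (-(h * V / 2))) :
    False := by
  have heps0 : 0 ≤ eps := (abs_nonneg _).trans heps
  have hmR : (84:ℝ) ≤ m := by exact_mod_cast hm
  have hhR : (1:ℝ) ≤ h := by exact_mod_cast hh1
  have hhR2 : (h:ℝ) ≤ 2000 := by exact_mod_cast hh2
  have hpR : (1:ℝ) ≤ p := by exact_mod_cast hp1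
  set T : ℝ := 2^m with hT
  set L : ℕ := 768 * m with hL
  have hLR : (L:ℝ) = 768 * m := by rw [hL]; push_cast; ring
  have hL1 : (64512:ℝ) ≤ L := by rw [hLR]; linarith
  have hkey : 129024 * m * h * (L:ℝ)^3 ≤ T := by
    have h1 := key_pow m hm
    have h2 : (129024:ℝ) * m * 2000 * (768 * m)^3 ≤ 2^m := by exact_mod_cast h1
    rw [hLR]
    refine le_trans ?_ h2
    gcongr
  set Q : ℝ := |(q:ℝ)| with hQ
  have hTpos : 0 < T := by positivity
  have hT4 : T * T ≤ 2 * Q := by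
    refine le_trans (le_of_eq ?_) hq1
    rw [hT, ← mul_pow]; norm_num
  set c : ℝ := 16 * h * (L:ℝ)^2 with hc
  have hL3 : (L:ℝ)^2 * 64512 ≤ (L:ℝ)^3 := by nlinarith [sq_nonneg (L:ℝ)]
  have hcT : 64 * c ≤ T := by
    refine le_trans ?_ hkey
    rw [hc]
    have : (1:ℝ) * h * (L:ℝ)^3 ≤ m * h * (L:ℝ)^3 := by gcongr; linarith
    have h2 : (h:ℝ) * ((L:ℝ)^2 * 64512) ≤ h * (L:ℝ)^3 := by gcongr
    nlinarith
  have hcL : 1 + (L:ℝ) ≤ c := by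
    rw [hc]
    nlinarith [sq_nonneg (L:ℝ)]
  have hcpos : 0 < c := by linarith
  have hT2 : 64 ≤ T := by linarith
  set w : ℝ := Q / T with hw
  have hwQ : w * T = Q := by rw [hw]; field_simp
  have hwT : T ≤ 2 * w := by
    apply le_of_mul_le_mul_right _ hTpos
    rw [mul_assoc, hwQ]; exact hT4
  have hw16 : 32 ≤ w := by linarith
  set G : ℝ := (h:ℝ)^2 * (L:ℝ)^3 * p * w with hG
  have hLc : (1:ℝ) ≤ (L:ℝ)^3 := one_le_pow₀ (by linarith)
  have hh2' : (1:ℝ) ≤ (h:ℝ)^2 := one_le_pow₀ hhR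
  have hG1 : 32 ≤ G := by
    have : (1:ℝ) * 1 * 1 * w ≤ G := by rw [hG]; gcongr
    linarith
  have hQpos : 0 < Q := by
    have : 0 < T * T := by positivity
    linarith
  have hQ64 : 64 ≤ Q := by
    rw [← hwQ]
    calc (64:ℝ) ≤ 32 * 64 := by norm_num
      _ ≤ w * T := by gcongr
  set K : ℕ := ⌊256 * G⌋₊ with hK
  have hK1 : (K:ℝ) ≤ 256 * G := Nat.floor_le (by linarith)
  have hK2 : 256 * G < K + 1 := Nat.lt_floor_add_one _
  have hKbig : (8000:ℝ) ≤ K := by linarith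
  have hKbigN : 8000 ≤ K := by exact_mod_cast hKbig
  set R : ℕ := 16 * h * L^2 * p with hR
  have hRr : (R:ℝ) = c * p := by rw [hR, hc]; push_cast; ring
  set S : ℕ := ⌊c * w⌋₊ + 1 with hS
  have hS1 : c * w ≤ S := by rw [hS]; push_cast; exact (Nat.lt_floor_add_one _).le
  have hS2 : (S:ℝ) ≤ c * w + 1 := by
    rw [hS]; push_cast
    have := Nat.floor_le (show 0 ≤ c * w by positivity)
    linarith
  have hcw : c * w * 64 ≤ Q := by
    rw [← hwQ]
    calc c * w * 64 = w * (64 * c) := by ring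
      _ ≤ w * T := by gcongr
  have hSQ : (S:ℤ) ≤ |q| := by
    have : (S:ℝ) ≤ Q := by linarith
    rw [hQ] at this
    exact_mod_cast this
  set M : ℕ := K * (32 * m) with hM
  have hKL : K * L = 24 * M := by rw [hL, hM]; ring
  have hKM : K ≤ M := by rw [hM]; exact Nat.le_mul_of_pos_right _ (by omega)
  have hKLr : (K:ℝ) * L ≤ R * S := by
    calc (K:ℝ) * L ≤ 256 * G * L := by gcongr
      _ = c * p * (c * w) := by rw [hG, hc]; ring
      _ ≤ R * S := by rw [hRr]; gcongr
  have hRS : K * L ≤ R * S := by exact_mod_cast hKLr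
  set Z : ℝ := 2 * c * p * Q with hZ
  have hcQ : c * w + 1 + L ≤ c * p * Q := by
    have h1 : c * 1 * Q ≤ c * p * Q := by gcongr
    have h2 : c * Q ≥ c * 64 := by
      gcongr
    have : c * w ≤ c * Q / 64 := by
      have : w ≤ Q / 64 := by
        rw [← hwQ, le_div_iff₀ (by norm_num)]; gcongr
      calc c * w ≤ c * (Q/64) := by gcongr
        _ = _ := by ring
    linarith
  have hZS : (S:ℝ) + L + R * |(q:ℝ)| ≤ Z := by
    rw [hRr, hZ, ← hQ]
    linarith
  have hZ1 : 1 ≤ Z := by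
    have : 0 ≤ (S:ℝ) := by positivity
    have : 0 ≤ (R:ℝ) * |(q:ℝ)| := by positivity
    linarith
  have hE : L * (Z * |lam|) ≤ K := by
    calc L * (Z * |lam|) ≤ L * (Z * (5 * h / T)) := by gcongr
      _ = 160 * G := by rw [hZ, hG, hc, hw]; ring
      _ ≤ K := by linarith
  set X : ℕ := ((L:ℤ) * ((S + L) * (|u1| + p) + R * (|u2| + |v2|))).toNat with hX
  have hX0 : (0:ℤ) ≤ (L:ℤ) * ((S + L) * (|u1| + p) + R * (|u2| + |v2|)) := by positivity
  have hX1 : (X:ℤ) = (L:ℤ) * ((S + L) * (|u1| + p) + R * (|u2| + |v2|)) := Int.toNat_of_nonneg hX0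
  have hXr : (X:ℝ) = L * ((S + L) * (|(u1:ℝ)| + p) + R * (|(u2:ℝ)| + |(v2:ℝ)|)) := by
    have := congrArg (fun z : ℤ => (z:ℝ)) hX1
    push_cast at this
    exact this
  have hu1r : |(u1:ℝ)| ≤ p := by exact_mod_cast hu1
  have hp2w : (p:ℝ) ≤ 2 * w := hpT.trans hwT
  have hXb : (X:ℝ) ≤ 9 * L * c * p * w := by
    rw [hXr]
    have h1 : (S:ℝ) + L ≤ 2 * (c * w) := by
      have : c * 32 ≤ c * w := by gcongr
      linarith
    calc (L:ℝ) * ((S + L) * (|(u1:ℝ)| + p) + R * (|(u2:ℝ)| + |(v2:ℝ)|))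
        ≤ L * (2 * (c * w) * (p + p) + c * p * (2 * (2 * w) + w)) := by
          rw [hRr]
          have h2 : |(u2:ℝ)| + |(v2:ℝ)| ≤ 2 * (2 * w) + w := by
            refine hu2.trans ?_
            rw [hw]; rw [hw] at hp2w; linarith
          gcongr
      _ = _ := by ring
  have hhX : 2 * h * (X:ℝ) ≤ 288 * G := by
    calc 2 * h * (X:ℝ) ≤ 2 * h * (9 * L * c * p * w) := by gcongr
      _ = _ := by rw [hG, hc]; ring
  have hhLR : (h:ℝ) * (L * R) ≤ G := by
    rw [hRr, hG, hc]
    calc (h:ℝ) * (L * (16 * h * (L:ℝ)^2 * p)) = (h:ℝ)^2 * (L:ℝ)^3 * p * 16 := by ring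
      _ ≤ _ := by gcongr; linarith
  have hLRG : (L:ℝ) * R ≤ G := by
    refine le_trans ?_ hhLR
    have : (0:ℝ) ≤ L * R := by positivity
    calc (L:ℝ) * R = 1 * (L * R) := by ring
      _ ≤ h * (L * R) := by gcongr
  set W : ℝ := 2^(m*K) with hWd
  have hWexp : ∀ x : ℝ, x ≤ 17 * K → Real.exp x ≤ W := by
    intro x hx
    have h1 : Real.exp 1 ≤ 4 := by linarith [Real.exp_one_lt_d9]
    calc Real.exp x ≤ Real.exp ((17 * K : ℕ) * 1) := by
          apply Real.exp_le_exp.2; push_cast; linarith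
      _ = (Real.exp 1)^(17*K) := Real.exp_nat_mul _ _
      _ ≤ 4^(17*K) := by gcongr
      _ = 2^(34*K) := by rw [show (4:ℝ) = 2^2 by norm_num, ← pow_mul]; congr 1; ring
      _ ≤ W := pow_le_pow_right₀ (by norm_num) (Nat.mul_le_mul_right _ (by omega))
  have hKW : 2 * (K:ℝ) ≤ W := by
    have h1 : K < 2^K := Nat.lt_two_pow_self
    have h2 : (K:ℝ) ≤ 2^K := by exact_mod_cast h1.le
    calc 2 * (K:ℝ) ≤ 2 * 2^K := by gcongr
      _ = 2^(K+1) := by ring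
      _ ≤ W := pow_le_pow_right₀ (by norm_num) (nat_aux1 m K hm hKbigN)
  have hW4 : 4 ≤ W := by linarith
  have hKLW : (K:ℝ) * L ≤ W := by
    have h1 : K < 2^K := Nat.lt_two_pow_self
    have h2 : (K:ℝ) ≤ 2^K := by exact_mod_cast h1.le
    have h3 : (L:ℝ) ≤ 2^m := by
      rw [← hT]; linarith
    calc (K:ℝ) * L ≤ 2^K * 2^m := by gcongr
      _ = 2^(K+m) := by rw [pow_add]
      _ ≤ W := pow_le_pow_right₀ (by norm_num) (nat_aux2 m K hm hKbigN)
  have hZW : Z^K ≤ W^4 := by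
    have h1 : Z ≤ 2^(4*m) := by
      calc Z = 2 * c * (p * Q) := by rw [hZ]; ring
        _ ≤ 2 * c * (2 * 8^(m+1)) := by gcongr
        _ = 32 * c * 8^m := by ring
        _ ≤ T * 8^m := by gcongr; linarith
        _ = 2^(4*m) := by rw [hT, ← mul_pow, pow_mul]; norm_num
    calc Z^K ≤ (2^(4*m))^K := pow_le_pow_left₀ (by linarith) h1 _
      _ = W^4 := by rw [hWd, ← pow_mul, ← pow_mul]; congr 1; ring
  have h16 : W^127 ≤ 16^(M-K) := by
    rw [hWd, show (16:ℝ) = 2^4 by norm_num, ← pow_mul, ← pow_mul]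
    apply pow_le_pow_right₀ (by norm_num)
    have : 4 * K ≤ m * K := Nat.mul_le_mul_right _ (by omega)
    have : M = 32 * (m * K) := by rw [hM]; ring
    omega
  have hepsW : W^112 * eps ≤ 1 := by
    have h1 : W^112 ≤ Real.exp (112 * (m * K)) := by
      have h2 : (2:ℝ) ≤ Real.exp 1 := by linarith [Real.exp_one_gt_d9]
      calc W^112 = 2^(m*K*112) := by rw [hWd, ← pow_mul]
        _ ≤ (Real.exp 1)^(m*K*112) := by gcongr
        _ = Real.exp (112 * (m * K)) := by
          rw [← Real.exp_nat_mul]; push_cast; congr 1; ring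
    have h3 : 112 * ((m:ℝ) * K) ≤ h * V / 2 := by
      have hVT : (p:ℝ) * w * T ≤ 2 * V := by rw [mul_assoc, hwQ]; exact hV
      calc 112 * ((m:ℝ) * K) ≤ 112 * (m * (256 * G)) := by gcongr
        _ = (28672 * m * h * (L:ℝ)^3) * (h * (p * w)) := by rw [hG]; ring
        _ ≤ (T/4) * (h * (p * w)) := by gcongr; linarith
        _ = h * (p * w * T) / 4 := by ring
        _ ≤ h * (2 * V) / 4 := by gcongr
        _ = _ := by ring
    calc W^112 * eps ≤ Real.exp (112 * (m * K)) * Real.exp (-(h * V / 2)) := by gcongr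
      _ = Real.exp (112 * (m * K) - h * V / 2) := by rw [← Real.exp_add]; congr 1
      _ ≤ 1 := Real.exp_le_one_iff.2 (by linarith)
  have hw3 : (2 * (L * R * eps)) * W^111 ≤ 1 := by
    refine le_trans ?_ hepsW
    have : 2 * ((L:ℝ) * R) ≤ W := by linarith
    calc (2 * (L * R * eps)) * W^111 = (2 * ((L:ℝ) * R)) * (W^111 * eps) := by ring
      _ ≤ W * (W^111 * eps) := by gcongr
      _ = _ := by ring
  have hWone : 1 ≤ W^111 := one_le_pow₀ (by linarith)
  have hLReps : L * R * eps ≤ 1 := by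
    have h0 : 0 ≤ 2 * (L * R * eps) := by positivity
    have h1 : 2 * (L * R * eps) * 1 ≤ (2 * (L * R * eps)) * W^111 := by gcongr
    linarith
  set H : ℕ := 2^(6*(m*K)) with hH
  have hHr : (H:ℝ) = W^6 := by rw [hH, hWd]; push_cast; rw [← pow_mul]; congr 1; ring
  have hMr : (K:ℝ) * L = 24 * M := by exact_mod_cast hKL
  have hfin := fin_numeric W ((K:ℝ) * L) M (Z^K) (Real.exp K) (Real.exp (17*K)) H (16^(M-K))
    (2 * (L * R * eps)) (Real.exp (h * (L * R))) (Real.exp (2 * h * X + h * (L * R)))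
    hW4 hKLW (by positivity) (by positivity) (by have : (0:ℝ) ≤ M := by positivity
                                                 linarith)
    (by positivity) hZW (by positivity) (hWexp _ (by linarith)) (by positivity) (hWexp _ le_rfl) hHr
    h16 (by positivity) hw3 (by positivity) (hWexp _ (by linarith)) (by positivity)
    (hWexp _ (by linarith))
  exact transc_core e1 e2 nu de h he1 he2 hnu hde hdeh hLi u1 u2 v2 q p al ga lam eps K Z hal hal1
    hga hlam heps K L M R S H X (by rw [hH]; exact Nat.one_le_two_pow) (by rw [hM]; positivity) hKM hKL hRS hSQ hZ1 hZS hE hLReps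
    hX1.ge hfin
end T6sec

section T7sec
open Finset

set_option maxHeartbeats 1000000 in
theorem transc (e1 e2 nu de : ℝ) (h : ℕ) (he1 : 0 < e1) (he2 : 0 < e2) (hnu : 0 < nu)
    (hde : 0 < de) (hdeh : de ≤ Real.exp h) (hLi : Liou e1 e2 nu de h)
    (hh1 : 1 ≤ h) (hh2 : h ≤ 2000) (hl1 : |Real.log e1| ≤ 2 * h)
    (hl3 : |Real.log (nu / de)| ≤ 2 * h) (hind : ∀ a b : ℤ, e1 ^ a * e2 ^ b = 1 → b = 0)
    (u v : ℤ) (huv : |u| ≤ |v|) (hv : (8:ℤ)^84 ≤ |v|)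
    (hL : |u * Real.log e1 + v * Real.log e2 - Real.log (nu / de)| ≤ Real.exp (-(h * |(v:ℝ)| / 2))) :
    False := by
  have hhR : (1:ℝ) ≤ h := by exact_mod_cast hh1
  obtain ⟨m, hm, hm1, hm2⟩ : ∃ m : ℕ, 84 ≤ m ∧ (8:ℝ)^m ≤ |(v:ℝ)| ∧ |(v:ℝ)| < 8^(m+1) := by
    have hv1 : 8^84 ≤ v.natAbs := by
      zify; exact hv
    have hv0 : v.natAbs ≠ 0 := by
      have : 0 < 8^84 := by norm_num
      omega
    refine ⟨Nat.log 8 v.natAbs, ?_, ?_, ?_⟩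
    · exact Nat.le_log_of_pow_le (by norm_num) hv1
    · have := Nat.pow_log_le_self 8 hv0
      have h2 : ((8:ℝ))^(Nat.log 8 v.natAbs) ≤ (v.natAbs:ℝ) := by exact_mod_cast this
      rwa [Nat.cast_natAbs, Int.cast_abs] at h2
    · have := Nat.lt_pow_succ_log_self (b := 8) (by norm_num) v.natAbs
      have h2 : (v.natAbs:ℝ) < ((8:ℝ))^(Nat.log 8 v.natAbs + 1) := by exact_mod_cast this
      rwa [Nat.cast_natAbs, Int.cast_abs] at h2
  set A : ℝ := |(v:ℝ)| with hA
  have h8 : (0:ℝ) < 8^m := by positivity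
  have hApos : 0 < A := by linarith
  have hv0 : (v:ℝ) ≠ 0 := abs_pos.1 hApos
  set xi : ℝ := (u:ℝ) / v with hxi
  have huxi : (u:ℝ) = xi * v := by rw [hxi]; field_simp
  have hxi1 : |xi| ≤ 1 := by
    rw [hxi, abs_div, div_le_one (by rw [← hA]; exact hApos)]
    exact_mod_cast huv
  obtain ⟨u1, p', hp0, hpn, hdir⟩ := Real.exists_int_int_abs_mul_sub_le xi (n := 2^m) (by positivity)
  obtain ⟨p, rfl⟩ := Int.eq_ofNat_of_zero_le hp0.le
  set T : ℝ := 2^m with hT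
  have hTpos : 0 < T := by positivity
  have hT84 : (4:ℝ) ≤ T := by
    calc (4:ℝ) = 2^2 := by norm_num
      _ ≤ T := pow_le_pow_right₀ (by norm_num) (by omega)
  have hdir' : |(p:ℝ) * xi - u1| ≤ 1 / T := by
    have h1 : |(p:ℝ) * xi - u1| ≤ 1 / (T + 1) := by
      have := hdir; push_cast at this; exact this
    refine h1.trans (one_div_le_one_div_of_le hTpos (by linarith))
  have hpT : (p:ℝ) ≤ T := by
    have : (p:ℤ) ≤ 2^m := by exact_mod_cast hpn
    rw [hT]; exact_mod_cast this
  have hp1 : 1 ≤ p := by omega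
  have hpR : (1:ℝ) ≤ p := by exact_mod_cast hp1
  have hu1 : |u1| ≤ p := by
    have h1 : |(u1:ℝ)| < p + 1 := by
      have e : (u1:ℝ) = p * xi - (p * xi - u1) := by ring
      rw [e]
      have h2 : |(p:ℝ) * xi| ≤ p := by
        rw [abs_mul, Nat.abs_cast]; nlinarith
      have h3 : 1 / T ≤ 1/4 := one_div_le_one_div_of_le (by norm_num) hT84
      linarith [abs_sub ((p:ℝ) * xi) (p * xi - u1)]
    have h2 : |u1| < (p:ℤ) + 1 := by exact_mod_cast h1
    omega
  set q : ℤ := v / p with hq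
  set v2 : ℤ := v % p with hv2
  have hqv : v = q * p + v2 := by rw [hq, hv2]; exact (Int.ediv_mul_add_emod v p).symm
  have hv2a : 0 ≤ v2 := Int.emod_nonneg _ (by omega)
  have hv2b : v2 < p := Int.emod_lt_of_pos _ (by omega)
  have hqvR : (v:ℝ) = q * p + v2 := by exact_mod_cast hqv
  have hv2aR : (0:ℝ) ≤ v2 := by exact_mod_cast hv2a
  have hv2bR : (v2:ℝ) ≤ p := by exact_mod_cast hv2b.le
  set u2 : ℤ := u - q * u1 with hu2
  have hu2R : (u2:ℝ) = u - q * u1 := by rw [hu2]; push_cast; ring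
  have hu2e : (u2:ℝ) = xi * v2 + q * (p * xi - u1) := by
    rw [hu2R, huxi, hqvR]; ring
  have hQp : |(q:ℝ)| * p = |(v:ℝ) - v2| := by
    rw [hqvR, add_sub_cancel_right, abs_mul, Nat.abs_cast]
  have hQp1 : |(q:ℝ)| * p ≤ A + p := by
    rw [hQp]
    refine (abs_sub _ _).trans ?_
    rw [abs_of_nonneg hv2aR, ← hA]; linarith
  have hQp2 : A - p ≤ |(q:ℝ)| * p := by
    rw [hQp]
    have := abs_sub_abs_le_abs_sub (v:ℝ) v2
    rw [abs_of_nonneg hv2aR, ← hA] at this; linarith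
  have h8T : (8:ℝ)^m = T * T * T := by rw [hT, ← mul_pow, ← mul_pow]; norm_num
  have h4T : (4:ℝ)^m = T * T := by rw [hT, ← mul_pow]; norm_num
  have hTA : T * T * T ≤ A := by rw [← h8T]; exact hm1
  have hTle : T * 16 ≤ T * T * T := by
    have : T * (4 * 4) ≤ T * (T * T) := by gcongr
    linarith
  have hpA : (p:ℝ) ≤ A := by linarith
  have hal0 : 0 < e1 ^ u1 * e2 ^ (p:ℤ) := by positivity
  have hlogal : Real.log (e1 ^ u1 * e2 ^ (p:ℤ)) = u1 * Real.log e1 + p * Real.log e2 := by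
    rw [Real.log_mul (by positivity) (by positivity), Real.log_zpow, Real.log_zpow]; push_cast; ring
  have hlogga : Real.log ((nu / de) * e1 ^ (-u2) * e2 ^ (-v2)) =
      Real.log (nu / de) - u2 * Real.log e1 - v2 * Real.log e2 := by
    rw [Real.log_mul (by positivity) (by positivity), Real.log_mul (by positivity) (by positivity),
      Real.log_zpow, Real.log_zpow]; push_cast; ring
  set l1 := Real.log e1
  set l2 := Real.log e2
  set l3 := Real.log (nu / de)
  set Lam := (u:ℝ) * l1 + v * l2 - l3 with hLam
  have hLam1 : |Lam| ≤ 1 := hL.trans (Real.exp_le_one_iff.2 (by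
    have : 0 ≤ (h:ℝ) * A / 2 := by positivity
    linarith))
  refine transc_mid e1 e2 nu de h he1 he2 hnu hde hdeh hLi u1 u2 v2 q p _ _ _
    (Real.exp (-(h * A / 2))) A rfl ?_ rfl rfl ?_ m hm hh1 hh2 hp1 hpT ?_ ?_ hu1 ?_ ?_ ?_ le_rfl
  · intro h1
    have := hind _ _ h1
    omega
  · rw [hlogal, hlogga]
    have : (q:ℝ) * (u1 * l1 + p * l2) - (l3 - u2 * l1 - v2 * l2) = Lam := by
      rw [hLam, hu2R, hqvR]; ring
    rw [this]; exact hL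
  · rw [h4T]
    have h1 : T * T * T - T ≤ |(q:ℝ)| * p := by linarith
    have h2 : |(q:ℝ)| * p ≤ |(q:ℝ)| * T := by gcongr
    have h3 : (T * T) * T ≤ (2 * |(q:ℝ)|) * T := by linarith
    exact le_of_mul_le_mul_right h3 hTpos
  · rw [mul_comm]; linarith
  · rw [hu2e, abs_of_nonneg hv2aR]
    have h1 : |xi * v2 + q * (p * xi - u1)| ≤ |xi * v2| + |q * (p * xi - u1)| := abs_add_le _ _
    have h2 : |xi * v2| ≤ p := by
      rw [abs_mul, abs_of_nonneg hv2aR]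
      calc |xi| * v2 ≤ 1 * p := by gcongr
        _ = _ := one_mul _
    have h3 : |(q:ℝ) * (p * xi - u1)| ≤ |(q:ℝ)| / T := by
      rw [abs_mul, div_eq_mul_one_div]
      gcongr
    linarith
  · rw [hlogal]
    have e : (u1:ℝ) * l1 + p * l2 = -(p * xi - u1) * l1 + (p / v) * (Lam + l3) := by
      rw [hLam, huxi]; field_simp; ring
    rw [e]
    have h1 : |-((p:ℝ) * xi - u1) * l1| ≤ 1 / T * (2 * h) := by
      rw [abs_mul, abs_neg]; gcongr
    have h2 : |((p:ℝ) / v) * (Lam + l3)| ≤ 1 / T * (3 * h) := by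
      rw [abs_mul, abs_div, Nat.abs_cast, ← hA]
      have h3 : (p:ℝ) / A ≤ 1 / T := by
        rw [div_le_div_iff₀ hApos hTpos]
        have : (p:ℝ) * T ≤ T * T := by gcongr
        have h5 : T * T * 1 ≤ T * T * T := by gcongr; linarith
        linarith
      have h4 : |Lam + l3| ≤ 3 * h := by
        linarith [abs_add_le Lam l3]
      gcongr
    calc _ ≤ 1 / T * (2 * h) + 1 / T * (3 * h) := (abs_add_le _ _).trans (add_le_add h1 h2)
      _ = 5 * h / T := by ring
  · rw [mul_comm]; linarith
end T7sec

section T8sec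
open Finset

theorem norm_argument {K : Type} [Field K] [Algebra ℚ K] [FiniteDimensional ℚ K]
    (φ : K →ₐ[ℚ] ℂ) (hcard : Fintype.card (K →ₐ[ℚ] ℂ) ≤ 9) (V : K) (hV : IsIntegral ℤ V) (C : ℝ)
    (hC : 1 ≤ C) (hb : ∀ s : K →ₐ[ℚ] ℂ, ‖s V‖ ≤ C) (hs : ‖φ V‖ * C^8 < 1) : V = 0 := by
  classical
  have h1 := Algebra.norm_eq_prod_embeddings ℚ ℂ V
  have h2 : IsIntegral ℤ (Algebra.norm ℚ V) := Algebra.isIntegral_norm ℚ hV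
  obtain ⟨z, hz⟩ := IsIntegrallyClosed.isIntegral_iff.1 h2
  have hz' : Algebra.norm ℚ V = (z:ℚ) := by rw [← hz]; simp
  rw [hz'] at h1
  have h3 : ‖((z:ℤ):ℂ)‖ = ∏ s : K →ₐ[ℚ] ℂ, ‖s V‖ := by
    rw [← norm_prod, ← h1]; simp
  have h4 : ∏ s : K →ₐ[ℚ] ℂ, ‖s V‖ ≤ ‖φ V‖ * C^8 := by
    rw [← Finset.mul_prod_erase Finset.univ _ (Finset.mem_univ φ)]
    gcongr
    calc ∏ s ∈ Finset.univ.erase φ, ‖s V‖ ≤ ∏ s ∈ Finset.univ.erase φ, C :=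
          Finset.prod_le_prod (fun _ _ => norm_nonneg _) fun s _ => hb s
      _ = C ^ (Finset.univ.erase φ).card := by simp
      _ ≤ C^8 := by
        apply pow_le_pow_right₀ hC
        rw [Finset.card_erase_of_mem (Finset.mem_univ _), Finset.card_univ]; omega
  have h5 : |(z:ℝ)| < 1 := by
    have : ‖((z:ℤ):ℂ)‖ = |(z:ℝ)| := by simp
    rw [← this, h3]; exact lt_of_le_of_lt h4 hs
  have h6 : |z| < 1 := by exact_mod_cast h5
  have h7 : z = 0 := Int.abs_lt_one_iff.1 h6
  rw [h7] at hz'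
  simpa using hz'

structure RD (a b : ℤ) (th : Fin 3 → ℝ) : Prop where
  ha : 514229 ≤ a
  hab : 1000 * a ≤ b
  hba : b ≤ a^2
  s1 : th 0 + th 1 + th 2 = a + b
  s2 : th 0 * th 1 + th 0 * th 2 + th 1 * th 2 = a * b
  s3 : th 0 * th 1 * th 2 = 1
  p0 : 0 < th 0
  q0 : th 0 < 2 / (a * b)
  p1 : th 1 < a
  q1 : a - 2 / (a * b) < th 1
  p2 : b < th 2
  q2 : th 2 < b + 2 / (a * b)

namespace RD
variable {a b : ℤ} {th : Fin 3 → ℝ}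

theorem haR (H : RD a b th) : (514229:ℝ) ≤ a := by exact_mod_cast H.ha
theorem habR (H : RD a b th) : (1000:ℝ) * a ≤ b := by exact_mod_cast H.hab
theorem hbaR (H : RD a b th) : (b:ℝ) ≤ a^2 := by exact_mod_cast H.hba
theorem habpos (H : RD a b th) : (0:ℝ) < a * b := by
  have := H.haR
  have := H.habR
  apply mul_pos <;> linarith
theorem hsmall (H : RD a b th) : (2:ℝ) / (a * b) < 1 / 1000 := by
  have := H.haR
  have := H.habR
  rw [div_lt_div_iff₀ H.habpos (by norm_num)]
  nlinarith

theorem root (H : RD a b th) (i : Fin 3) : th i * (th i - a) * (th i - b) = 1 := by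
  have h1 := H.s1
  have h2 := H.s2
  have h3 := H.s3
  have key : ∀ x : ℝ, x * (x - a) * (x - b) - 1 = (x - th 0) * (x - th 1) * (x - th 2) := by
    intro x
    linear_combination x^2 * h1 - x * h2 + h3
  have := key (th i)
  have h0 : (th i - th 0) * (th i - th 1) * (th i - th 2) = 0 := by
    fin_cases i <;> simp
  linarith

theorem fact (H : RD a b th) (x : ℝ) :
    x * (x - a) * (x - b) - 1 = (x - th 0) * (x - th 1) * (x - th 2) := by
  linear_combination x^2 * H.s1 - x * H.s2 + H.s3

theorem ne0 (H : RD a b th) (i : Fin 3) : th i ≠ 0 := by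
  intro h; have := H.root i; rw [h] at this; simp at this

theorem nea (H : RD a b th) (i : Fin 3) : th i - a ≠ 0 := by
  intro h; have := H.root i; rw [h] at this; simp at this

theorem inv0 (H : RD a b th) (i : Fin 3) : (th i)⁻¹ = (th i - a) * (th i - b) := by
  have := H.root i
  have h0 := H.ne0 i
  field_simp; linarith

theorem inva (H : RD a b th) (i : Fin 3) : (th i - a)⁻¹ = th i * (th i - b) := by
  have := H.root i
  have h0 := H.nea i
  field_simp; linarith

theorem bd (H : RD a b th) (i : Fin 3) : |th i| ≤ a * b ∧ |th i - a| ≤ a * b ∧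
    |(th i)⁻¹| ≤ a * b ∧ |(th i - a)⁻¹| ≤ a * b := by
  have h1 := H.haR
  have h2 := H.habR
  have h3 := H.hsmall
  have p0 := H.p0
  have q0 := H.q0
  have p1 := H.p1
  have q1 := H.q1
  have p2 := H.p2
  have q2 := H.q2
  rw [H.inv0, H.inva]
  set e : ℝ := 2 / (a * b)
  have hab1 : (b:ℝ) + 1 ≤ a * b := by nlinarith
  have hi : i = 0 ∨ i = 1 ∨ i = 2 := by fin_cases i <;> simp
  rcases hi with rfl | rfl | rfl
  · refine ⟨?_, ?_, ?_, ?_⟩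
    · rw [abs_of_pos p0]; linarith
    · rw [abs_of_neg (by linarith)]; linarith
    · rw [abs_mul, abs_of_neg (by linarith), abs_of_neg (by linarith)]
      apply mul_le_mul <;> linarith
    · rw [abs_mul, abs_of_pos p0, abs_of_neg (by linarith)]
      apply mul_le_mul <;> linarith
  · refine ⟨?_, ?_, ?_, ?_⟩
    · rw [abs_of_pos (by linarith)]; linarith
    · rw [abs_of_neg (by linarith)]; linarith
    · rw [abs_mul, abs_of_neg (by linarith), abs_of_neg (by linarith)]
      apply mul_le_mul <;> linarith
    · rw [abs_mul, abs_of_pos (by linarith), abs_of_neg (by linarith)]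
      apply mul_le_mul <;> linarith
  · refine ⟨?_, ?_, ?_, ?_⟩
    · rw [abs_of_pos (by linarith)]; linarith
    · rw [abs_of_pos (by linarith)]; linarith
    · rw [abs_mul, abs_of_pos (by linarith), abs_of_pos (by linarith), mul_comm]
      apply mul_le_mul <;> linarith
    · have := H.root 2
      have hh : th 2 * (th 2 - b) * (th 2 - a) = 1 := by linarith
      have h5 : 0 < th 2 * (th 2 - b) := mul_pos (by linarith) (by linarith)
      rw [abs_of_pos h5]
      nlinarith

theorem bdd (H : RD a b th) (i j : Fin 3) : |th i - th j| ≤ a * b := by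
  have h1 := H.haR
  have h2 := H.habR
  have h3 := H.hsmall
  have p0 := H.p0
  have q0 := H.q0
  have p1 := H.p1
  have q1 := H.q1
  have p2 := H.p2
  have q2 := H.q2
  set e : ℝ := 2 / (a * b)
  have hab1 : (b:ℝ) + 1 ≤ a * b := by nlinarith
  have hz : ∀ i, 0 ≤ th i ∧ th i ≤ b + 1 := by
    intro i
    have hi : i = 0 ∨ i = 1 ∨ i = 2 := by fin_cases i <;> simp
    rcases hi with rfl | rfl | rfl <;> constructor <;> linarith
  have := hz i
  have := hz j
  rw [abs_le]; constructor <;> linarith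

end RD
end T8sec

section T9sec
open Finset

theorem exists_sgn (y : ℝ) : ∃ s : ℤ, |s| = 1 ∧ |y| = s * y := by
  rcases abs_choice y with h | h
  · exact ⟨1, by simp, by rw [h]; simp⟩
  · exact ⟨-1, by simp, by rw [h]; simp⟩

theorem zpow_norm_le (z : ℂ) (C : ℝ) (h1 : ‖z‖ ≤ C) (h2 : ‖z⁻¹‖ ≤ C) (hC : 1 ≤ C) (n : ℤ) :
    ‖z ^ n‖ ≤ C ^ n.natAbs := by
  rcases Int.natAbs_eq n with h | h
  · rw [h, zpow_natCast, norm_pow, Int.natAbs_natCast]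
    exact pow_le_pow_left₀ (norm_nonneg _) h1 _
  · rw [h, zpow_neg, zpow_natCast, ← inv_pow, norm_pow, Int.natAbs_neg, Int.natAbs_natCast]
    exact pow_le_pow_left₀ (norm_nonneg _) h2 _

theorem zpow_integral {K : Type} [Field K] (z : K) (h1 : IsIntegral ℤ z)
    (h2 : IsIntegral ℤ z⁻¹) (n : ℤ) : IsIntegral ℤ (z ^ n) := by
  rcases Int.natAbs_eq n with h | h
  · rw [h, zpow_natCast]; exact h1.pow _
  · rw [h, zpow_neg, zpow_natCast, ← inv_pow]; exact h2.pow _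

set_option maxHeartbeats 1000000 in
theorem liou_RD {a b : ℤ} {th : Fin 3 → ℝ} (H : RD a b th) (h : ℕ) (hh : (a:ℝ) * b ≤ Real.exp h)
    (j i k : Fin 3) :
    Liou |th i / th k| |(th i - a) / (th k - a)| |th j - th i| |th j - th k| h := by
  classical
  intro s c ea eb f g B X Y hB1 hB hX hY hsm
  have hintg : ∀ i, IsIntegral ℤ (th i) := by
    intro i
    refine ⟨Polynomial.X * (Polynomial.X - Polynomial.C a) * (Polynomial.X - Polynomial.C b) - 1, ?_, ?_⟩
    · have h3 : (Polynomial.X * (Polynomial.X - Polynomial.C a) * (Polynomial.X - Polynomial.C b) : Polynomial ℤ).Monic :=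
        (Polynomial.monic_X.mul (Polynomial.monic_X_sub_C a)).mul (Polynomial.monic_X_sub_C b)
      apply h3.sub_of_left
      rw [Polynomial.degree_one, Polynomial.degree_mul, Polynomial.degree_mul, Polynomial.degree_X,
        Polynomial.degree_X_sub_C, Polynomial.degree_X_sub_C]
      decide
    · simp only [Polynomial.eval₂_sub, Polynomial.eval₂_mul, Polynomial.eval₂_X, Polynomial.eval₂_C,
        Polynomial.eval₂_one]
      have := H.root i
      simp only [eq_intCast]
      linarith
  set K := IntermediateField.adjoin ℚ ({th 0, th 1} : Set ℝ) with hK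
  have : FiniteDimensional ℚ K := by
    apply IntermediateField.finiteDimensional_adjoin
    intro x hx
    have : IsIntegral ℤ x := by
      rcases hx with rfl | rfl
      · exact hintg 0
      · exact hintg 1
    exact this.tower_top
  have m0 : th 0 ∈ K := IntermediateField.subset_adjoin ℚ _ (by simp)
  have m1 : th 1 ∈ K := IntermediateField.subset_adjoin ℚ _ (by simp)
  have m2 : th 2 ∈ K := by
    have : th 2 = a + b - th 0 - th 1 := by linarith [H.s1]
    rw [this]
    exact sub_mem (sub_mem (add_mem (intCast_mem K a) (intCast_mem K b)) m0) m1
  have mm : ∀ i, th i ∈ K := by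
    intro i; fin_cases i
    · exact m0
    · exact m1
    · exact m2
  let t : Fin 3 → K := fun i => ⟨th i, mm i⟩
  have ht : ∀ i, ((t i : K) : ℝ) = th i := fun i => rfl
  have htint : ∀ i, IsIntegral ℤ (t i) := by
    intro i
    have h3 : IsIntegral ℤ ((algebraMap K ℝ) (t i)) := hintg i
    exact (isIntegral_algebraMap_iff (algebraMap K ℝ).injective).1 h3
  have hroot : ∀ i, t i * (t i - a) * (t i - b) = 1 := by
    intro i
    apply Subtype.ext
    push_cast
    exact H.root i
  have ht0 : ∀ i, t i ≠ 0 := by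
    intro i h0; have := hroot i; rw [h0] at this; simp at this
  have hta : ∀ i, t i - a ≠ 0 := by
    intro i h0; have := hroot i; rw [h0] at this; simp at this
  have tinv : ∀ i, (t i)⁻¹ = (t i - a) * (t i - b) := by
    intro i; have := hroot i; have := ht0 i; field_simp; rw [← hroot i]
  have tinva : ∀ i, (t i - a)⁻¹ = t i * (t i - b) := by
    intro i; have := hroot i; have := hta i; field_simp; rw [← hroot i]
  have hia : IsIntegral ℤ (a:K) := isIntegral_algebraMap (R := ℤ) (x := a)
  have hib : IsIntegral ℤ (b:K) := isIntegral_algebraMap (R := ℤ) (x := b)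
  have hi1 : ∀ i, IsIntegral ℤ (t i - a) := fun i => (htint i).sub hia
  have hi2 : ∀ i, IsIntegral ℤ (t i - b) := fun i => (htint i).sub hib
  have hi3 : ∀ i, IsIntegral ℤ (t i)⁻¹ := fun i => by rw [tinv]; exact (hi1 i).mul (hi2 i)
  have hi4 : ∀ i, IsIntegral ℤ (t i - a)⁻¹ := fun i => by rw [tinva]; exact (htint i).mul (hi2 i)
  have hemb : ∀ (s : K →ₐ[ℚ] ℂ) (i : Fin 3), ∃ l : Fin 3, s (t i) = (th l : ℂ) := by
    intro s i
    have h3 := congrArg s (hroot i)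
    simp only [map_mul, map_sub, map_one, map_intCast] at h3
    set z := s (t i)
    have h4 : (z - th 0) * (z - th 1) * (z - th 2) = 0 := by
      have s1 := congrArg (fun x : ℝ => (x:ℂ)) H.s1
      have s2 := congrArg (fun x : ℝ => (x:ℂ)) H.s2
      have s3 := congrArg (fun x : ℝ => (x:ℂ)) H.s3
      push_cast at s1 s2 s3
      linear_combination h3 - z^2 * s1 + z * s2 - s3
    rcases mul_eq_zero.1 h4 with h5 | h5
    · rcases mul_eq_zero.1 h5 with h6 | h6
      · exact ⟨0, sub_eq_zero.1 h6⟩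
      · exact ⟨1, sub_eq_zero.1 h6⟩
    · exact ⟨2, sub_eq_zero.1 h5⟩
  choose π hπ using hemb
  have hcard : Fintype.card (K →ₐ[ℚ] ℂ) ≤ 9 := by
    have hinj : Function.Injective (fun s : K →ₐ[ℚ] ℂ => (π s 0, π s 1)) := by
      intro s s' hss
      simp only [Prod.mk.injEq] at hss
      apply IntermediateField.adjoin_algHom_ext
      intro x hx
      rcases hx with rfl | rfl
      · exact (hπ s 0).trans (by rw [hss.1]; exact (hπ s' 0).symm)
      · exact (hπ s 1).trans (by rw [hss.2]; exact (hπ s' 1).symm)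
    have := Fintype.card_le_of_injective _ hinj
    simpa using this
  let y : ℕ × ℕ → K := fun r => (t i / t k) ^ (ea r) * ((t i - a) / (t k - a)) ^ (eb r) *
    (t j - t i) ^ (f r) * (t j - t k) ^ (g r)
  choose sg hsg1 hsg2 using fun r => exists_sgn ((y r : K) : ℝ)
  let V : K := ∑ r ∈ s, ((c r * sg r : ℤ) : K) * y r
  have hyint : ∀ r, IsIntegral ℤ (y r) := by
    intro r
    refine IsIntegral.mul (IsIntegral.mul (IsIntegral.mul ?_ ?_) ?_) ?_
    · apply zpow_integral
      · rw [div_eq_mul_inv]; exact (htint i).mul (hi3 k)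
      · rw [inv_div, div_eq_mul_inv]; exact (htint k).mul (hi3 i)
    · apply zpow_integral
      · rw [div_eq_mul_inv]; exact (hi1 i).mul (hi4 k)
      · rw [inv_div, div_eq_mul_inv]; exact (hi1 k).mul (hi4 i)
    · exact ((htint j).sub (htint i)).pow _
    · exact ((htint j).sub (htint k)).pow _
  have hVint : IsIntegral ℤ V := by
    apply IsIntegral.sum
    intro r _
    exact (isIntegral_algebraMap (R := ℤ) (x := c r * sg r)).mul (hyint r)
  have hVR : ((V : K) : ℝ) = ∑ r ∈ s, (c r : ℝ) * |th i / th k| ^ (ea r) *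
      |(th i - a) / (th k - a)| ^ (eb r) * |th j - th i| ^ (f r) * |th j - th k| ^ (g r) := by
    simp only [V]
    rw [AddSubmonoidClass.coe_finsetSum]
    refine Finset.sum_congr rfl fun r _ => ?_
    push_cast
    have : |((y r : K) : ℝ)| = |th i / th k| ^ (ea r) *
      |(th i - a) / (th k - a)| ^ (eb r) * |th j - th i| ^ (f r) * |th j - th k| ^ (g r) := by
      have e : ((y r : K) : ℝ) = (th i / th k) ^ (ea r) * ((th i - a) / (th k - a)) ^ (eb r) *
          (th j - th i) ^ (f r) * (th j - th k) ^ (g r) := by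
        change (algebraMap K ℝ) (y r) = _
        simp only [y, map_mul, map_zpow₀, map_pow, map_div₀, map_sub, map_intCast]
        rfl
      rw [e, abs_mul, abs_mul, abs_mul, abs_zpow, abs_zpow, abs_pow, abs_pow]
    rw [mul_assoc, ← hsg2, this]; ring
  rw [← hVR] at hsm ⊢
  set Ce := Real.exp h with hCe
  have hCe1 : 1 ≤ Ce := Real.one_le_exp (by positivity)
  have hbd : ∀ (l l' : Fin 3), ‖(th l : ℂ) / (th l' : ℂ)‖ ≤ Ce^2 := by
    intro l l'
    rw [div_eq_mul_inv, norm_mul, ← Complex.ofReal_inv, Complex.norm_real, Complex.norm_real, pow_two]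
    exact mul_le_mul ((H.bd l).1.trans hh) ((H.bd l').2.2.1.trans hh) (norm_nonneg _) (by positivity)
  have hbda : ∀ (l l' : Fin 3), ‖((th l : ℂ) - a) / ((th l' : ℂ) - a)‖ ≤ Ce^2 := by
    intro l l'
    have e1 : (th l : ℂ) - a = ((th l - a : ℝ) : ℂ) := by push_cast; ring
    have e2 : (th l' : ℂ) - a = ((th l' - a : ℝ) : ℂ) := by push_cast; ring
    rw [e1, e2, div_eq_mul_inv, norm_mul, ← Complex.ofReal_inv, Complex.norm_real, Complex.norm_real, pow_two]
    exact mul_le_mul ((H.bd l).2.1.trans hh) ((H.bd l').2.2.2.trans hh) (norm_nonneg _) (by positivity)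
  have hbdd : ∀ (l l' : Fin 3), ‖(th l : ℂ) - (th l' : ℂ)‖ ≤ Ce := by
    intro l l'
    rw [← Complex.ofReal_sub, Complex.norm_real]
    exact (H.bdd l l').trans hh
  have hCe2 : 1 ≤ Ce^2 := one_le_pow₀ hCe1
  have hVb : ∀ σ : K →ₐ[ℚ] ℂ, ‖σ V‖ ≤ B * Real.exp (2 * h * X + h * Y) := by
    intro σ
    simp only [V, map_sum]
    refine (norm_sum_le _ _).trans ?_
    calc _ ≤ ∑ r ∈ s, |(c r : ℝ)| * Real.exp (2 * h * X + h * Y) := by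
          apply Finset.sum_le_sum
          intro r hr
          rw [map_mul, norm_mul]
          apply mul_le_mul
          · rw [map_intCast]
            have : ‖((c r * sg r : ℤ) : ℂ)‖ = |((c r * sg r : ℤ) : ℝ)| := by simp
            rw [this]
            push_cast
            rw [abs_mul]
            have : |(sg r : ℝ)| = 1 := by exact_mod_cast hsg1 r
            rw [this, mul_one]
          · simp only [y, map_mul, map_zpow₀, map_pow, map_div₀, map_sub, map_intCast, hπ]
            rw [norm_mul, norm_mul, norm_mul, norm_pow, norm_pow]
            have z1 := zpow_norm_le ((th (π σ i) : ℂ) / (th (π σ k) : ℂ)) (Ce^2) (hbd _ _)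
              (by rw [inv_div]; exact hbd _ _) hCe2 (ea r)
            have z2 := zpow_norm_le (((th (π σ i) : ℂ) - a) / ((th (π σ k) : ℂ) - a)) (Ce^2) (hbda _ _)
              (by rw [inv_div]; exact hbda _ _) hCe2 (eb r)
            have z3 := pow_le_pow_left₀ (norm_nonneg _) (hbdd (π σ j) (π σ i)) (f r)
            have z4 := pow_le_pow_left₀ (norm_nonneg _) (hbdd (π σ j) (π σ k)) (g r)
            have hX' : (ea r).natAbs + (eb r).natAbs ≤ X := by
              have := hX r hr
              zify; exact this
            calc _ ≤ (Ce^2)^(ea r).natAbs * (Ce^2)^(eb r).natAbs * Ce^(f r) * Ce^(g r) := by gcongr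
              _ = (Ce^2)^((ea r).natAbs + (eb r).natAbs) * Ce^(f r + g r) := by
                rw [pow_add, pow_add]; ring
              _ ≤ (Ce^2)^X * Ce^Y := by
                gcongr
                exact hY r hr
              _ = _ := by
                rw [hCe, ← Real.exp_nat_mul, ← Real.exp_nat_mul, ← Real.exp_nat_mul, ← Real.exp_add]
                congr 1; push_cast; ring
          · exact norm_nonneg _
          · exact abs_nonneg _
      _ = (∑ r ∈ s, |(c r : ℝ)|) * Real.exp (2 * h * X + h * Y) := by rw [Finset.sum_mul]
      _ ≤ _ := by gcongr
  let φ : K →ₐ[ℚ] ℂ := ((Algebra.ofId ℝ ℂ).restrictScalars ℚ).comp K.val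
  have hφ : ∀ x : K, φ x = ((x:ℝ):ℂ) := fun x => rfl
  have hfin := norm_argument φ hcard V hVint (B * Real.exp (2 * h * X + h * Y)) (by
    have : 1 ≤ Real.exp (2 * h * X + h * Y) := Real.one_le_exp (by positivity)
    exact one_le_mul_of_one_le_of_one_le hB1 this) hVb (by
    rw [hφ, Complex.norm_real, Real.norm_eq_abs]; exact hsm)
  rw [hfin]; simp
end T9sec

section N1sec
open Finset

@[irreducible] def SS : ℕ := 2 ^ 640

def hor (z2 : ℕ) : ℕ → ℕ → ℕ :=
  Nat.rec (fun h => h)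
    (fun k ih h => ih (Nat.add (Nat.div SS (Nat.add (Nat.mul 2 k) 1)) (Nat.div (Nat.mul z2 h) SS)))

theorem hor_zero (z2 h : ℕ) : hor z2 0 h = h := rfl
theorem hor_succ (z2 k h : ℕ) : hor z2 (k+1) h = hor z2 k (SS / (2*k+1) + z2*h/SS) := rfl

theorem SS_posN : 0 < SS := by decide +kernel
theorem SS_pos : (0:ℝ) < (SS:ℝ) := by exact_mod_cast SS_posN

theorem nat_div_bd (m d : ℕ) (hd : 0 < d) :
    (m:ℝ)/d - 1 ≤ ((m/d : ℕ):ℝ) ∧ ((m/d : ℕ):ℝ) ≤ (m:ℝ)/d := by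
  constructor
  · have h := Nat.lt_div_mul_add (a := m) hd
    have h' : (m:ℝ) < ((m/d : ℕ):ℝ)*d + d := by exact_mod_cast h
    have hd' : (0:ℝ) < d := by exact_mod_cast hd
    rw [sub_le_iff_le_add, div_le_iff₀ hd']
    linarith
  · exact Nat.cast_div_le

theorem hor_step (z2 k h : ℕ) (y : ℝ) (hy0 : 0 ≤ y) (hy : y ≤ 1/9)
    (h1 : (SS:ℝ)*y - 2 ≤ z2) (h2 : (z2:ℝ) ≤ SS*y) (hh : (h:ℝ) ≤ 2*SS) :
    |((SS / (2*k+1) + z2*h/SS : ℕ):ℝ) - (SS/(2*k+1) + y*h)| ≤ 6 ∧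
      ((SS / (2*k+1) + z2*h/SS : ℕ):ℝ) ≤ 2*SS := by
  have hS := SS_pos
  have hSn : 0 < SS := by exact_mod_cast hS
  obtain ⟨a1, a2⟩ := nat_div_bd SS (2*k+1) (by omega)
  obtain ⟨b1, b2⟩ := nat_div_bd (z2*h) SS hSn
  push_cast at a1 a2 b1 b2 ⊢
  have hh0 : (0:ℝ) ≤ h := Nat.cast_nonneg h
  have c1 : (z2:ℝ)*h/SS ≤ y*h := by
    rw [div_le_iff₀ hS]; nlinarith
  have c2 : y*h - 4 ≤ (z2:ℝ)*h/SS := by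
    rw [le_div_iff₀ hS]; nlinarith
  have c3 : (SS:ℝ)/(2*k+1) ≤ SS := by
    apply div_le_self hS.le
    have : (0:ℝ) ≤ k := Nat.cast_nonneg k
    linarith
  have c4 : y*h ≤ 1/9*(2*SS) := by gcongr
  constructor
  · rw [abs_le]; constructor <;> linarith
  · linarith

theorem hor_bd (z2 : ℕ) (y : ℝ) (hy0 : 0 ≤ y) (hy : y ≤ 1/9)
    (h1 : (SS:ℝ)*y - 2 ≤ z2) (h2 : (z2:ℝ) ≤ SS*y) (k : ℕ) : ∀ h : ℕ, (h:ℝ) ≤ 2*SS →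
    |(hor z2 k h : ℝ) - (SS * ∑ i ∈ range k, y^i/(2*i+1) + y^k*h)| ≤ 7*(1-y^k) := by
  induction k with
  | zero => intro h _; simp [hor_zero]
  | succ k ih =>
    intro h hh
    obtain ⟨s1, s2⟩ := hor_step z2 k h y hy0 hy h1 h2 hh
    have := ih _ s2
    rw [hor_succ, sum_range_succ]
    set X : ℝ := ((SS / (2*k+1) + z2*h/SS : ℕ):ℝ)
    set R : ℝ := (hor z2 k (SS / (2*k+1) + z2*h/SS) : ℝ)
    have hyk : 0 ≤ y^k := by positivity
    have e : R - (SS * (∑ i ∈ range k, y^i/(2*i+1) + y^k/(2*k+1)) + y^(k+1)*h) =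
       (R - (SS * ∑ i ∈ range k, y^i/(2*i+1) + y^k*X)) + y^k*(X - (SS/(2*k+1) + y*h)) := by ring
    rw [e]
    refine (abs_add_le _ _).trans ?_
    rw [abs_mul, abs_of_nonneg hyk, pow_succ]
    nlinarith [mul_le_mul_of_nonneg_left s1 hyk, mul_nonneg hyk (sub_nonneg.2 hy)]

def lqz (N D : ℕ) : ℕ := Nat.div (Nat.mul SS (Nat.sub N D)) (Nat.add N D)
def lqm (z2 : ℕ) : ℕ := 640 / (640 - (Nat.log2 (z2 + 2) + 1)) + 1
def lqck (N D z2 m : ℕ) : Bool :=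
  Nat.ble D N && Nat.ble (Nat.mul 3 (Nat.sub N D)) (Nat.add N D) && Nat.ble 1 D &&
    Nat.ble (Nat.pow (Nat.add z2 2) m) (Nat.pow SS (Nat.sub m 1)) && Nat.ble 1 m
/-- check and value of `SS * log (N / D)`, for `D ≤ N`. -/
def lqc (N D : ℕ) : Bool := 
  lqck N D (Nat.div (Nat.mul (lqz N D) (lqz N D)) SS) (lqm (Nat.div (Nat.mul (lqz N D) (lqz N D)) SS))
def lqv (N D : ℕ) : ℕ :=
  Nat.div (Nat.mul (Nat.mul 2 (lqz N D)) 
    (hor (Nat.div (Nat.mul (lqz N D) (lqz N D)) SS) (lqm (Nat.div (Nat.mul (lqz N D) (lqz N D)) SS)) 0)) SS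

theorem lq_aux (S zs H z T : ℝ) (hS : 1000 ≤ S) (zs0 : 0 ≤ zs) (hH : 0 ≤ H) (hz : 0 ≤ z) (hz1 : z ≤ 1/3)
    (hT : 0 ≤ T) (hT1 : T ≤ 9/8) (a1 : S*z - 1 ≤ zs) (a2 : zs ≤ S*z) (b1 : -7 ≤ H - S*T) (b2 : H - S*T ≤ 7) :
    2*zs*H/S ≤ 2*S*(z*T) + 5 ∧ 2*S*(z*T) - 8 ≤ 2*zs*H/S := by
  have hS0 : 0 < S := by linarith
  constructor
  · rw [div_le_iff₀ hS0]
    have : 2*zs*H ≤ 2*(S*z)*(S*T+7) := by gcongr; linarith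
    have : S*z ≤ S*(1/3) := by gcongr
    linarith
  · rw [le_div_iff₀ hS0]
    have h1 : (S*z-1)*H ≤ zs*H := by gcongr
    have h2 : (S*z)*(S*T-7) ≤ (S*z)*H := by gcongr; linarith
    have h3 : S*z ≤ S*(1/3) := by gcongr
    have h4 : S*T ≤ S*(9/8) := by gcongr
    linarith

theorem lq_sound (N D : ℕ) (h : lqc N D = true) :
    |(SS:ℝ) * Real.log ((N:ℝ)/D) - (lqv N D : ℝ)| ≤ 12 := by
  have hS := SS_pos
  have hSn : 0 < SS := by exact_mod_cast hS
  have h' : lqck N D (lqz N D * lqz N D / SS) (lqm (lqz N D * lqz N D / SS)) = true := h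
  have hv : lqv N D = 2 * lqz N D * hor (lqz N D * lqz N D / SS) (lqm (lqz N D * lqz N D / SS)) 0 / SS := rfl
  have hzd : lqz N D = SS * (N - D) / (N + D) := rfl
  rw [hv]
  generalize lqm (lqz N D * lqz N D / SS) = m at *
  generalize hzz : lqz N D = zs at *
  generalize hz2 : zs * zs / SS = z2 at *
  simp only [lqck, Bool.and_eq_true, Nat.ble_eq, Nat.mul_eq, Nat.add_eq, Nat.sub_eq, Nat.pow_eq] at h'
  obtain ⟨⟨⟨⟨g1, g2⟩, g3⟩, g4⟩, g5⟩ := h'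
  have hDp : (0:ℝ) < D := by exact_mod_cast g3
  have hND : (D:ℝ) ≤ N := by exact_mod_cast g1
  obtain ⟨z, hz⟩ : ∃ z : ℝ, z = ((N:ℝ)-D)/(N+D) := ⟨_, rfl⟩
  have hz0 : 0 ≤ z := by rw [hz]; apply div_nonneg <;> linarith
  have hz13 : z ≤ 1/3 := by
    rw [hz, div_le_iff₀ (by linarith)]
    have : (3:ℝ) * ((N - D : ℕ):ℝ) ≤ N + D := by exact_mod_cast g2
    rw [Nat.cast_sub g1] at this; linarith
  have hlog : Real.log ((N:ℝ)/D) = 2 * (1/2 * Real.log ((1+z)/(1-z))) := by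
    have : (1+z)/(1-z) = (N:ℝ)/D := by
      have e1 : (1 + z) = 2*N/(N+D) := by rw [hz]; field_simp; ring
      have e2 : (1 - z) = 2*D/(N+D) := by rw [hz]; field_simp; ring
      rw [e1, e2]; field_simp
    rw [this]; ring
  have t1 := Real.sum_range_le_log_div hz0 (by linarith) m
  have t2 := Real.log_div_le_sum_range_add hz0 (by linarith) m
  have hy9 : z^2 ≤ 1/9 := by nlinarith
  obtain ⟨a1, a2⟩ := nat_div_bd (SS * (N - D)) (N + D) (by omega)
  rw [← hzd] at a1 a2
  have hq : ((SS * (N - D) : ℕ):ℝ) / ((N + D : ℕ):ℝ) = SS * z := by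
    push_cast [Nat.cast_sub g1]; rw [hz]; ring
  rw [hq] at a1 a2
  obtain ⟨b1, b2⟩ := nat_div_bd (zs*zs) SS hSn
  rw [hz2] at b1 b2
  push_cast at b1 b2
  have zs0 : (0:ℝ) ≤ zs := Nat.cast_nonneg _
  have c2 : (z2:ℝ) ≤ SS * z^2 := by
    refine b2.trans ?_
    rw [div_le_iff₀ hS]
    nlinarith
  have c1 : (SS:ℝ) * z^2 - 2 ≤ z2 := by
    have : (SS:ℝ)*z^2 - 1 ≤ zs*zs/SS := by
      rw [le_div_iff₀ hS]
      rcases le_total 1 ((SS:ℝ)*z) with q | q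
      · nlinarith
      · have : (SS:ℝ)*z*((SS:ℝ)*z) ≤ 1*1 := by gcongr
        have hS1 : (1:ℝ) ≤ SS := by exact_mod_cast hSn
        nlinarith [mul_nonneg zs0 zs0]
    linarith
  have hb := hor_bd z2 (z^2) (by positivity) hy9 c1 c2 m 0 (by simp)
  simp only [Nat.cast_zero, mul_zero, add_zero] at hb
  have hsum : ∑ i ∈ range m, z^(2*i+1)/(2*i+1) = z * ∑ i ∈ range m, (z^2)^i/(2*i+1) := by
    rw [mul_sum]; apply sum_congr rfl; intro i _; rw [pow_succ, pow_mul]; ring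
  rw [hsum] at t1 t2
  obtain ⟨T, hT⟩ : ∃ T : ℝ, T = ∑ i ∈ range m, (z^2)^i/(2*(i:ℝ)+1) := ⟨_, rfl⟩
  rw [← hT] at hb t1 t2
  have htail : (SS:ℝ) * (z^2)^m ≤ 1 := by
    have g : ((z2:ℝ)+2)^m ≤ (SS:ℝ)^(m-1) := by exact_mod_cast g4
    have : ((SS:ℝ)*z^2)^m ≤ (SS:ℝ)^(m-1) := 
      le_trans (by gcongr; linarith) g
    rw [mul_pow] at this
    obtain ⟨m', rfl⟩ : ∃ m', m = m'+1 := ⟨m-1, by omega⟩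
    simp only [Nat.add_sub_cancel] at this
    have hp : (0:ℝ) < (SS:ℝ)^m' := by positivity
    have : (SS:ℝ)^m' * ((SS:ℝ) * (z^2)^(m'+1)) ≤ (SS:ℝ)^m' * 1 := by
      calc _ = (SS:ℝ)^(m'+1) * (z^2)^(m'+1) := by ring
        _ ≤ _ := by linarith
    exact le_of_mul_le_mul_left this hp
  have htail2 : (SS:ℝ) * (z^(2*m+1)/(1-z^2)) ≤ 1 := by
    rw [pow_succ, pow_mul, mul_div_assoc']
    rw [div_le_one (by linarith)]
    have : (SS:ℝ) * ((z^2)^m*z) = (SS * (z^2)^m)*z := by ring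
    rw [this]
    calc _ ≤ 1 * (1/3:ℝ) := by gcongr
      _ ≤ _ := by linarith
  have hzm : 0 ≤ (z^2)^m := by positivity
  obtain ⟨d1, d2⟩ := nat_div_bd (2*zs*hor z2 m 0) SS hSn
  push_cast at d1 d2
  obtain ⟨H, hH⟩ : ∃ H : ℝ, H = (hor z2 m 0 : ℝ) := ⟨_, rfl⟩
  rw [← hH] at hb d1 d2
  have hb' : |H - SS*T| ≤ 7 := hb.trans (by linarith)
  rw [abs_le] at hb'
  have hT0 : 0 ≤ T := by rw [hT]; positivity
  have hT1 : T ≤ 9/8 := by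
    rw [hT]
    calc _ ≤ ∑ i ∈ range m, (z^2)^i := by
          apply sum_le_sum; intro i _; apply div_le_self (by positivity)
          have : (0:ℝ) ≤ i := Nat.cast_nonneg i
          linarith
      _ ≤ 9/8 := by
          have hg := geom_sum_mul_neg (z^2) m
          have : 0 ≤ ∑ i ∈ range m, (z^2)^i := by positivity
          nlinarith
  have hSge : (1000:ℝ) ≤ SS := by
    have : 1000 ≤ SS := by decide +kernel
    exact_mod_cast this
  have hH0 : 0 ≤ H := by rw [hH]; positivity
  obtain ⟨f1, f2⟩ := lq_aux SS zs H z T hSge zs0 hH0 hz0 hz13 hT0 hT1 a1 a2 hb'.1 hb'.2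
  rw [hlog]
  have k1 := mul_le_mul_of_nonneg_left t1 hS.le
  have k2 := mul_le_mul_of_nonneg_left t2 hS.le
  rw [mul_add] at k2
  rw [abs_le]
  constructor <;> linarith
end N1sec

section N2sec
@[irreducible] def LN2 : ℕ := 3162442850577000144542819255265044123884198300717798677536341180773118696995660441338367561063358767323571958122307070903190084685977847936741854327993944726832264493303953239866611699627604093

def frc (n : ℕ) (k : ℕ → Bool) : Bool := Nat.rec (motive := fun _ => Bool) (k 0) (fun m _ => k (Nat.succ m)) n
theorem frc_eq (n : ℕ) (k : ℕ → Bool) : frc n k = k n := by cases n <;> rfl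
noncomputable def frcI (z : ℤ) (k : ℤ → Bool) : Bool :=
  Int.rec (motive := fun _ => Bool) (fun m => frc m (fun m => k (Int.ofNat m))) (fun m => frc m (fun m => k (Int.negSucc m))) z
theorem frcI_eq (z : ℤ) (k : ℤ → Bool) : frcI z k = k z := by
  cases z <;> simp [frcI, frc_eq]

def lgc (N D : ℕ) : Bool := cond (Nat.ble D N) (lqc N D) (lqc D N)
def lgv (N D : ℕ) : ℤ := cond (Nat.ble D N) (Int.ofNat (lqv N D)) (Int.neg (Int.ofNat (lqv D N)))

/-- denominators of convergents -/
def cvl (W : ℕ) : ℕ → ℕ → ℕ → ℕ → ℕ → ℕ :=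
  Nat.rec (fun _ _ _ q1 => q1)
    (fun _ ih x y q0 q1 =>
      cond (Nat.ble q1 W) (ih y (Nat.mod x y) q1 (Nat.add (Nat.mul (Nat.div x y) q1) q0)) q1)

@[irreducible] def EE : ℕ := 131072
@[irreducible] def UU : ℕ := 2 ^ 252

noncomputable def rnd (A : ℤ) (B t : ℕ) : ℤ :=
  cond (Int.rec (motive := fun _ => Bool) (fun _ => true) (fun _ => false) A)
   (Int.ofNat ((2 * t * A.natAbs + B) / (2 * B))) (Int.neg (Int.ofNat ((2 * t * A.natAbs + B) / (2 * B))))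

def homc (W : ℕ) (A : ℤ) (B : ℕ) (T : ℤ) (Lh t : ℕ) (s : ℤ) : Bool :=
  Nat.beq (Nat.gcd s.natAbs t) 1 && Nat.ble (W+1) t &&
   Nat.ble (W * ((t * A - s * B).natAbs + (t + s.natAbs) * EE) + t * (T.natAbs + 3 * EE + Lh) + EE + 1) B

def inhc (W : ℕ) (A : ℤ) (B : ℕ) (T : ℤ) (t : ℕ) (s g : ℤ) (err : ℕ) : Bool :=
  Nat.ble (W * ((t * A - s * B).natAbs + (t + s.natAbs) * EE) + t + 3 * EE * t + (g.natAbs + 1) * EE) err &&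
  decide (g * B + err < t * T) && decide (t * T + err < (g+1) * B)

noncomputable def homt (W : ℕ) (A : ℤ) (B : ℕ) (T : ℤ) (Lh : ℕ) : Bool :=
  frc (cvl W 600 A.natAbs B 1 0) fun t => frcI (rnd A B t) fun s => homc W A B T Lh t s

noncomputable def inht (W st : ℕ) (A : ℤ) (B : ℕ) (T : ℤ) : Bool :=
  frc (cvl st 600 A.natAbs B 1 0) fun t => frcI (rnd A B t) fun s => frcI (t * T / B) fun g =>
   frc (W * ((t * A - s * B).natAbs + (t + s.natAbs) * EE) + t + 3 * EE * t + (g.natAbs + 1) * EE) fun err =>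
    inhc W A B T t s g err

noncomputable def tst (A Bz T : ℤ) (Lh : ℕ) : Bool :=
  frcI A fun A => frc Bz.toNat fun B => frcI T fun T => 
   cond (homt (UU + 1) A B T Lh) true
    (cond (homt 1024 A B T Lh) (cond (inht (UU+1) (UU * 16) A B T) true (inht (UU+1) (UU * 64) A B T)) false)
    
def pf (a b : ℕ) (x : ℤ) : ℤ := x * (x - a * SS) * (x - b * SS) - SS ^ 3

def it1 (a b : ℕ) (k : ℕ) : ℕ := Nat.rec 0 (fun _ x => SS^3 / ((a*SS - x)*(b*SS-x))) k
def it2 (a b : ℕ) (k : ℕ) : ℕ := Nat.rec 0 (fun _ x => SS^3 / ((a*SS - x)*((b-a)*SS+x))) k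
def it3 (a b : ℕ) (k : ℕ) : ℕ := Nat.rec 0 (fun _ x => SS^3 / ((b*SS + x)*((b-a)*SS+x))) k

def rtc (a b X0 X1 X2 : ℕ) : Bool :=
  Nat.ble X0 SS && Nat.ble ((a-1)*SS) X1 && Nat.ble X1 (a * SS) && Nat.ble (b*SS) X2 && Nat.ble X2 ((b+1)*SS) &&
  decide (0 ≤ pf a b (X0+1)) && decide (pf a b (X0 - 1) ≤ 0) &&
  decide (0 ≤ pf a b (X1-1)) && decide (pf a b (X1 + 1) ≤ 0) &&
  decide (0 ≤ pf a b (X2+1)) && decide (pf a b (X2 - 1) ≤ 0)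

noncomputable def lgk (N D : ℕ) (k : ℤ → Bool) : Bool := cond (lgc N D) (frcI (lgv N D) k) false

noncomputable def fin (Lh : ℕ) (l2 l3 m1 m3 c12 c13 c23 : ℤ) : Bool :=
  tst (l3 - l2) (m1 + 2 * m3) (c13 - c12 - (l3 - l2)) Lh &&
  tst (2 * l3 + l2) (m3 - m1) (c23 - c12 - (m3 - m1)) Lh &&
  tst (-(2 * l2 + l3)) (2 * m1 + m3) (c13 - c23 + (-(2 * l2 + l3)) + (2 * m1 + m3)) Lh

noncomputable def lgs (a b X0 X1 X2 Lh : ℕ) (la lb lc : ℤ) : Bool :=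
  lgk X1 (a*SS) fun r2 => lgk X2 (b*SS) fun r3 => lgk (a*SS-X0) (a*SS) fun s1 => 
  lgk (X2 - a*SS) ((b-a)*SS) fun s3 => lgk (X1-X0) (a*SS) fun t12 => lgk (X2-X0) (b*SS) fun t13 =>
  lgk (X2-X1) ((b-a)*SS) fun t23 => 
  fin Lh (la + r2) (lb + r3) (la + s1) (lc + s3) (la + t12) (lb + t13) (lc + t23)

noncomputable def ckb (n a b : ℕ) : Bool :=
  frc (it1 a b (640/(2*n)+2)) fun X0 => frc (a*SS - it2 a b (640/(2*n)+2)) fun X1 =>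
  frc (b*SS + it3 a b (640/(2*n)+2)) fun X2 => cond (rtc a b X0 X1 X2)
   (frc (cond (Nat.ble (2^(2*(Nat.log2 a)+1)) (a*a)) (Nat.log2 a+1) (Nat.log2 a)) fun e => 
     cond (Nat.ble e 1000)
     (lgk a (2^e) fun r => lgk (b-a) b fun r' => 
        lgs a b X0 X1 X2 (1000 * SS / (a*b)^3 + 1) (r + e * LN2) (n * LN2) (n * LN2 + r')) false)
   false

noncomputable def ck (n a : ℕ) : Bool := frc (2^n) fun b => ckb n a b

noncomputable def runs : ℕ → ℕ → ℕ → ℕ → Bool :=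
  Nat.rec (fun _ _ _ => true) (fun _ ih n f g => cond (ck n f) (frc g fun g => frc (Nat.add f g) fun h => ih (Nat.succ n) g h) false)

theorem runs_sound (k : ℕ) : ∀ n f g, runs k n f g = true → f = Nat.fib n → g = Nat.fib (n+1) →
    ∀ i, n ≤ i → i < n + k → ck i (Nat.fib i) = true := by
  induction k with
  | zero => intro n f g _ _ _ i h1 h2; omega
  | succ k ih =>
    intro n f g h hf hg i h1 h2
    have h' : cond (ck n f) (frc g fun g => frc (Nat.add f g) fun h => runs k (Nat.succ n) g h) false = true := h
    simp only [frc_eq] at h'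
    cases hc : ck n f with
    | false => rw [hc] at h'; simp at h'
    | true =>
      rw [hc] at h'
      rcases Nat.eq_or_lt_of_le h1 with e | e
      · rw [← e, ← hf]; exact hc
      · refine ih (n+1) g (f+g) h' hg ?_ i e (by omega)
        rw [hf, hg, Nat.fib_add_two]
end N2sec

section N3sec
set_option maxRecDepth 100000
set_option exponentiation.threshold 2000
theorem chunk_ok0 : runs 81 29 514229 832040 = true := by decide +kernel
theorem chunk_ok1 : runs 81 110 43566776258854844738105 70492524767089125814114 = true := by decide +kernel
theorem chunk_ok2 : runs 81 191 3691087032412706639440686994833808526209 5972304273877744135569338397692020533504 = true := by decide +kernel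
theorem chunk_ok3 : runs 81 272 312718191492907860985910767785256677811449301165198482789 505988662735923140767969869749836918999964413630219877218 = true := by decide +kernel
theorem chunk_ok4 : runs 81 353 26494272942318589069480525788592273303839335703403521573912286394960106973 42868634127888159424995674777973502051063092312442448224088410550266867672 = true := by decide +kernel
theorem chunk_ok5 : runs 81 434 2244661544603472032436332649584708114319787957314032873538930901437280496774780497748874337 3631938672408255859550518752770954506578238315485816563618848933573305722729383091461442690 = true := by decide +kernel
theorem chunk_ok6 : runs 81 515 190173380518541262644908836314147509997243394930954381097638787546788263422418459467776989498542041312046985 307706993434466865456401903551551578318956034208374691542093028553513056268030561242600951135606345897560112 = true := by decide +kernel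
theorem chunk_ok7 : runs 81 596 16111967857603554797929155400174310964103654135943897789553945634128457897367547898182707228021086758156611701046055535657197 26069711619248377583524645322456554671460976361889270266967000202340261970332126043084329988608548802627001913451802276881602 = true := by decide +kernel
theorem chunk_ok8 : runs 81 677 1365046504072321508231222244310422363877266660206444179119732408369866192876900278185575638836207240316520034980758670394197563455932861996357 2208691639813237951345054815528123559888926654875983118185464351044729098274334257901507380795280765552825035054785108733612886260798103440264 = true := by decide +kernel
theorem chunk_ok9 : runs 81 758 115650178472812307066947725922884512209954014405689209223271951024467876149421547437270035760627074346990718032425624160540610132683735567778267782651148854729 187125919574001719809716973010607637059273302371273126289603338172424177784400972089879820340803528664935315134898458711244533059056976834310723828085087250466 = true := by decide +kernel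
theorem chunk_ok10 : runs 81 839 9798174451120912445558785144649757148082243494220523290580147486639333658127841144016820895796354650742381254461383043036431993463924350848845186326770158156487270591499492561 15853779289614481577191691577533518174485949824765525957623037737532160833631593681512535189759649213804709691705593604227037581022758330489263385511067756715301085561591382880 = true := by decide +kernel
theorem chunk_ok11 : runs 81 920 830126021787055047622441572678655992350572415327460154154529445889109757788994107326186690751365241695215886721154737728593181500199549345260535478509541567521282541694147401525840003191120565 1343172118197190792578750244364655512769497592664280789098578949032851734178642763891810536882491709396961194463386647005135217509904680325466274697080777803057051246741824115181280325156445346 = true := by decide +kernel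
theorem ck_all (n : ℕ) (h1 : 28 < n) (h2 : n ≤ 1000) : ck n (Nat.fib n) = true := by
  rcases lt_or_ge n 110 with h | h
  · exact runs_sound _ _ _ _ chunk_ok0 (by norm_num) (by norm_num) n (by omega) h
  rcases lt_or_ge n 191 with h | h
  · exact runs_sound _ _ _ _ chunk_ok1 (by norm_num) (by norm_num) n (by omega) h
  rcases lt_or_ge n 272 with h | h
  · exact runs_sound _ _ _ _ chunk_ok2 (by norm_num) (by norm_num) n (by omega) h
  rcases lt_or_ge n 353 with h | h
  · exact runs_sound _ _ _ _ chunk_ok3 (by norm_num) (by norm_num) n (by omega) h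
  rcases lt_or_ge n 434 with h | h
  · exact runs_sound _ _ _ _ chunk_ok4 (by norm_num) (by norm_num) n (by omega) h
  rcases lt_or_ge n 515 with h | h
  · exact runs_sound _ _ _ _ chunk_ok5 (by norm_num) (by norm_num) n (by omega) h
  rcases lt_or_ge n 596 with h | h
  · exact runs_sound _ _ _ _ chunk_ok6 (by norm_num) (by norm_num) n (by omega) h
  rcases lt_or_ge n 677 with h | h
  · exact runs_sound _ _ _ _ chunk_ok7 (by norm_num) (by norm_num) n (by omega) h
  rcases lt_or_ge n 758 with h | h
  · exact runs_sound _ _ _ _ chunk_ok8 (by norm_num) (by norm_num) n (by omega) h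
  rcases lt_or_ge n 839 with h | h
  · exact runs_sound _ _ _ _ chunk_ok9 (by norm_num) (by norm_num) n (by omega) h
  rcases lt_or_ge n 920 with h | h
  · exact runs_sound _ _ _ _ chunk_ok10 (by norm_num) (by norm_num) n (by omega) h
  rcases lt_or_ge n 1001 with h | h
  · exact runs_sound _ _ _ _ chunk_ok11 (by norm_num) (by norm_num) n (by omega) h
  omega
end N3sec

section N4sec
theorem real_hom (S α β τ E : ℝ) (A B T s t U V : ℤ) (W Lh : ℝ) (hS : 0 < S) (hE : 0 ≤ E)
    (hα : |S*α - A| ≤ E) (hβ : |S*β - B| ≤ E) (hτ : |S*τ - T| ≤ 3*E) (hU : |(U:ℝ)| ≤ W)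
    (hl : S*|U*α+V*β-τ| ≤ Lh) (ht : 0 < t)
    (hc : W * (|((t*A - s*B:ℤ):ℝ)| + (t+|(s:ℝ)|)*E) + t*(|(T:ℝ)|+3*E+Lh) + E < B) :
    U*s+V*t = 0 := by
  by_contra hne
  have h1 : (1:ℝ) ≤ |((U*s+V*t : ℤ):ℝ)| := by exact_mod_cast Int.one_le_abs hne
  have ht' : (0:ℝ) < t := by exact_mod_cast ht
  have hd : |S*(t*α-s*β)| ≤ |((t*A - s*B:ℤ):ℝ)| + (t+|(s:ℝ)|)*E := by
    have e : S*(t*α-s*β) = ((t*A - s*B:ℤ):ℝ) + (t*(S*α-A) - s*(S*β-B)) := by push_cast; ring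
    rw [e]
    refine (abs_add_le _ _).trans ?_
    refine add_le_add le_rfl ((abs_sub _ _).trans ?_)
    rw [abs_mul, abs_mul, abs_of_pos ht', add_mul]
    gcongr
  have hB : (B:ℝ) - E ≤ S*β := by have := abs_le.1 hβ; linarith
  have hW : 0 ≤ W := (abs_nonneg _).trans hU
  have hLh : 0 ≤ Lh := le_trans (by positivity) hl
  have hBE : 0 < (B:ℝ) - E := by
    have : 0 ≤ W * (|((t*A - s*B:ℤ):ℝ)| + (t+|(s:ℝ)|)*E) := by positivity
    have : 0 ≤ t*(|(T:ℝ)|+3*E+Lh) := by positivity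
    linarith
  have e : (S*β)*((U*s+V*t : ℤ):ℝ) = t*(S*(U*α+V*β-τ)) + t*(S*τ) - U*(S*(t*α-s*β)) := by push_cast; ring
  have hT : |S*τ| ≤ |(T:ℝ)| + 3*E := by
    have e2 : S*τ = T + (S*τ - T) := by ring
    rw [e2]; exact (abs_add_le _ _).trans (by linarith)
  have h2 : |(S*β)*((U*s+V*t : ℤ):ℝ)| ≤ t*Lh + t*(|(T:ℝ)|+3*E) + W * (|((t*A - s*B:ℤ):ℝ)| + (t+|(s:ℝ)|)*E) := by
    rw [e]
    refine (abs_sub _ _).trans (add_le_add ((abs_add_le _ _).trans (add_le_add ?_ ?_)) ?_)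
    · rw [abs_mul, abs_of_pos ht', abs_mul, abs_of_pos hS]; gcongr
    · rw [abs_mul, abs_of_pos ht']; gcongr
    · rw [abs_mul]; gcongr
  rw [abs_mul, abs_of_pos (by linarith : 0 < S*β)] at h2
  have h3 : S*β*1 ≤ S*β*|((U*s+V*t : ℤ):ℝ)| := by
    apply mul_le_mul_of_nonneg_left h1; linarith
  linarith

theorem real_inh (S α β τ E : ℝ) (A B T s t g U V : ℤ) (W err : ℝ) (hS : 0 < S) (hE : 0 ≤ E)
    (hα : |S*α - A| ≤ E) (hβ : |S*β - B| ≤ E) (hτ : |S*τ - T| ≤ 3*E) (hU : |(U:ℝ)| ≤ W)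
    (hl : S*|U*α+V*β-τ| ≤ 1) (ht : 0 < t) (hBE : E ≤ B)
    (herr : W * (|((t*A - s*B:ℤ):ℝ)| + (t+|(s:ℝ)|)*E) + t + 3*E*t + (|(g:ℝ)|+1)*E ≤ err)
    (h1 : g*B + err < t*(T:ℝ)) (h2 : t*(T:ℝ) + err < (g+1)*B) : False := by
  have ht' : (0:ℝ) < t := by exact_mod_cast ht
  have hd : |S*(t*α-s*β)| ≤ |((t*A - s*B:ℤ):ℝ)| + (t+|(s:ℝ)|)*E := by
    have e : S*(t*α-s*β) = ((t*A - s*B:ℤ):ℝ) + (t*(S*α-A) - s*(S*β-B)) := by push_cast; ring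
    rw [e]
    refine (abs_add_le _ _).trans ?_
    refine add_le_add le_rfl ((abs_sub _ _).trans ?_)
    rw [abs_mul, abs_mul, abs_of_pos ht', add_mul]
    gcongr
  have hW : 0 ≤ W := (abs_nonneg _).trans hU
  have hβ0 : 0 ≤ S*β := by have := abs_le.1 hβ; linarith
  obtain ⟨k, hk⟩ : ∃ k : ℤ, k = U*s+V*t := ⟨_, rfl⟩
  have e : t*(S*τ) - (S*β)*(k:ℝ) = U*(S*(t*α-s*β)) - t*(S*(U*α+V*β-τ)) := by rw [hk]; push_cast; ring
  have hm : |t*(S*τ) - (S*β)*(k:ℝ)| ≤ W * (|((t*A - s*B:ℤ):ℝ)| + (t+|(s:ℝ)|)*E) + t*1 := by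
    rw [e]
    refine (abs_sub _ _).trans (add_le_add ?_ ?_)
    · rw [abs_mul]; gcongr
    · rw [abs_mul, abs_of_pos ht', abs_mul, abs_of_pos hS]; gcongr
  have hτ1 : |t*(S*τ) - t*(T:ℝ)| ≤ 3*E*t := by
    rw [← mul_sub, abs_mul, abs_of_pos ht']; nlinarith
  rw [abs_le] at hm hτ1
  have hg : |(g:ℝ)*(S*β) - g*B| ≤ |(g:ℝ)| * E := by
    rw [← mul_sub, abs_mul]; gcongr
  have hg1 : |((g:ℝ)+1)*(S*β) - (g+1)*B| ≤ (|(g:ℝ)|+1)*E := by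
    rw [← mul_sub, abs_mul]
    have : |(g:ℝ)+1| ≤ |(g:ℝ)|+1 := (abs_add_le _ _).trans (by simp)
    gcongr
  rw [abs_le] at hg hg1
  rcases le_or_gt k g with q | q
  · have : (k:ℝ) ≤ g := by exact_mod_cast q
    have := mul_le_mul_of_nonneg_left this hβ0
    linarith
  · have : (g:ℝ) + 1 ≤ k := by exact_mod_cast q
    have := mul_le_mul_of_nonneg_left this hβ0
    linarith

theorem homc_sound (W : ℕ) (A : ℤ) (B : ℕ) (T : ℤ) (Lh t : ℕ) (s : ℤ) (h : homc W A B T Lh t s = true)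
    (α β τ : ℝ) (hα : |SS*α - A| ≤ EE) (hβ : |SS*β - B| ≤ EE) (hτ : |SS*τ - T| ≤ 3*EE) (U V : ℤ)
    (hU : |U| ≤ W) (hl : SS*|U*α+V*β-τ| ≤ Lh) : U = 0 ∧ V = 0 := by
  simp only [homc, Bool.and_eq_true, Nat.ble_eq, Nat.beq_eq_true_eq] at h
  obtain ⟨⟨h1, h2⟩, h3⟩ := h
  have ht : (0:ℤ) < t := by omega
  have key := real_hom SS α β τ EE A B T s t U V W Lh SS_pos (Nat.cast_nonneg _) hα (by exact_mod_cast hβ) hτ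
    (by exact_mod_cast hU) hl ht (by
      have h3' := h3
      have : ((W * ((t * A - s * B).natAbs + (t + s.natAbs) * EE) + t * (T.natAbs + 3 * EE + Lh) + EE + 1 : ℕ):ℝ) ≤ (B:ℝ) := by exact_mod_cast h3
      push_cast [Nat.cast_natAbs] at this ⊢
      linarith)
  have hdvd : (t:ℤ) ∣ U := by
    have : (t:ℤ) ∣ U * s := ⟨-V, by linarith⟩
    refine IsCoprime.dvd_of_dvd_mul_right ?_ this
    rw [Int.isCoprime_iff_gcd_eq_one, Int.gcd_comm]
    simpa [Int.gcd] using h1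
  have hU0 : U = 0 := by
    apply Int.eq_zero_of_abs_lt_dvd hdvd
    omega
  refine ⟨hU0, ?_⟩
  rw [hU0] at key
  have : V * (t:ℤ) = 0 := by linarith
  rcases mul_eq_zero.1 this with h | h
  · exact h
  · omega

theorem inhc_sound (W : ℕ) (A : ℤ) (B : ℕ) (T : ℤ) (t : ℕ) (s g : ℤ) (err : ℕ) (h : inhc W A B T t s g err = true)
    (α β τ : ℝ) (hα : |SS*α - A| ≤ EE) (hβ : |SS*β - B| ≤ EE) (hτ : |SS*τ - T| ≤ 3*EE) (U V : ℤ)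
    (hBE : EE ≤ B)
    (hU : |U| ≤ W) (hl : SS*|U*α+V*β-τ| ≤ 1) : False := by
  simp only [inhc, Bool.and_eq_true, Nat.ble_eq, decide_eq_true_eq] at h
  obtain ⟨⟨h1, h2⟩, h3⟩ := h
  have ht : (0:ℤ) < t := by
    rcases Nat.eq_zero_or_pos t with e | e
    · exfalso
      rw [e] at h2 h3
      simp only [Nat.cast_zero, zero_mul] at h2 h3
      have hB0 : (0:ℤ) < B := by
        have : 0 < EE := by decide +kernel
        omega
      have a1 : g < 0 := by
        by_contra hc; push Not at hc
        have := mul_nonneg hc hB0.le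
        omega
      have a2 : (g+1) * B ≤ 0 := mul_nonpos_of_nonpos_of_nonneg (by omega) hB0.le
      omega
    · exact_mod_cast e
  refine real_inh SS α β τ EE A B T s t g U V W err SS_pos (Nat.cast_nonneg _) hα (by exact_mod_cast hβ) hτ
    (by exact_mod_cast hU) hl ht (by exact_mod_cast hBE) ?_ (by exact_mod_cast h2) (by exact_mod_cast h3)
  have : ((W * ((t * A - s * B).natAbs + (t + s.natAbs) * EE) + t + 3 * EE * t + (g.natAbs + 1) * EE : ℕ):ℝ) ≤ (err:ℝ) := by exact_mod_cast h1
  push_cast [Nat.cast_natAbs] at this ⊢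
  linarith

theorem homc_B (W : ℕ) (A : ℤ) (B : ℕ) (T : ℤ) (Lh t : ℕ) (s : ℤ) (h : homc W A B T Lh t s = true) : EE ≤ B := by
  simp only [homc, Bool.and_eq_true, Nat.ble_eq, Nat.beq_eq_true_eq] at h
  obtain ⟨⟨h1, h2⟩, h3⟩ := h
  omega

theorem tst_sound (A Bz T : ℤ) (Lh : ℕ) (h : tst A Bz T Lh = true)
    (α β τ : ℝ) (hα : |SS*α - A| ≤ EE) (hβ : |SS*β - Bz| ≤ EE) (hτ : |SS*τ - T| ≤ 3*EE) (U V : ℤ)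
    (hU : |U| ≤ UU + 1) (hl : SS*|U*α+V*β-τ| ≤ Lh) (hl2 : 1024 < |U| → SS*|U*α+V*β-τ| ≤ 1) : U = 0 ∧ V = 0 := by
  simp only [tst, frcI_eq, frc_eq] at h
  have hBz : Bz.toNat = Bz ∨ Bz.toNat = 0 := by omega
  rcases hBz with e | e
  swap
  · exfalso
    rw [e] at h
    have no : ∀ W t s, homc W A 0 T Lh t s = false := by
      intro W t s
      by_contra hc
      have := homc_B W A 0 T Lh t s (by simpa using hc)
      revert this; decide +kernel
    simp [homt, frcI_eq, frc_eq, no] at h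
  generalize Bz.toNat = B at *
  subst e
  simp only [Int.cast_natCast] at hβ
  by_cases q1 : homt (UU+1) A B T Lh = true
  · simp only [homt, frcI_eq, frc_eq] at q1
    exact homc_sound _ _ _ _ _ _ _ q1 α β τ hα hβ hτ U V (by exact_mod_cast hU) hl
  · simp only [Bool.not_eq_true] at q1
    rw [q1] at h
    simp only [cond_false] at h
    by_cases q2 : homt 1024 A B T Lh = true
    · rw [q2] at h
      simp only [cond_true] at h
      simp only [homt, frcI_eq, frc_eq] at q2
      rcases le_or_gt |U| 1024 with w | w
      · exact homc_sound _ _ _ _ _ _ _ q2 α β τ hα hβ hτ U V (by exact_mod_cast w) hl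
      · exfalso
        have hB := homc_B _ _ _ _ _ _ _ q2
        by_cases q3 : inht (UU+1) (UU*16) A B T = true
        · simp only [inht, frcI_eq, frc_eq] at q3
          exact inhc_sound _ _ _ _ _ _ _ _ q3 α β τ hα hβ hτ U V hB (by exact_mod_cast hU) (hl2 w)
        · simp only [Bool.not_eq_true] at q3
          rw [q3] at h
          simp only [cond_false] at h
          simp only [inht, frcI_eq, frc_eq] at h
          exact inhc_sound _ _ _ _ _ _ _ _ h α β τ hα hβ hτ U V hB (by exact_mod_cast hU) (hl2 w)
    · simp only [Bool.not_eq_true] at q2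
      rw [q2] at h
      simp at h
end N4sec

section N5sec
theorem lgk_sound (N D : ℕ) (k : ℤ → Bool) (h : lgk N D k = true) : lgc N D = true ∧ k (lgv N D) = true := by
  simp only [lgk, frcI_eq] at h
  cases hc : lgc N D with
  | false => rw [hc] at h; simp at h
  | true => rw [hc] at h; exact ⟨rfl, h⟩

theorem lqc_bd (N D : ℕ) (h : lqc N D = true) : 1 ≤ D ∧ D ≤ N ∧ N ≤ 2 * D := by
  simp only [lqc, lqck, Bool.and_eq_true, Nat.ble_eq, Nat.mul_eq, Nat.add_eq, Nat.sub_eq] at h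
  obtain ⟨⟨⟨⟨g1, g2⟩, g3⟩, -⟩, -⟩ := h
  omega

theorem lg_sound (N D : ℕ) (h : lgc N D = true) : 0 < N ∧ 0 < D ∧ D ≤ 2 * N ∧
    |(SS:ℝ) * Real.log ((N:ℝ)/D) - (lgv N D : ℝ)| ≤ 12 := by
  unfold lgc at h
  unfold lgv
  cases hc : Nat.ble D N with
  | true =>
    rw [hc] at h
    have h1 : lqc N D = true := h
    have := lqc_bd N D h1
    refine ⟨by omega, by omega, by omega, ?_⟩
    have := lq_sound N D h1
    simpa using this
  | false =>
    rw [hc] at h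
    have h1 : lqc D N = true := h
    have := lqc_bd D N h1
    refine ⟨by omega, by omega, by omega, ?_⟩
    have := lq_sound D N h1
    rw [← inv_div, Real.log_inv, mul_neg, ← neg_add', abs_neg] at this
    convert this using 2
    simp only [cond_false]
    have : Int.neg (Int.ofNat (lqv D N)) = -((lqv D N : ℕ) : ℤ) := rfl
    rw [this]; push_cast; ring

theorem lg_rel (N D : ℕ) (h : lgc N D = true) (x base : ℝ) (hb : 1000 ≤ base) (hD : (D:ℝ) = base * SS)
    (hx : |SS * x - N| ≤ 2) : 0 < x ∧ |(SS:ℝ) * Real.log x - (SS * Real.log base + (lgv N D : ℝ))| ≤ 13 := by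
  obtain ⟨h1, h2, h3, h4⟩ := lg_sound N D h
  have hS := SS_pos
  have h3' : (D:ℝ) ≤ 2 * N := by exact_mod_cast h3
  have hN : 500 * (SS:ℝ) ≤ N := by nlinarith
  have hSge : (1000:ℝ) ≤ SS := by
    have : 1000 ≤ SS := by decide +kernel
    exact_mod_cast this
  have hN0 : (0:ℝ) < N := by exact_mod_cast h1
  rw [abs_le] at hx
  have hx0 : 0 < x := by
    by_contra hc; push Not at hc
    have := mul_nonpos_of_nonneg_of_nonpos hS.le hc
    linarith
  refine ⟨hx0, ?_⟩
  have hND : (0:ℝ) < (N:ℝ)/D := by positivity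
  have e : Real.log x = Real.log base + Real.log ((N:ℝ)/D) + Real.log (SS*x/N) := by
    rw [← Real.log_mul (by positivity) hND.ne', ← Real.log_mul (by positivity) (by positivity)]
    congr 1
    rw [hD]; field_simp
  have q : 0 < SS*x/N := by positivity
  have u1 := Real.log_le_sub_one_of_pos q
  have u2 := Real.one_sub_inv_le_log_of_pos q
  have w1 : SS * (SS*x/N - 1) ≤ 1 := by
    rw [show (SS:ℝ) * (SS*x/N - 1) = SS*(SS*x-N)/N by field_simp, div_le_one hN0]
    nlinarith
  have w2 : -1 ≤ SS * (1 - (SS*x/N)⁻¹) := by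
    rw [show (SS:ℝ) * (1 - (SS*x/N)⁻¹) = (SS*x-N)/x by field_simp, le_div_iff₀ hx0]
    have : 2 ≤ x := by
      by_contra hc; push Not at hc
      have := mul_lt_mul_of_pos_left hc hS
      linarith
    linarith
  have v1 := mul_le_mul_of_nonneg_left u1 hS.le
  have v2 := mul_le_mul_of_nonneg_left u2 hS.le
  rw [abs_le] at h4 ⊢
  rw [e]
  constructor <;> linarith

theorem ln2_bd : |(SS:ℝ) * Real.log 2 - (LN2:ℝ)| ≤ 12 := by
  have h1 : lqc 2 1 = true := by decide +kernel
  have h2 : lqv 2 1 = LN2 := by decide +kernel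
  have := lq_sound 2 1 h1
  rw [h2] at this
  simpa using this

theorem pf_real (a b : ℕ) (th : Fin 3 → ℝ) (H : RD a b th) (x : ℤ) :
    ((pf a b x : ℤ):ℝ) = (x - SS * th 0) * (x - SS * th 1) * (x - SS * th 2) := by
  have hS := SS_pos
  have := H.fact ((x:ℝ)/SS)
  have e : ((pf a b x : ℤ):ℝ) = SS^3 * ((x:ℝ)/SS * ((x:ℝ)/SS - ((a:ℤ):ℝ)) * ((x:ℝ)/SS - ((b:ℤ):ℝ)) - 1) := by
    unfold pf; push_cast; field_simp
  rw [e, this]; field_simp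

theorem sgn_aux {x y z : ℝ} (hy : y < 0) (hz : z < 0) : (0 ≤ x*y*z → 0 ≤ x) ∧ (x*y*z ≤ 0 → x ≤ 0) := by
  have := mul_pos_of_neg_of_neg hy hz
  constructor
  · intro h; by_contra hc; push Not at hc
    have := mul_neg_of_neg_of_pos hc this
    linarith
  · intro h; by_contra hc; push Not at hc
    have := mul_pos hc this
    linarith

theorem sgn_aux2 {x y z : ℝ} (hy : 0 < y) (hz : z < 0) : (0 ≤ y*x*z → x ≤ 0) ∧ (y*x*z ≤ 0 → 0 ≤ x) := by
  have := mul_neg_of_pos_of_neg hy hz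
  constructor
  · intro h; by_contra hc; push Not at hc
    have := mul_neg_of_pos_of_neg hc this
    linarith
  · intro h; by_contra hc; push Not at hc
    have := mul_pos_of_neg_of_neg hc this
    linarith

theorem sgn_aux3 {x y z : ℝ} (hy : 0 < y) (hz : 0 < z) : (0 ≤ y*z*x → 0 ≤ x) ∧ (y*z*x ≤ 0 → x ≤ 0) := by
  have := mul_pos hy hz
  constructor
  · intro h; by_contra hc; push Not at hc
    have := mul_neg_of_pos_of_neg this hc
    linarith
  · intro h; by_contra hc; push Not at hc
    have := mul_pos this hc
    linarith

theorem rt_sound (a b X0 X1 X2 : ℕ) (th : Fin 3 → ℝ) (H : RD a b th) (h : rtc a b X0 X1 X2 = true) :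
    |SS * th 0 - X0| ≤ 1 ∧ |SS * th 1 - X1| ≤ 1 ∧ |SS * th 2 - X2| ≤ 1 ∧ X0 ≤ SS ∧ X0 ≤ X1 ∧ X1 ≤ a * SS ∧ b * SS ≤ X2 := by
  simp only [rtc, Bool.and_eq_true, Nat.ble_eq, decide_eq_true_eq] at h
  obtain ⟨⟨⟨⟨⟨⟨⟨⟨⟨⟨h0, h1⟩, h2⟩, h3⟩, h4⟩, k1⟩, k2⟩, k3⟩, k4⟩, k5⟩, k6⟩ := h
  have hS := SS_pos
  have hSge : (1000:ℝ) ≤ SS := by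
    have : 1000 ≤ SS := by decide +kernel
    exact_mod_cast this
  have ha := H.haR
  have hb := H.habR
  have hs := H.hsmall
  have p0 := H.p0
  have q0 := H.q0
  have p1 := H.p1
  have q1 := H.q1
  have p2 := H.p2
  have q2 := H.q2
  push_cast at ha hb hs q0 p1 q1 p2 q2
  have k1' : (0:ℝ) ≤ ((pf a b (X0+1) : ℤ):ℝ) := by exact_mod_cast k1
  have k2' : ((pf a b (X0-1) : ℤ):ℝ) ≤ 0 := by exact_mod_cast k2
  have k3' : (0:ℝ) ≤ ((pf a b (X1-1) : ℤ):ℝ) := by exact_mod_cast k3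
  have k4' : ((pf a b (X1+1) : ℤ):ℝ) ≤ 0 := by exact_mod_cast k4
  have k5' : (0:ℝ) ≤ ((pf a b (X2+1) : ℤ):ℝ) := by exact_mod_cast k5
  have k6' : ((pf a b (X2-1) : ℤ):ℝ) ≤ 0 := by exact_mod_cast k6
  rw [pf_real a b th H] at k1' k2' k3' k4' k5' k6'
  push_cast at k1' k2' k3' k4' k5' k6'
  have h0' : (X0:ℝ) ≤ SS := by exact_mod_cast h0
  have ha1 : 1 ≤ a := by have := H.ha; omega
  have h1' : ((a:ℝ)-1)*SS ≤ X1 := by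
    have : (((a-1)*SS:ℕ):ℝ) ≤ X1 := by exact_mod_cast h1
    push_cast [Nat.cast_sub ha1] at this; exact this
  have h2' : (X1:ℝ) ≤ a*SS := by exact_mod_cast h2
  have h3' : (b:ℝ)*SS ≤ X2 := by exact_mod_cast h3
  have h4' : (X2:ℝ) ≤ (b+1)*SS := by exact_mod_cast h4
  have e0 : SS * th 0 ≤ SS * 1 := by gcongr; linarith
  have e1 : SS * th 1 ≤ SS * a := by gcongr
  have e1' : (SS:ℝ) * (a - 1) ≤ SS * th 1 := by gcongr; linarith
  have e2 : (SS:ℝ) * b ≤ SS * th 2 := by gcongr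
  have e0' : 0 < SS * th 0 := by positivity
  have ea : (SS:ℝ) * 514229 ≤ SS * a := by gcongr
  have eb : (SS:ℝ) * (1000 * a) ≤ SS * b := by gcongr
  refine ⟨?_, ?_, ?_, h0, ?_, h2, h3⟩
  · rw [abs_le]
    have a1 := (sgn_aux (x := (X0:ℝ)+1 - SS*th 0) (y := (X0:ℝ)+1 - SS*th 1) (z := (X0:ℝ)+1 - SS*th 2) (by linarith) (by linarith)).1 k1'
    have a2 := (sgn_aux (x := (X0:ℝ)-1 - SS*th 0) (y := (X0:ℝ)-1 - SS*th 1) (z := (X0:ℝ)-1 - SS*th 2) (by linarith) (by linarith)).2 k2'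
    constructor <;> linarith
  · rw [abs_le]
    have a1 := (sgn_aux2 (y := (X1:ℝ)-1 - SS*th 0) (x := (X1:ℝ)-1 - SS*th 1) (z := (X1:ℝ)-1 - SS*th 2) (by linarith) (by linarith)).1 k3'
    have a2 := (sgn_aux2 (y := (X1:ℝ)+1 - SS*th 0) (x := (X1:ℝ)+1 - SS*th 1) (z := (X1:ℝ)+1 - SS*th 2) (by linarith) (by linarith)).2 k4'
    constructor <;> linarith
  · rw [abs_le]
    have a1 := (sgn_aux3 (y := (X2:ℝ)+1 - SS*th 0) (z := (X2:ℝ)+1 - SS*th 1) (x := (X2:ℝ)+1 - SS*th 2) (by linarith) (by linarith)).1 k5'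
    have a2 := (sgn_aux3 (y := (X2:ℝ)-1 - SS*th 0) (z := (X2:ℝ)-1 - SS*th 1) (x := (X2:ℝ)-1 - SS*th 2) (by linarith) (by linarith)).2 k6'
    constructor <;> linarith
  · have : (X0:ℝ) ≤ X1 := by linarith
    exact_mod_cast this
end N5sec

section N6sec
/-- the linear form attached to the roots -/
noncomputable def Lam (a : ℤ) (th : Fin 3 → ℝ) (i k j : Fin 3) (u v : ℤ) : ℝ :=
  u * (Real.log |th i| - Real.log |th k|) + v * (Real.log |th i - a| - Real.log |th k - a|)
    - (Real.log |th j - th i| - Real.log |th j - th k|)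

theorem three_tst (Lh : ℕ) (l2 l3 m1 m3 c12 c13 c23 : ℤ) (h : fin Lh l2 l3 m1 m3 c12 c13 c23 = true)
    (L2 L3 M1 M3 C12 C13 C23 : ℝ) (e1 : |SS * L2 - l2| ≤ 12100) (e2 : |SS * L3 - l3| ≤ 12100)
    (e3 : |SS * M1 - m1| ≤ 12100) (e4 : |SS * M3 - m3| ≤ 12100) (e5 : |SS * C12 - c12| ≤ 12100)
    (e6 : |SS * C13 - c13| ≤ 12100) (e7 : |SS * C23 - c23| ≤ 12100) (u v : ℤ) (hu : |u| ≤ UU) :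
    (SS * |u * (L3 - L2) + v * (M1 + 2 * M3) - (C13 - C12)| ≤ Lh → 
       (1000 ≤ |u| → SS * |u * (L3 - L2) + v * (M1 + 2 * M3) - (C13 - C12)| ≤ 1) → u = 1 ∧ v = 0) ∧
    (SS * |u * (2 * L3 + L2) + v * (M3 - M1) - (C23 - C12)| ≤ Lh → 
       (1000 ≤ |u| → SS * |u * (2 * L3 + L2) + v * (M3 - M1) - (C23 - C12)| ≤ 1) → u = 0 ∧ v = 1) ∧
    (SS * |u * (-(2 * L2 + L3)) + v * (2 * M1 + M3) - (C13 - C23)| ≤ Lh → 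
       (1000 ≤ |u| → SS * |u * (-(2 * L2 + L3)) + v * (2 * M1 + M3) - (C13 - C23)| ≤ 1) → u = -1 ∧ v = -1) := by
  simp only [fin, Bool.and_eq_true] at h
  obtain ⟨⟨t0, t1⟩, t2⟩ := h
  have hE : (EE:ℝ) = 131072 := by
    have : EE = 131072 := by decide +kernel
    rw [this]; norm_num
  rw [abs_le] at e1 e2 e3 e4 e5 e6 e7
  have habs : ∀ w : ℤ, |w| ≤ 1 → |u - w| ≤ UU + 1 ∧ (1024 < |u - w| → 1000 ≤ |u|) := by
    intro w hw
    have := abs_sub u w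
    constructor <;> intros <;> omega
  refine ⟨fun q1 q2 => ?_, fun q1 q2 => ?_, fun q1 q2 => ?_⟩
  · have e : ((u - 1 : ℤ):ℝ) * (L3 - L2) + ((v - 0 : ℤ):ℝ) * (M1 + 2 * M3) - (C13 - C12 - (L3 - L2)) = 
      u * (L3 - L2) + v * (M1 + 2 * M3) - (C13 - C12) := by push_cast; ring
    have := tst_sound _ _ _ _ t0 (L3 - L2) (M1 + 2 * M3) (C13 - C12 - (L3 - L2))
      (by rw [hE, abs_le]; push_cast; constructor <;> linarith) 
      (by rw [hE, abs_le]; push_cast; constructor <;> linarith) 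
      (by rw [hE, abs_le]; push_cast; constructor <;> linarith) (u - 1) (v - 0) (habs 1 (by simp)).1
      (by rw [e]; exact q1) (fun w => by rw [e]; exact q2 ((habs 1 (by simp)).2 w))
    omega
  · have e : ((u - 0 : ℤ):ℝ) * (2 * L3 + L2) + ((v - 1 : ℤ):ℝ) * (M3 - M1) - (C23 - C12 - (M3 - M1)) = 
      u * (2 * L3 + L2) + v * (M3 - M1) - (C23 - C12) := by push_cast; ring
    have := tst_sound _ _ _ _ t1 (2 * L3 + L2) (M3 - M1) (C23 - C12 - (M3 - M1))
      (by rw [hE, abs_le]; push_cast; constructor <;> linarith) 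
      (by rw [hE, abs_le]; push_cast; constructor <;> linarith) 
      (by rw [hE, abs_le]; push_cast; constructor <;> linarith) (u - 0) (v - 1) (habs 0 (by simp)).1
      (by rw [e]; exact q1) (fun w => by rw [e]; exact q2 ((habs 0 (by simp)).2 w))
    omega
  · have e : ((u - -1 : ℤ):ℝ) * (-(2 * L2 + L3)) + ((v - -1 : ℤ):ℝ) * (2 * M1 + M3) - (C13 - C23 + (-(2 * L2 + L3)) + (2 * M1 + M3)) = 
      u * (-(2 * L2 + L3)) + v * (2 * M1 + M3) - (C13 - C23) := by push_cast; ring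
    have := tst_sound _ _ _ _ t2 (-(2 * L2 + L3)) (2 * M1 + M3) (C13 - C23 + (-(2 * L2 + L3)) + (2 * M1 + M3))
      (by rw [hE, abs_le]; push_cast; constructor <;> linarith) 
      (by rw [hE, abs_le]; push_cast; constructor <;> linarith) 
      (by rw [hE, abs_le]; push_cast; constructor <;> linarith) (u - -1) (v - -1) (habs (-1) (by simp)).1
      (by rw [e]; exact q1) (fun w => by rw [e]; exact q2 ((habs (-1) (by simp)).2 w))
    omega

theorem lgs_sound (a b X0 X1 X2 Lh : ℕ) (la lb lc : ℤ) (h : lgs a b X0 X1 X2 Lh la lb lc = true)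
    (th : Fin 3 → ℝ) (H : RD a b th) (hr : rtc a b X0 X1 X2 = true)
    (ha : |SS * Real.log a - la| ≤ 12050) (hb : |SS * Real.log b - lb| ≤ 12050)
    (hc : |SS * Real.log ((b:ℝ) - a) - lc| ≤ 12050) (u v : ℤ) (hu : |u| ≤ UU) :
    (SS * |Lam a th 2 1 0 u v| ≤ Lh → (1000 ≤ |u| → SS * |Lam a th 2 1 0 u v| ≤ 1) → u = 1 ∧ v = 0) ∧
    (SS * |Lam a th 2 0 1 u v| ≤ Lh → (1000 ≤ |u| → SS * |Lam a th 2 0 1 u v| ≤ 1) → u = 0 ∧ v = 1) ∧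
    (SS * |Lam a th 0 1 2 u v| ≤ Lh → (1000 ≤ |u| → SS * |Lam a th 0 1 2 u v| ≤ 1) → u = -1 ∧ v = -1) := by
  unfold lgs at h
  obtain ⟨g1, h⟩ := lgk_sound _ _ _ h
  obtain ⟨g2, h⟩ := lgk_sound _ _ _ h
  obtain ⟨g3, h⟩ := lgk_sound _ _ _ h
  obtain ⟨g4, h⟩ := lgk_sound _ _ _ h
  obtain ⟨g5, h⟩ := lgk_sound _ _ _ h
  obtain ⟨g6, h⟩ := lgk_sound _ _ _ h
  obtain ⟨g7, h⟩ := lgk_sound _ _ _ h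
  obtain ⟨r0, r1, r2, x0, x01, x1, x2⟩ := rt_sound a b X0 X1 X2 th H hr
  have hS := SS_pos
  have haR : (514229:ℝ) ≤ a := by simpa using H.haR
  have habR : (1000:ℝ) * a ≤ b := by simpa using H.habR
  have habN : 1000 * a ≤ b := by exact_mod_cast habR
  have haN : 514229 ≤ a := by exact_mod_cast haR
  have hSa : SS ≤ a * SS := Nat.le_mul_of_pos_left _ (by omega)
  have hab : a * SS ≤ b * SS := Nat.mul_le_mul_right _ (by omega)
  have hbR : (1000:ℝ) ≤ (b:ℝ) := by linarith
  have hbaR : (1000:ℝ) ≤ (b:ℝ) - a := by linarith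
  rw [abs_le] at r0 r1 r2 ha hb hc
  have w1 := lg_rel _ _ g1 (th 1) a (by linarith) (by push_cast; ring) (by rw [abs_le]; constructor <;> linarith)
  have w2 := lg_rel _ _ g2 (th 2) b (by linarith) (by push_cast; ring) (by rw [abs_le]; constructor <;> linarith)
  have w3 := lg_rel _ _ g3 (a - th 0) a (by linarith) (by push_cast; ring) (by
    rw [Nat.cast_sub (by omega), abs_le]; push_cast; constructor <;> linarith)
  have hbaN : a ≤ b := by omega
  have w4 := lg_rel _ _ g4 (th 2 - a) (b - a) (by linarith) (by push_cast [Nat.cast_sub hbaN]; ring) (by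
    rw [Nat.cast_sub (by omega), abs_le]; push_cast; constructor <;> linarith)
  have w5 := lg_rel _ _ g5 (th 1 - th 0) a (by linarith) (by push_cast; ring) (by
    rw [Nat.cast_sub (by omega), abs_le]; constructor <;> linarith)
  have w6 := lg_rel _ _ g6 (th 2 - th 0) b (by linarith) (by push_cast; ring) (by
    rw [Nat.cast_sub (by omega), abs_le]; constructor <;> linarith)
  have w7 := lg_rel _ _ g7 (th 2 - th 1) (b - a) (by linarith) (by push_cast [Nat.cast_sub hbaN]; ring) (by
    rw [Nat.cast_sub (by omega), abs_le]; constructor <;> linarith)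
  obtain ⟨z1, w1⟩ := w1
  obtain ⟨z2, w2⟩ := w2
  obtain ⟨z3, w3⟩ := w3
  obtain ⟨z4, w4⟩ := w4
  obtain ⟨z5, w5⟩ := w5
  obtain ⟨z6, w6⟩ := w6
  obtain ⟨z7, w7⟩ := w7
  rw [abs_le] at w1 w2 w3 w4 w5 w6 w7
  have fin3 := three_tst Lh _ _ _ _ _ _ _ h (Real.log (th 1)) (Real.log (th 2)) (Real.log (a - th 0))
    (Real.log (th 2 - a)) (Real.log (th 1 - th 0)) (Real.log (th 2 - th 0)) (Real.log (th 2 - th 1))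
    (by rw [abs_le]; push_cast; constructor <;> linarith) (by rw [abs_le]; push_cast; constructor <;> linarith)
    (by rw [abs_le]; push_cast; constructor <;> linarith) (by rw [abs_le]; push_cast; constructor <;> linarith)
    (by rw [abs_le]; push_cast; constructor <;> linarith) (by rw [abs_le]; push_cast; constructor <;> linarith)
    (by rw [abs_le]; push_cast; constructor <;> linarith) u v hu
  have p0 := H.p0
  have p1 : th 1 < (a:ℝ) := by simpa using H.p1
  have l0 : Real.log (th 0) = - Real.log (th 1) - Real.log (th 2) := by
    have : Real.log (th 0 * th 1 * th 2) = 0 := by rw [H.s3, Real.log_one]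
    rw [Real.log_mul (by positivity) z2.ne', Real.log_mul p0.ne' z1.ne'] at this
    linarith
  have m0 : Real.log (a - th 1) = - Real.log (a - th 0) - Real.log (th 2 - a) := by
    have : (a - th 0) * (a - th 1) * (th 2 - a) = 1 := by
      have := H.fact a
      simp only [Int.cast_natCast, sub_self, mul_zero, zero_mul] at this
      linarith
    have h1 : Real.log ((a - th 0) * (a - th 1) * (th 2 - a)) = 0 := by rw [this, Real.log_one]
    have : 0 < (a:ℝ) - th 1 := by linarith
    rw [Real.log_mul (by positivity) z4.ne', Real.log_mul z3.ne' this.ne'] at h1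
    linarith
  have q0 : |th 0| = th 0 := abs_of_pos p0
  have q1 : |th 1| = th 1 := abs_of_pos z1
  have q2 : |th 2| = th 2 := abs_of_pos z2
  have q3 : |th 0 - a| = a - th 0 := by rw [abs_sub_comm]; exact abs_of_pos z3
  have q4 : |th 1 - a| = a - th 1 := by rw [abs_sub_comm]; exact abs_of_pos (by linarith)
  have q5 : |th 2 - a| = th 2 - a := abs_of_pos z4
  have c01 : |th 0 - th 1| = th 1 - th 0 := by rw [abs_sub_comm]; exact abs_of_pos z5
  have c02 : |th 0 - th 2| = th 2 - th 0 := by rw [abs_sub_comm]; exact abs_of_pos z6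
  have c12 : |th 1 - th 2| = th 2 - th 1 := by rw [abs_sub_comm]; exact abs_of_pos z7
  have c10 : |th 1 - th 0| = th 1 - th 0 := abs_of_pos z5
  have c20 : |th 2 - th 0| = th 2 - th 0 := abs_of_pos z6
  have c21 : |th 2 - th 1| = th 2 - th 1 := abs_of_pos z7
  have E0 : Lam a th 2 1 0 u v = u * (Real.log (th 2) - Real.log (th 1)) + v * (Real.log (a - th 0) + 2 * Real.log (th 2 - a)) - (Real.log (th 2 - th 0) - Real.log (th 1 - th 0)) := by
    simp only [Lam, Int.cast_natCast, q0, q1, q2, q3, q4, q5, c01, c02, c12, c10, c20, c21, l0, m0]; ring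
  have E1 : Lam a th 2 0 1 u v = u * (2 * Real.log (th 2) + Real.log (th 1)) + v * (Real.log (th 2 - a) - Real.log (a - th 0)) - (Real.log (th 2 - th 1) - Real.log (th 1 - th 0)) := by
    simp only [Lam, Int.cast_natCast, q0, q1, q2, q3, q4, q5, c01, c02, c12, c10, c20, c21, l0, m0]; ring
  have E2 : Lam a th 0 1 2 u v = u * (-(2 * Real.log (th 1) + Real.log (th 2))) + v * (2 * Real.log (a - th 0) + Real.log (th 2 - a)) - (Real.log (th 2 - th 0) - Real.log (th 2 - th 1)) := by
    simp only [Lam, Int.cast_natCast, q0, q1, q2, q3, q4, q5, c01, c02, c12, c10, c20, c21, l0, m0]; ring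
  rw [E0, E1, E2]
  exact fin3

theorem ck_sound (n a : ℕ) (hn : n ≤ 1000) (h : ck n a = true) (th : Fin 3 → ℝ) (H : RD a ((2^n : ℕ) : ℤ) th)
    (u v : ℤ) (hu : |u| ≤ UU) (Lm : ℝ) (hLm : SS * Lm ≤ 1000 * SS / ((a:ℝ) * 2^n)^3)
    (hLm2 : 1000 ≤ |u| → SS * Lm ≤ 1) :
    (|Lam a th 2 1 0 u v| ≤ Lm → u = 1 ∧ v = 0) ∧ (|Lam a th 2 0 1 u v| ≤ Lm → u = 0 ∧ v = 1) ∧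
    (|Lam a th 0 1 2 u v| ≤ Lm → u = -1 ∧ v = -1) := by
  have hS := SS_pos
  simp only [ck, frc_eq, ckb] at h
  generalize it1 a (2 ^ n) (640 / (2 * n) + 2) = X0 at h
  generalize a * SS - it2 a (2 ^ n) (640 / (2 * n) + 2) = X1 at h
  generalize 2 ^ n * SS + it3 a (2 ^ n) (640 / (2 * n) + 2) = X2 at h
  cases hr : rtc a (2^n) X0 X1 X2 with
  | false => rw [hr] at h; simp at h
  | true =>
  rw [hr] at h
  simp only [cond_true] at h
  generalize (bif (2 ^ (2 * a.log2 + 1)).ble (a * a) then a.log2 + 1 else a.log2) = e at h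
  cases he : Nat.ble e 1000 with
  | false => rw [he] at h; simp at h
  | true =>
  rw [he] at h
  simp only [cond_true] at h
  rw [Nat.ble_eq] at he
  obtain ⟨g1, h⟩ := lgk_sound _ _ _ h
  obtain ⟨g2, h⟩ := lgk_sound _ _ _ h
  have haR : (514229:ℝ) ≤ a := by simpa using H.haR
  have habR : (1000:ℝ) * a ≤ 2^n := by simpa using H.habR
  have hln := ln2_bd
  obtain ⟨-, -, -, v1⟩ := lg_sound _ _ g1
  obtain ⟨-, -, -, v2⟩ := lg_sound _ _ g2
  have habN : a ≤ 2^n := by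
    have : (a:ℝ) ≤ 2^n := by linarith
    exact_mod_cast this
  rw [Real.log_div (by positivity) (by positivity)] at v1
  rw [Nat.cast_sub habN] at v2
  push_cast at v1 v2
  rw [Real.log_div (by linarith) (by positivity), Real.log_pow] at v2
  rw [Real.log_pow] at v1
  have he' : (e:ℝ) ≤ 1000 := by exact_mod_cast he
  have hn' : (n:ℝ) ≤ 1000 := by exact_mod_cast hn
  have ee : |(e:ℝ) * (SS * Real.log 2 - LN2)| ≤ 1000 * 12 := by
    rw [abs_mul, abs_of_nonneg (Nat.cast_nonneg e)]; gcongr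
  have en : |(n:ℝ) * (SS * Real.log 2 - LN2)| ≤ 1000 * 12 := by
    rw [abs_mul, abs_of_nonneg (Nat.cast_nonneg n)]; gcongr
  rw [abs_le] at v1 v2 ee en
  have key := lgs_sound a (2^n) X0 X1 X2 _ _ _ _ h th H hr
    (by rw [abs_le]; push_cast; constructor <;> linarith)
    (by rw [abs_le]; push_cast; rw [Real.log_pow]; constructor <;> linarith)
    (by rw [abs_le]; push_cast; constructor <;> linarith) u v hu
  have hLh : SS * Lm ≤ ((1000 * SS / (a * 2^n)^3 + 1 : ℕ) : ℝ) := by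
    refine hLm.trans ?_
    have hp : 0 < (a * 2^n)^3 := by
      have : 0 < a := by have := H.ha; omega
      positivity
    have := (nat_div_bd (1000 * SS) ((a*2^n)^3) hp).1
    push_cast at this ⊢
    linarith
  refine ⟨fun q => key.1 ?_ ?_, fun q => key.2.1 ?_ ?_, fun q => key.2.2 ?_ ?_⟩
  · exact (mul_le_mul_of_nonneg_left q hS.le).trans hLh
  · intro w; exact (mul_le_mul_of_nonneg_left q hS.le).trans (hLm2 w)
  · exact (mul_le_mul_of_nonneg_left q hS.le).trans hLh
  · intro w; exact (mul_le_mul_of_nonneg_left q hS.le).trans (hLm2 w)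
  · exact (mul_le_mul_of_nonneg_left q hS.le).trans hLh
  · intro w; exact (mul_le_mul_of_nonneg_left q hS.le).trans (hLm2 w)
end N6sec

section R1sec
theorem fib_facts (n : ℕ) (hn : 28 < n) : 514229 ≤ Nat.fib n ∧ 1000 * Nat.fib n ≤ 2^n ∧ 2^n ≤ (Nat.fib n)^2 := by
  have key : ∀ k, 514229 ≤ Nat.fib (29+k) ∧ 1000 * Nat.fib (29+k) ≤ 2^(29+k) ∧ 2^(29+k) ≤ (Nat.fib (29+k))^2 ∧
     1000 * Nat.fib (29+k+1) ≤ 2^(29+k+1) ∧ 3 * Nat.fib (29+k) ≤ 2 * Nat.fib (29+k+1) ∧ Nat.fib (29+k+1) ≤ 2 * Nat.fib (29+k) := by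
    intro k
    induction k with
    | zero => norm_num
    | succ k ih =>
      obtain ⟨h1, h2, h3, h4, h5, h6⟩ := ih
      have e : Nat.fib (29+(k+1)+1) = Nat.fib (29+k) + Nat.fib (29+k+1) := Nat.fib_add_two
      have e2 : 29 + (k+1) = 29+k+1 := by ring
      have e3 : 2^(29+(k+1)+1) = 2 * 2^(29+k+1) := by rw [← e2]; ring
      have e4 : 2^(29+k+1) = 2 * 2^(29+k) := by ring
      rw [e, e3, e2]
      refine ⟨by omega, h4, ?_, by omega, by omega, by omega⟩
      rw [e4]
      nlinarith
  obtain ⟨k, rfl⟩ : ∃ k, n = 29+k := ⟨n-29, by omega⟩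
  obtain ⟨h1, h2, h3, -⟩ := key k
  exact ⟨h1, h2, h3⟩

theorem vieta (s p r0 r1 r2 : ℝ) (h01 : r0 < r1) (h12 : r1 < r2) (e0 : r0^3 - s*r0^2 + p*r0 - 1 = 0)
    (e1 : r1^3 - s*r1^2 + p*r1 - 1 = 0) (e2 : r2^3 - s*r2^2 + p*r2 - 1 = 0) :
    r0 + r1 + r2 = s ∧ r0*r1+r0*r2+r1*r2 = p ∧ r0*r1*r2 = 1 := by
  have d1 : r1^2+r1*r0+r0^2 - s*(r1+r0) + p = 0 := by
    have : (r1 - r0) * (r1^2+r1*r0+r0^2 - s*(r1+r0) + p) = 0 := by linear_combination e1 - e0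
    rcases mul_eq_zero.1 this with h | h
    · linarith
    · exact h
  have d2 : r2^2+r2*r0+r0^2 - s*(r2+r0) + p = 0 := by
    have : (r2 - r0) * (r2^2+r2*r0+r0^2 - s*(r2+r0) + p) = 0 := by linear_combination e2 - e0
    rcases mul_eq_zero.1 this with h | h
    · linarith
    · exact h
  have d3 : r0 + r1 + r2 - s = 0 := by
    have : (r2 - r1) * (r0 + r1 + r2 - s) = 0 := by linear_combination d2 - d1
    rcases mul_eq_zero.1 this with h | h
    · linarith
    · exact h
  have hs : s = r0 + r1 + r2 := by linarith
  have hp : p = r0*r1+r0*r2+r1*r2 := by rw [hs] at d1; linear_combination d1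
  refine ⟨hs.symm, hp.symm, ?_⟩
  rw [hs, hp] at e0
  linear_combination e0

theorem RD_exists (a b : ℤ) (ha : 514229 ≤ a) (hab : 1000 * a ≤ b) (hba : b ≤ a^2) : ∃ th, RD a b th := by
  have haR : (514229:ℝ) ≤ a := by exact_mod_cast ha
  have habR : (1000:ℝ) * a ≤ b := by exact_mod_cast hab
  have hP : (0:ℝ) < a * b := by apply mul_pos <;> linarith
  obtain ⟨ε, hε⟩ : ∃ ε : ℝ, ε = 2 / (a * b) := ⟨_, rfl⟩
  have he : ε * (a * b) = 2 := by rw [hε]; exact div_mul_cancel₀ _ hP.ne'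
  have he0 : 0 < ε := by rw [hε]; positivity
  have he1 : ε < 1/1000 := by
    rw [hε, div_lt_div_iff₀ hP (by norm_num)]; nlinarith
  let f : ℝ → ℝ := fun x => x * (x - a) * (x - b)
  have hf : Continuous f := by fun_prop
  have f0 : f 0 = 0 := by simp [f]
  have fa : f a = 0 := by simp [f]
  have fb : f b = 0 := by simp [f]
  have g0 : 1 < f ε := by
    have h : (a * (999/1000)) * (b * (999/1000)) ≤ (a - ε) * (b - ε) := by
      apply mul_le_mul <;> linarith
    have : f ε = ε * ((a - ε) * (b - ε)) := by simp only [f]; ring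
    rw [this]
    nlinarith
  have g1 : 1 < f (a - ε) := by
    have h : (a * (999/1000)) * (b * (999/1000)) ≤ (a - ε) * (b - a + ε) := by
      apply mul_le_mul <;> linarith
    have : f (a - ε) = ε * ((a - ε) * (b - a + ε)) := by simp only [f]; ring
    rw [this]
    nlinarith
  have g2 : 1 < f (b + ε) := by
    have h : (a * (999/1000)) * (b * (999/1000)) ≤ (b - a + ε) * (b + ε) := by
      apply mul_le_mul <;> linarith
    have : f (b + ε) = ε * ((b - a + ε) * (b + ε)) := by simp only [f]; ring
    rw [this]
    nlinarith
  obtain ⟨r0, m0, e0⟩ := intermediate_value_Ioo he0.le hf.continuousOn (show (1:ℝ) ∈ Set.Ioo (f 0) (f ε) by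
    rw [f0]; exact ⟨by norm_num, g0⟩)
  obtain ⟨r1, m1, e1⟩ := intermediate_value_Ioo' (by linarith : (a:ℝ) - ε ≤ a) hf.continuousOn (show (1:ℝ) ∈ Set.Ioo (f a) (f (a - ε)) by
    rw [fa]; exact ⟨by norm_num, g1⟩)
  obtain ⟨r2, m2, e2⟩ := intermediate_value_Ioo (by linarith : (b:ℝ) ≤ b + ε) hf.continuousOn (show (1:ℝ) ∈ Set.Ioo (f b) (f (b + ε)) by
    rw [fb]; exact ⟨by norm_num, g2⟩)
  simp only [f] at e0 e1 e2
  obtain ⟨n0, n0'⟩ := m0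
  obtain ⟨n1, n1'⟩ := m1
  obtain ⟨n2, n2'⟩ := m2
  obtain ⟨v1, v2, v3⟩ := vieta (a+b) (a*b) r0 r1 r2 (by linarith) (by linarith) (by linear_combination e0)
    (by linear_combination e1) (by linear_combination e2)
  refine ⟨![r0, r1, r2], ha, hab, hba, ?_, ?_, ?_, ?_, ?_, ?_, ?_, ?_, ?_⟩ <;> 
    simp only [Matrix.cons_val_zero, Matrix.cons_val_one, Matrix.cons_val] <;> first | exact v1 | exact v2 | exact v3 | linarith | (rw [← hε]; linarith)
end R1sec

section U1sec
theorem three_prod (A B C Y a b : ℝ) (hA : 1 ≤ A) (hB : 1 ≤ B) (hC : 1 ≤ C) (hY : 1 ≤ Y) (ha : 514229 ≤ a)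
    (hab : 1000 * a ≤ b) (h1 : a * Y ≤ A + B) (h2 : (b - a) * Y ≤ B + C) (h3 : b * Y ≤ A + C) :
    a * b * Y^2 / 5 ≤ A * B * C := by
  have hd : b * Y * (9/10) ≤ (b - a) * Y := by nlinarith
  have hbY : 0 ≤ b * Y := by apply mul_nonneg <;> linarith
  have haY : 0 ≤ a * Y := by apply mul_nonneg <;> linarith
  have key : ∀ X P Q : ℝ, 1 ≤ X → a * Y / 2 ≤ P → b * Y * (9/20) ≤ Q → a * b * Y^2 / 5 ≤ X * (P * Q) := by
    intro X P Q hX hP hQ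
    have : (a * Y / 2) * (b * Y * (9/20)) ≤ P * Q := by
      apply mul_le_mul hP hQ <;> linarith
    have h0 : 0 ≤ (a * Y) * (b * Y) := mul_nonneg haY hbY
    nlinarith
  have hab' : a * Y ≤ b * Y := by nlinarith
  rcases le_total A B with p | p
  · rcases le_total A C with q | q
    · have := key A B C hA (by linarith) (by linarith); linarith
    · have := key C B A hC (by linarith) (by linarith); linarith
  · rcases le_total B C with q | q
    · have := key B A C hB (by linarith) (by linarith); linarith
    · have := key C B A hC (by linarith) (by linarith); linarith

def Triv (a b x y : ℤ) : Prop :=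
  (y = 0 ∧ (x = 1 ∨ x = -1)) ∨ ((y = 1 ∨ y = -1) ∧ (x = 0 ∨ x = a * y ∨ x = b * y))

theorem cube_pm (y : ℤ) (h : y^3 = 1 ∨ y^3 = -1) : y = 1 ∨ y = -1 := by
  have : IsUnit y := by
    rw [← isUnit_pow_iff (n := 3) (by norm_num)]
    rcases h with h | h <;> rw [h] <;> simp
  exact Int.isUnit_iff.1 this

theorem small_sol (a b x y : ℤ) (ha : 514229 ≤ a) (hab : 1000 * a ≤ b)
    (h : x*(x-a*y)*(x-b*y) - y^3 = 1 ∨ x*(x-a*y)*(x-b*y) - y^3 = -1) (hT : ¬ Triv a b x y) :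
    (a:ℝ) * b ≤ 10 * |(y:ℝ)| := by
  have hy : y ≠ 0 := by
    rintro rfl
    apply hT
    left
    refine ⟨rfl, cube_pm x ?_⟩
    rcases h with h | h
    · left; linear_combination h
    · right; linear_combination h
  have hz : ∀ w : ℤ, x*(x-a*y)*(x-b*y) = 0 → y = 1 ∨ y = -1 := by
    intro _ h0
    rw [h0] at h
    apply cube_pm
    rcases h with h | h
    · right; linarith
    · left; linarith
  have hx0 : x ≠ 0 := by
    intro e; apply hT; right
    exact ⟨hz 0 (by rw [e]; ring), Or.inl e⟩
  have hx1 : x - a*y ≠ 0 := by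
    intro e; apply hT; right
    exact ⟨hz 0 (by rw [e]; ring), Or.inr (Or.inl (by linarith))⟩
  have hx2 : x - b*y ≠ 0 := by
    intro e; apply hT; right
    exact ⟨hz 0 (by rw [e]; ring), Or.inr (Or.inr (by linarith))⟩
  have haR : (514229:ℝ) ≤ a := by exact_mod_cast ha
  have habR : (1000:ℝ) * a ≤ b := by exact_mod_cast hab
  have Y1 : (1:ℝ) ≤ |(y:ℝ)| := by exact_mod_cast Int.one_le_abs hy
  have A1 : (1:ℝ) ≤ |(x:ℝ)| := by exact_mod_cast Int.one_le_abs hx0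
  have B1 : (1:ℝ) ≤ |(x:ℝ) - a*y| := by exact_mod_cast Int.one_le_abs hx1
  have C1 : (1:ℝ) ≤ |(x:ℝ) - b*y| := by exact_mod_cast Int.one_le_abs hx2
  have t1 : (a:ℝ) * |(y:ℝ)| ≤ |(x:ℝ)| + |(x:ℝ) - a*y| := by
    rw [← abs_of_nonneg (by linarith : (0:ℝ) ≤ a), ← abs_mul, abs_of_nonneg (by linarith : (0:ℝ) ≤ a)]
    calc |(a:ℝ)*y| = |(x:ℝ) - (x - a*y)| := by congr 1; ring
      _ ≤ _ := abs_sub _ _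
  have t3 : (b:ℝ) * |(y:ℝ)| ≤ |(x:ℝ)| + |(x:ℝ) - b*y| := by
    rw [← abs_of_nonneg (by linarith : (0:ℝ) ≤ b), ← abs_mul, abs_of_nonneg (by linarith : (0:ℝ) ≤ b)]
    calc |(b:ℝ)*y| = |(x:ℝ) - (x - b*y)| := by congr 1; ring
      _ ≤ _ := abs_sub _ _
  have t2 : ((b:ℝ) - a) * |(y:ℝ)| ≤ |(x:ℝ) - a*y| + |(x:ℝ) - b*y| := by
    have e : ((b:ℝ) - a) * |(y:ℝ)| = |((b:ℝ) - a)*y| := by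
      rw [abs_mul, abs_of_nonneg (by linarith : (0:ℝ) ≤ (b:ℝ) - a)]
    rw [e]
    calc |((b:ℝ) - a)*y| = |((x:ℝ) - a*y) - (x - b*y)| := by congr 1; ring
      _ ≤ _ := abs_sub _ _
  have hp := three_prod _ _ _ _ a b A1 B1 C1 Y1 haR habR t1 t2 t3
  rw [← abs_mul, ← abs_mul] at hp
  have hq : |(x:ℝ)*(x-a*y)*(x-b*y)| ≤ |(y:ℝ)|^3 + 1 := by
    have e : |((x:ℝ)*(x-a*y)*(x-b*y)) - (y:ℝ)^3| = 1 := by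
      rcases h with h | h
      · have : (x:ℝ)*(x-a*y)*(x-b*y) - (y:ℝ)^3 = 1 := by exact_mod_cast h
        rw [this]; simp
      · have : (x:ℝ)*(x-a*y)*(x-b*y) - (y:ℝ)^3 = -1 := by exact_mod_cast h
        rw [this]; simp
    calc |(x:ℝ)*(x-a*y)*(x-b*y)| = |(((x:ℝ)*(x-a*y)*(x-b*y)) - (y:ℝ)^3) + (y:ℝ)^3| := by congr 1; ring
      _ ≤ 1 + |(y:ℝ)^3| := by rw [← e]; exact abs_add_le _ _
      _ = _ := by rw [abs_pow]; ring
  generalize |(y:ℝ)| = Y at *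
  have h3 : Y^3 + 1 ≤ 2 * Y * Y^2 := by nlinarith [pow_le_pow_left₀ (by norm_num : (0:ℝ) ≤ 1) Y1 3]
  have h4 : (a * b / 5) * Y^2 ≤ 2 * Y * Y^2 := by linarith
  have := le_of_mul_le_mul_right h4 (by positivity)
  linarith

/-- the vector lies in the order -/
def InO (th z : Fin 3 → ℝ) : Prop := ∃ p q r : ℤ, ∀ i, z i = p + q * th i + r * th i ^ 2

namespace RD
variable {a b : ℤ} {th : Fin 3 → ℝ}

theorem cubic (H : RD a b th) (i : Fin 3) : th i ^ 3 = (a + b) * th i ^ 2 - a * b * th i + 1 := by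
  linear_combination H.root i

theorem inO_mul (H : RD a b th) {z w : Fin 3 → ℝ} (hz : InO th z) (hw : InO th w) : InO th (fun i => z i * w i) := by
  obtain ⟨p, q, r, h⟩ := hz
  obtain ⟨p', q', r', h'⟩ := hw
  refine ⟨p*p' + (q*r'+r*q') + r*r'*(a+b), p*q'+q*p' - (q*r'+r*q')*(a*b) + r*r'*(1 - (a+b)*(a*b)),
    p*r'+q*q'+r*p' + (q*r'+r*q')*(a+b) + r*r'*((a+b)^2 - a*b), fun i => ?_⟩
  have c := H.cubic i
  show z i * w i = _
  rw [h, h']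
  push_cast
  linear_combination ((q:ℝ)*r'+r*q' + r*r'*(th i + (a+b))) * c

theorem inO_one (th : Fin 3 → ℝ) : InO th (fun _ => 1) := ⟨1, 0, 0, fun i => by simp⟩
theorem inO_th (th : Fin 3 → ℝ) : InO th (fun i => th i) := ⟨0, 1, 0, fun i => by simp⟩
theorem inO_ta (a : ℤ) (th : Fin 3 → ℝ) : InO th (fun i => th i - a) := ⟨-a, 1, 0, fun i => by push_cast; ring⟩
theorem inO_thinv (H : RD a b th) : InO th (fun i => (th i)⁻¹) :=
  ⟨a*b, -(a+b), 1, fun i => by show (th i)⁻¹ = _; rw [H.inv0]; push_cast; ring⟩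
theorem inO_tainv (H : RD a b th) : InO th (fun i => (th i - a)⁻¹) :=
  ⟨0, -b, 1, fun i => by show (th i - a)⁻¹ = _; rw [H.inva]; push_cast; ring⟩

theorem inO_pow (H : RD a b th) {z : Fin 3 → ℝ} (hz : InO th z) (n : ℕ) : InO th (fun i => z i ^ n) := by
  induction n with
  | zero => simpa using inO_one th
  | succ n ih => simpa only [pow_succ] using H.inO_mul ih hz

theorem inO_zpow (H : RD a b th) {z : Fin 3 → ℝ} (hz : InO th z) (hz' : InO th (fun i => (z i)⁻¹)) (n : ℤ) :
    InO th (fun i => z i ^ n) := by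
  rcases n with n | n
  · simpa using H.inO_pow hz n
  · have := H.inO_pow hz' (n+1)
    simpa only [zpow_negSucc, inv_pow] using this

theorem inO_unit (H : RD a b th) (u v : ℤ) : InO th (fun i => th i ^ u * (th i - a) ^ v) :=
  H.inO_mul (H.inO_zpow (inO_th th) H.inO_thinv u) (H.inO_zpow (inO_ta a th) H.inO_tainv v)

/-- the sizes of the logarithms -/
theorem logs (H : RD a b th) : ∃ lam L0 L1 L2 M0 M1 M2 : ℝ, lam = Real.log b ∧ L0 = Real.log |th 0| ∧ L1 = Real.log |th 1| ∧
    L2 = Real.log |th 2| ∧ M0 = Real.log |th 0 - a| ∧ M1 = Real.log |th 1 - a| ∧ M2 = Real.log |th 2 - a| ∧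
    L0 + L1 + L2 = 0 ∧ M0 + M1 + M2 = 0 ∧ 19 ≤ lam ∧ lam/2 - 1/100 ≤ L1 ∧ L1 ≤ lam - 6 ∧ lam ≤ L2 ∧ L2 ≤ lam + 1/100 ∧
    lam/2 - 1/100 ≤ M0 ∧ M0 ≤ lam - 6 ∧ lam - 1/100 ≤ M2 ∧ M2 ≤ lam := by
  have ha := H.haR
  have hab := H.habR
  have hba := H.hbaR
  have hs := H.hsmall
  have p0 := H.p0
  have q0 := H.q0
  have p1 := H.p1
  have q1 := H.q1
  have p2 := H.p2
  have q2 := H.q2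
  have hb : (0:ℝ) < b := by linarith
  have hapos : (0:ℝ) < a := by linarith
  have e0 : |th 0| = th 0 := abs_of_pos p0
  have e1 : |th 1| = th 1 := abs_of_pos (by linarith)
  have e2 : |th 2| = th 2 := abs_of_pos (by linarith)
  have e3 : |th 0 - a| = a - th 0 := by rw [abs_sub_comm]; exact abs_of_pos (by linarith)
  have e4 : |th 1 - a| = a - th 1 := by rw [abs_sub_comm]; exact abs_of_pos (by linarith)
  have e5 : |th 2 - a| = th 2 - a := abs_of_pos (by linarith)
  have la1 : Real.log b ≤ 2 * Real.log a := by
    have := Real.log_le_log hb hba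
    rwa [Real.log_pow] at this
  have l1000 : 6 + Real.log a ≤ Real.log b := by
    have h1 : Real.log (1000 * a) ≤ Real.log b := Real.log_le_log (by positivity) hab
    rw [Real.log_mul (by norm_num) hapos.ne'] at h1
    have h2 : Real.log (2^9) ≤ Real.log 1000 := Real.log_le_log (by norm_num) (by norm_num)
    rw [Real.log_pow] at h2
    have := Real.log_two_gt_d9
    push_cast at h2
    linarith
  have l99 : ∀ x y : ℝ, 0 < y → y * (999/1000) ≤ x → Real.log y - 1/100 ≤ Real.log x := by
    intro x y hy hx
    have h1 : Real.log (y * (999/1000)) ≤ Real.log x := Real.log_le_log (by positivity) hx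
    rw [Real.log_mul hy.ne' (by norm_num)] at h1
    have h2 := Real.one_sub_inv_le_log_of_pos (by norm_num : (0:ℝ) < 999/1000)
    norm_num at h2
    linarith
  refine ⟨_, _, _, _, _, _, _, rfl, rfl, rfl, rfl, rfl, rfl, rfl, ?_, ?_, ?_, ?_, ?_, ?_, ?_, ?_, ?_, ?_, ?_⟩
  · rw [e0, e1, e2, ← Real.log_mul (by linarith) (by linarith), ← Real.log_mul (by apply mul_ne_zero <;> linarith) (by linarith), H.s3, Real.log_one]
  · have n0 := H.nea 0
    have n1 := H.nea 1
    have n2 := H.nea 2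
    rw [← Real.log_mul (abs_ne_zero.2 n0) (abs_ne_zero.2 n1), ← abs_mul, ← Real.log_mul (abs_ne_zero.2 (mul_ne_zero n0 n1)) (abs_ne_zero.2 n2), ← abs_mul]
    have : (th 0 - a) * (th 1 - a) * (th 2 - a) = 1 := by
      have := H.fact a
      simp only [sub_self, mul_zero, zero_mul] at this
      linear_combination this
    rw [this]; simp
  · have h1 : Real.log (2^28) ≤ Real.log b := Real.log_le_log (by norm_num) (by linarith)
    rw [Real.log_pow] at h1
    have := Real.log_two_gt_d9
    push_cast at h1
    linarith
  · rw [e1]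
    have := l99 (th 1) a hapos (by linarith)
    linarith
  · rw [e1]
    have : Real.log (th 1) ≤ Real.log a := Real.log_le_log (by linarith) p1.le
    linarith
  · rw [e2]; exact Real.log_le_log hb p2.le
  · rw [e2]
    have := l99 b (th 2) (by linarith) (by linarith)
    linarith
  · rw [e3]
    have := l99 (a - th 0) a hapos (by linarith)
    linarith
  · rw [e3]
    have : Real.log (a - th 0) ≤ Real.log a := Real.log_le_log (by linarith) (by linarith)
    linarith
  · rw [e5]
    exact l99 (th 2 - a) b hb (by linarith)
  · rw [e5]
    exact Real.log_le_log (by linarith) (by linarith)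
end RD
end U1sec

section U2sec
namespace RD
variable {a b : ℤ} {th : Fin 3 → ℝ}

theorem form (H : RD a b th) (x y : ℝ) :
    (x - th 0 * y) * (x - th 1 * y) * (x - th 2 * y) = x*(x-a*y)*(x-b*y) - y^3 := by
  linear_combination (-x^2*y) * H.s1 + x*y^2 * H.s2 - y^3 * H.s3

theorem interp (H : RD a b th) (z : Fin 3 → ℝ) (p q r : ℝ) (hz : ∀ i, z i = p + q * th i + r * th i ^ 2) :
    r * ((th 1 - th 0) * (th 2 - th 0) * (th 2 - th 1)) =
      z 0 * (th 2 - th 1) - z 1 * (th 2 - th 0) + z 2 * (th 1 - th 0) := by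
  rw [hz 0, hz 1, hz 2]; ring

theorem rzero (a b t0 t1 t2 z0 z1 z2 r : ℝ) (ha : 514229 ≤ a) (hab : 1000 * a ≤ b)
    (h0 : 0 < t0) (h0' : t0 < 1/1000) (h1 : t1 < a) (h1' : a - 1/1000 < t1) (h2 : b < t2) (h2' : t2 < b + 1/1000)
    (b0 : |z0| ≤ a*b/100) (b1 : |z1| ≤ a*b/100) (b2 : |z2| ≤ 2*b)
    (h : r * ((t1 - t0) * (t2 - t0) * (t2 - t1)) = z0 * (t2 - t1) - z1 * (t2 - t0) + z2 * (t1 - t0)) : |r| < 1 := by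
  have g1 : 0 < t1 - t0 := by linarith
  have g2 : 0 < t2 - t0 := by linarith
  have g3 : 0 < t2 - t1 := by linarith
  have hb : 0 < b := by linarith
  have e : |r| * ((t1 - t0) * (t2 - t0) * (t2 - t1)) ≤ a*b/100 * (t2 - t1) + a*b/100 * (t2 - t0) + 2*b * (t1 - t0) := by
    have : |r| * ((t1 - t0) * (t2 - t0) * (t2 - t1)) = |r * ((t1 - t0) * (t2 - t0) * (t2 - t1))| := by
      rw [abs_mul, abs_of_pos (mul_pos (mul_pos g1 g2) g3)]
    rw [this, h]
    refine (abs_add_le _ _).trans (add_le_add ((abs_sub _ _).trans (add_le_add ?_ ?_)) ?_)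
    · rw [abs_mul, abs_of_pos g3]; exact mul_le_mul_of_nonneg_right b0 g3.le
    · rw [abs_mul, abs_of_pos g2]; exact mul_le_mul_of_nonneg_right b1 g2.le
    · rw [abs_mul, abs_of_pos g1]; exact mul_le_mul_of_nonneg_right b2 g1.le
  by_contra hr
  push Not at hr
  have hD : (t1 - t0) * (t2 - t0) * (t2 - t1) ≤ |r| * ((t1 - t0) * (t2 - t0) * (t2 - t1)) :=
    le_mul_of_one_le_left (mul_pos (mul_pos g1 g2) g3).le hr
  have k1 : a * (9/10) ≤ t1 - t0 := by linarith
  have k1' : t1 - t0 ≤ a := by linarith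
  have k2 : b * (9/10) ≤ t2 - t0 := by linarith
  have k2' : t2 - t0 ≤ 2*b := by linarith
  have k3 : b * (9/10) ≤ t2 - t1 := by linarith
  have k3' : t2 - t1 ≤ 2*b := by linarith
  have m1 : a * (9/10) * (b * (9/10)) * (b * (9/10)) ≤ (t1 - t0) * (t2 - t0) * (t2 - t1) := by gcongr
  have m2 : a*b/100 * (t2 - t1) ≤ a*b/100*(2*b) := by gcongr
  have m3 : a*b/100 * (t2 - t0) ≤ a*b/100*(2*b) := by gcongr
  have m4 : 2*b * (t1 - t0) ≤ 2 * b * a := by gcongr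
  have : 0 < a * b := by positivity
  nlinarith

theorem small_unit (H : RD a b th) (z : Fin 3 → ℝ) (hz : InO th z) (hp : |z 0 * z 1 * z 2| = 1)
    (b0 : |z 0| ≤ a*b/100) (b1 : |z 1| ≤ a*b/100) (b2 : |z 2| ≤ 2*b) :
    ∃ u v : ℤ, ∀ i, |z i| = |th i|^u * |th i - a|^v := by
  obtain ⟨p, q, r, h⟩ := hz
  have ha := H.haR
  have hab := H.habR
  have hba := H.hbaR
  have hs := H.hsmall
  have p0 := H.p0
  have q0 := H.q0
  have p1 := H.p1
  have q1 := H.q1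
  have p2 := H.p2
  have q2 := H.q2
  have hr := rzero a b (th 0) (th 1) (th 2) (z 0) (z 1) (z 2) r ha hab p0 (by linarith) p1 (by linarith) p2 (by linarith)
    b0 b1 b2 (H.interp z p q r h)
  have hr0 : r = 0 := by
    have : |r| < 1 := by exact_mod_cast hr
    exact Int.abs_lt_one_iff.1 this
  have h' : ∀ i, z i = p - th i * ((-q : ℤ) : ℝ) := by
    intro i; rw [h i, hr0]; push_cast; ring
  have hform : p*(p-a*(-q))*(p-b*(-q)) - (-q)^3 = 1 ∨ p*(p-a*(-q))*(p-b*(-q)) - (-q)^3 = -1 := by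
    rw [h' 0, h' 1, h' 2, H.form] at hp
    apply eq_or_eq_neg_of_abs_eq
    exact_mod_cast hp
  have hT : Triv a b p (-q) := by
    by_contra hT
    have hq := small_sol a b p (-q) H.ha H.hab hform hT
    have e : ((-q : ℤ) : ℝ) * (th 2 - th 0) = z 0 - z 2 := by rw [h' 0, h' 2]; ring
    have e2 : |((-q : ℤ) : ℝ)| * (th 2 - th 0) ≤ a*b/100 + 2*b := by
      have : |((-q : ℤ) : ℝ)| * (th 2 - th 0) = |((-q : ℤ) : ℝ) * (th 2 - th 0)| := by
        rw [abs_mul, abs_of_pos (by linarith : 0 < th 2 - th 0)]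
      rw [this, e]
      exact (abs_sub _ _).trans (add_le_add b0 b2)
    generalize |((-q : ℤ) : ℝ)| = Q at *
    have hQ : 0 ≤ Q := by
      have := H.habpos
      linarith
    have : Q * (b * (9/10)) ≤ Q * (th 2 - th 0) := by
      apply mul_le_mul_of_nonneg_left _ hQ; linarith
    have hbpos : (0:ℝ) < b := by linarith
    have : (Q * (9/10)) * b ≤ (a/100 + 2) * b := by linarith
    have := le_of_mul_le_mul_right this hbpos
    nlinarith
  rcases hT with ⟨hq, hp⟩ | ⟨hq, hp⟩
  · refine ⟨0, 0, fun i => ?_⟩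
    rw [h', hq]
    rcases hp with hp | hp <;> rw [hp] <;> simp
  · have hQ : |((-q : ℤ) : ℝ)| = 1 := by
      rcases hq with hq | hq <;> rw [hq] <;> simp
    rcases hp with hp | hp | hp
    · refine ⟨1, 0, fun i => ?_⟩
      have : z i = -(th i * ((-q : ℤ) : ℝ)) := by rw [h', hp]; simp
      rw [this, abs_neg, abs_mul, hQ]; simp
    · refine ⟨0, 1, fun i => ?_⟩
      have : z i = -((th i - a) * ((-q : ℤ) : ℝ)) := by rw [h', hp]; push_cast; ring
      rw [this, abs_neg, abs_mul, hQ]; simp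
    · refine ⟨-1, -1, fun i => ?_⟩
      have : z i = -((th i - b) * ((-q : ℤ) : ℝ)) := by rw [h', hp]; push_cast; ring
      rw [this, abs_neg, abs_mul, hQ]
      have n0 := abs_pos.2 (H.ne0 i)
      have na := abs_pos.2 (H.nea i)
      have hroot : |th i| * |th i - a| * |th i - b| = 1 := by
        rw [← abs_mul, ← abs_mul, H.root]; simp
      simp only [zpow_neg, zpow_one]
      field_simp
      linarith

theorem detpos (lam L0 L1 L2 M0 M1 M2 : ℝ) (h1 : L0 + L1 + L2 = 0) (h2 : M0 + M1 + M2 = 0) (h3 : 19 ≤ lam)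
    (h4 : lam/2 - 1/100 ≤ L1) (h6 : lam ≤ L2)
    (h8 : lam/2 - 1/100 ≤ M0) (h10 : lam - 1/100 ≤ M2) :
    19/10 * lam^2 ≤ L0 * M1 - L1 * M0 := by
  have : L0 * M1 - L1 * M0 = L2 * M0 + L1 * M2 + L2 * M2 := by
    have : L0 = -(L1+L2) := by linarith
    have e : M1 = -(M0+M2) := by linarith
    rw [this, e]; ring
  rw [this]
  have a1 : lam * (lam/2 - 1/100) ≤ L2 * M0 := by apply mul_le_mul <;> linarith
  have a2 : (lam/2 - 1/100) * (lam - 1/100) ≤ L1 * M2 := by apply mul_le_mul <;> linarith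
  have a3 : lam * (lam - 1/100) ≤ L2 * M2 := by apply mul_le_mul <;> linarith
  nlinarith

theorem half_bd (c d L M K : ℝ) (hc : |c| ≤ 1/2) (hd : |d| ≤ 1/2) (hK : |L| + |M| ≤ 2*K) : c * L + d * M ≤ K := by
  have h1 : c * L ≤ |L|/2 := by
    have := le_abs_self (c*L)
    rw [abs_mul] at this
    nlinarith [abs_nonneg L]
  have h2 : d * M ≤ |M|/2 := by
    have := le_abs_self (d*M)
    rw [abs_mul] at this
    nlinarith [abs_nonneg M]
  linarith

theorem le_of_log (w K c : ℝ) (hw : 0 < w) (hc : 0 < c) (h : Real.log w ≤ K) (hK : K ≤ Real.log c) : w ≤ c :=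
  (Real.log_le_log_iff hw hc).1 (h.trans hK)

theorem units (H : RD a b th) (x y : ℤ)
    (h : x*(x-a*y)*(x-b*y) - y^3 = 1 ∨ x*(x-a*y)*(x-b*y) - y^3 = -1) :
    ∃ u v : ℤ, ∀ i, |(x:ℝ) - th i * y| = |th i|^u * |th i - a|^v := by
  have hP : |((x:ℝ) - th 0 * y) * (x - th 1 * y) * (x - th 2 * y)| = 1 := by
    rw [H.form]
    rcases h with h | h
    · have : (x:ℝ)*(x-a*y)*(x-b*y) - (y:ℝ)^3 = 1 := by exact_mod_cast h
      rw [this]; simp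
    · have : (x:ℝ)*(x-a*y)*(x-b*y) - (y:ℝ)^3 = -1 := by exact_mod_cast h
      rw [this]; simp
  have hne : ∀ i, (x:ℝ) - th i * y ≠ 0 := by
    intro i h0
    have : ((x:ℝ) - th 0 * y) * (x - th 1 * y) * (x - th 2 * y) = 0 := by
      fin_cases i <;> simp at h0 <;> simp [h0]
    rw [this] at hP; simp at hP
  obtain ⟨lam, L0, L1, L2, M0, M1, M2, hlam, hL0, hL1, hL2, hM0, hM1, hM2, sL, sM, k1, k2, k3, k4, k5, k6, k7, k8, k9⟩ := H.logs
  have hD := detpos lam L0 L1 L2 M0 M1 M2 sL sM k1 k2 k4 k6 k8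
  have hDne : L0 * M1 - L1 * M0 ≠ 0 := by nlinarith
  obtain ⟨B, hB⟩ : ∃ B : Fin 3 → ℝ, ∀ i, B i = Real.log |(x:ℝ) - th i * y| := ⟨_, fun _ => rfl⟩
  have sB : B 0 + B 1 + B 2 = 0 := by
    rw [hB, hB, hB, ← Real.log_mul (abs_ne_zero.2 (hne 0)) (abs_ne_zero.2 (hne 1)), ← abs_mul,
      ← Real.log_mul (abs_ne_zero.2 (mul_ne_zero (hne 0) (hne 1))) (abs_ne_zero.2 (hne 2)), ← abs_mul, hP, Real.log_one]
  obtain ⟨c, hc⟩ : ∃ c, c = (B 0 * M1 - B 1 * M0) / (L0 * M1 - L1 * M0) := ⟨_, rfl⟩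
  obtain ⟨d, hd⟩ : ∃ d, d = (L0 * B 1 - L1 * B 0) / (L0 * M1 - L1 * M0) := ⟨_, rfl⟩
  have E0 : B 0 = c * L0 + d * M0 := by rw [hc, hd, div_mul_eq_mul_div, div_mul_eq_mul_div, ← add_div, eq_div_iff hDne]; ring
  have E1 : B 1 = c * L1 + d * M1 := by rw [hc, hd, div_mul_eq_mul_div, div_mul_eq_mul_div, ← add_div, eq_div_iff hDne]; ring
  have E2 : B 2 = c * L2 + d * M2 := by linear_combination sB - E0 - E1 - c * sL - d * sM
  obtain ⟨z, hz⟩ : ∃ z : Fin 3 → ℝ, ∀ i, z i = ((x:ℝ) - th i * y) * (th i ^ (-round c) * (th i - a) ^ (-round d)) := ⟨_, fun _ => rfl⟩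
  have hzne : ∀ i, z i ≠ 0 := by
    intro i; rw [hz]
    exact mul_ne_zero (hne i) (mul_ne_zero (zpow_ne_zero _ (H.ne0 i)) (zpow_ne_zero _ (H.nea i)))
  have hzO : InO th z := by
    have h1 : InO th (fun i => (x:ℝ) - th i * y) := ⟨x, -y, 0, fun i => by push_cast; ring⟩
    have := H.inO_mul h1 (H.inO_unit (-round c) (-round d))
    obtain ⟨p, q, r, hh⟩ := this
    exact ⟨p, q, r, fun i => by rw [hz]; exact hh i⟩
  have hzp : |z 0 * z 1 * z 2| = 1 := by
    have f1 : th 0 ^ (-round c) * th 1 ^ (-round c) * th 2 ^ (-round c) = 1 := by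
      rw [← mul_zpow, ← mul_zpow, H.s3, one_zpow]
    have f2 : (th 0 - a) ^ (-round d) * (th 1 - a) ^ (-round d) * (th 2 - a) ^ (-round d) = 1 := by
      have : (th 0 - a) * (th 1 - a) * (th 2 - a) = 1 := by
        have := H.fact a
        simp only [sub_self, mul_zero, zero_mul] at this
        linear_combination this
      rw [← mul_zpow, ← mul_zpow, this, one_zpow]
    have : z 0 * z 1 * z 2 = (((x:ℝ) - th 0 * y) * (x - th 1 * y) * (x - th 2 * y)) *
      (th 0 ^ (-round c) * th 1 ^ (-round c) * th 2 ^ (-round c)) *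
      ((th 0 - a) ^ (-round d) * (th 1 - a) ^ (-round d) * (th 2 - a) ^ (-round d)) := by
      rw [hz, hz, hz]; ring
    rw [this, f1, f2, mul_one, mul_one, hP]
  have hlog : ∀ i, Real.log |z i| = B i - round c * Real.log |th i| - round d * Real.log |th i - a| := by
    intro i
    rw [hz, hB]
    simp only [Real.log_abs]
    rw [Real.log_mul (hne i) (mul_ne_zero (zpow_ne_zero _ (H.ne0 i)) (zpow_ne_zero _ (H.nea i))),
      Real.log_mul (zpow_ne_zero _ (H.ne0 i)) (zpow_ne_zero _ (H.nea i)), Real.log_zpow, Real.log_zpow]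
    push_cast; ring
  have rc := abs_sub_round c
  have rd := abs_sub_round d
  have ha := H.haR
  have hab := H.habR
  have hba := H.hbaR
  have hapos : (0:ℝ) < a := by linarith
  have hbpos : (0:ℝ) < b := by linarith
  have la1 : lam ≤ 2 * Real.log a := by
    have := Real.log_le_log hbpos hba
    rw [Real.log_pow] at this
    rw [hlam]; exact_mod_cast this
  have l100 : Real.log (a*b/100) = Real.log a + lam - Real.log 100 := by
    rw [Real.log_div (by positivity) (by norm_num), Real.log_mul hapos.ne' hbpos.ne', hlam]
  have l100' : Real.log 100 ≤ 5 := by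
    have h1 : Real.log 100 ≤ Real.log (2^7) := Real.log_le_log (by norm_num) (by norm_num)
    rw [Real.log_pow] at h1
    have := Real.log_two_lt_d9
    push_cast at h1
    linarith
  have l2b : lam + 1/100 ≤ Real.log (2*b) := by
    rw [Real.log_mul (by norm_num) hbpos.ne', ← hlam]
    have := Real.log_two_gt_d9
    linarith
  have aL0 : |L0| = L1 + L2 := by rw [abs_of_nonpos] <;> linarith
  have aL1 : |L1| = L1 := abs_of_nonneg (by linarith)
  have aL2 : |L2| = L2 := abs_of_nonneg (by linarith)
  have aM0 : |M0| = M0 := abs_of_nonneg (by linarith)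
  have aM1 : |M1| = M0 + M2 := by rw [abs_of_nonpos] <;> linarith
  have aM2 : |M2| = M2 := abs_of_nonneg (by linarith)
  have b0 : |z 0| ≤ a*b/100 := by
    apply le_of_log _ (3/2*lam - 5) _ (abs_pos.2 (hzne 0)) (by positivity)
    · rw [hlog, ← hL0, ← hM0, E0]
      have := half_bd _ _ L0 M0 (3/2*lam-5) rc rd (by rw [aL0, aM0]; linarith)
      linarith
    · linarith
  have b1 : |z 1| ≤ a*b/100 := by
    apply le_of_log _ (3/2*lam - 5) _ (abs_pos.2 (hzne 1)) (by positivity)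
    · rw [hlog, ← hL1, ← hM1, E1]
      have := half_bd _ _ L1 M1 (3/2*lam-5) rc rd (by rw [aL1, aM1]; linarith)
      linarith
    · linarith
  have b2 : |z 2| ≤ 2*b := by
    apply le_of_log _ (lam+1/100) _ (abs_pos.2 (hzne 2)) (by positivity)
    · rw [hlog, ← hL2, ← hM2, E2]
      have := half_bd _ _ L2 M2 (lam+1/100) rc rd (by rw [aL2, aM2]; linarith)
      linarith
    · linarith
  obtain ⟨u, v, huv⟩ := H.small_unit z hzO hzp b0 b1 b2
  refine ⟨u + round c, v + round d, fun i => ?_⟩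
  have n0 := abs_ne_zero.2 (H.ne0 i)
  have na := abs_ne_zero.2 (H.nea i)
  have := huv i
  rw [hz, abs_mul, abs_mul, abs_zpow, abs_zpow, zpow_neg, zpow_neg] at this
  rw [zpow_add₀ n0, zpow_add₀ na]
  have w0 := zpow_ne_zero (round c) n0
  have wa := zpow_ne_zero (round d) na
  field_simp at this
  linear_combination this
end RD
end U2sec

section U3sec
namespace RD
variable {a b : ℤ} {th : Fin 3 → ℝ}

theorem no_rat (H : RD a b th) (j : Fin 3) (s r : ℤ) (hr : r ≠ 0) : th j * r ≠ s := by
  intro h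
  have hrR : (r:ℝ) ≠ 0 := by exact_mod_cast hr
  have ht : th j = (((s:ℚ)/(r:ℚ) : ℚ) : ℝ) := by
    push_cast; rw [eq_div_iff hrR, h]
  have hroot := H.root j
  rw [ht] at hroot
  have hroot' : ((s:ℚ)/r) * ((s:ℚ)/r - a) * ((s:ℚ)/r - b) = 1 := by exact_mod_cast hroot
  generalize (s:ℚ)/r = t at *
  have hintg : IsIntegral ℤ t := by
    refine ⟨Polynomial.X * (Polynomial.X - Polynomial.C a) * (Polynomial.X - Polynomial.C b) - 1, ?_, ?_⟩
    · have : (Polynomial.X * (Polynomial.X - Polynomial.C a) * (Polynomial.X - Polynomial.C b) - 1 : Polynomial ℤ)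
        = Polynomial.X^3 + (-Polynomial.C (a+b) * Polynomial.X^2 + Polynomial.C (a*b) * Polynomial.X - 1) := by
        simp only [map_add, map_mul]; ring
      rw [this]
      apply Polynomial.monic_X_pow_add
      have e : (-Polynomial.C (a+b) * Polynomial.X^2 + Polynomial.C (a*b) * Polynomial.X - 1 : Polynomial ℤ) =
        Polynomial.C (-(a+b)) * Polynomial.X^2 + Polynomial.C (a*b) * Polynomial.X + Polynomial.C (-1) := by
        simp only [map_neg, map_one]; ring
      rw [e]
      exact Polynomial.degree_quadratic_lt
    · simp only [Polynomial.eval₂_sub, Polynomial.eval₂_mul, Polynomial.eval₂_X, Polynomial.eval₂_C, Polynomial.eval₂_one]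
      simp only [algebraMap_int_eq, eq_intCast]
      linarith
  obtain ⟨m, hm⟩ := IsIntegrallyClosed.isIntegral_iff.1 hintg
  simp only [algebraMap_int_eq, eq_intCast] at hm
  rw [← hm] at hroot'
  have hz : m * (m - a) * (m - b) = 1 := by exact_mod_cast hroot'
  have u1 : IsUnit m := IsUnit.of_mul_eq_one ((m-a)*(m-b)) (by linarith)
  have u2 : IsUnit (m - a) := IsUnit.of_mul_eq_one (m*(m-b)) (by linarith)
  have := H.ha
  rcases Int.isUnit_iff.1 u1 with h1 | h1 <;> rcases Int.isUnit_iff.1 u2 with h2 | h2 <;> linarith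

theorem third (H : RD a b th) (i k : Fin 3) (hik : i ≠ k) : ∃ j, th i + th k = a + b - th j := by
  have := H.s1
  fin_cases i <;> fin_cases k <;> simp at hik ⊢
  · exact ⟨2, by linarith⟩
  · exact ⟨1, by linarith⟩
  · exact ⟨2, by linarith⟩
  · exact ⟨0, by linarith⟩
  · exact ⟨1, by linarith⟩
  · exact ⟨0, by linarith⟩

theorem gaps (H : RD a b th) : (100000:ℝ) ≤ th 1 - th 0 ∧ (100000:ℝ) ≤ th 2 - th 1 ∧ (100000:ℝ) ≤ th 2 - th 0 := by
  have ha := H.haR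
  have hab := H.habR
  have hs := H.hsmall
  have p0 := H.p0
  have q0 := H.q0
  have p1 := H.p1
  have q1 := H.q1
  have p2 := H.p2
  have q2 := H.q2
  refine ⟨?_, ?_, ?_⟩ <;> linarith

theorem gap (H : RD a b th) (i k : Fin 3) (hik : i ≠ k) : (100000:ℝ) ≤ |th i - th k| := by
  obtain ⟨h1, h2, h3⟩ := H.gaps
  rw [le_abs]
  fin_cases i <;> fin_cases k <;> simp at hik ⊢
  · right; linarith
  · right; linarith
  · left; linarith
  · right; linarith
  · left; linarith
  · left; linarith

theorem ind (H : RD a b th) (i k : Fin 3) (hik : i ≠ k) (A B : ℤ)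
    (h : |th i / th k|^A * |(th i - a) / (th k - a)|^B = 1) : A = 0 ∧ B = 0 := by
  obtain ⟨p, q, r, hw⟩ := H.inO_unit (2*A) (2*B)
  have hw1 : ∀ l, th l ^ (2*A) * (th l - a) ^ (2*B) = p + q * th l + r * th l ^ 2 := hw
  have hsq : ∀ l, th l ^ (2*A) * (th l - a) ^ (2*B) = (|th l|^A * |th l - a|^B)^2 := by
    intro l
    rw [mul_pow, ← zpow_natCast, ← zpow_natCast, ← zpow_mul, ← zpow_mul]
    rw [← (even_two_mul A).zpow_abs, ← (even_two_mul B).zpow_abs]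
    congr 2 <;> push_cast <;> ring
  have hik2 : th i ^ (2*A) * (th i - a) ^ (2*B) = th k ^ (2*A) * (th k - a) ^ (2*B) := by
    rw [hsq, hsq]
    congr 1
    rw [abs_div, abs_div, div_zpow, div_zpow] at h
    have w0 := zpow_ne_zero A (abs_ne_zero.2 (H.ne0 k))
    have wa := zpow_ne_zero B (abs_ne_zero.2 (H.nea k))
    field_simp at h
    linarith
  rw [hw1, hw1] at hik2
  have hne : th i - th k ≠ 0 := by
    intro h0
    have := H.gap i k hik
    rw [h0] at this; norm_num at this
  have hqr : (q:ℝ) + r * (th i + th k) = 0 := by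
    have : (th i - th k) * (q + r * (th i + th k)) = 0 := by linear_combination hik2
    exact (mul_eq_zero.1 this).resolve_left hne
  obtain ⟨j, hj⟩ := H.third i k hik
  have hr : r = 0 := by
    by_contra hr
    apply H.no_rat j (q + r*(a+b)) r hr
    rw [hj] at hqr
    push_cast
    linear_combination -hqr
  have hq : (q:ℝ) = 0 := by rw [hr] at hqr; simpa using hqr
  have hc : ∀ l, 2 * (A * Real.log |th l| + B * Real.log |th l - a|) = Real.log p := by
    intro l
    have : (p:ℝ) = th l ^ (2*A) * (th l - a) ^ (2*B) := by
      rw [hw1, hr, hq]; simp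
    rw [this, Real.log_mul (zpow_ne_zero _ (H.ne0 l)) (zpow_ne_zero _ (H.nea l)), Real.log_zpow, Real.log_zpow,
      Real.log_abs, Real.log_abs]
    push_cast; ring
  obtain ⟨lam, L0, L1, L2, M0, M1, M2, hlam, hL0, hL1, hL2, hM0, hM1, hM2, sL, sM, k1, k2, k3, k4, k5, k6, k7, k8, k9⟩ := H.logs
  have hD := detpos lam L0 L1 L2 M0 M1 M2 sL sM k1 k2 k4 k6 k8
  have hDne : L0 * M1 - L1 * M0 ≠ 0 := by nlinarith
  have c0 := hc 0
  have c1 := hc 1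
  have c2 := hc 2
  rw [← hL0, ← hM0] at c0
  rw [← hL1, ← hM1] at c1
  rw [← hL2, ← hM2] at c2
  have s0 : Real.log p = 0 := by linear_combination (-1/3) * (c0 + c1 + c2) + (2*A/3) * sL + (2*B/3)*sM
  rw [s0] at c0 c1
  constructor
  · have : (A:ℝ) * (L0 * M1 - L1 * M0) = 0 := by linear_combination M1/2 * c0 - M0/2 * c1
    exact_mod_cast (mul_eq_zero.1 this).resolve_right hDne
  · have : (B:ℝ) * (L0 * M1 - L1 * M0) = 0 := by linear_combination -L1/2 * c0 + L0/2 * c1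
    exact_mod_cast (mul_eq_zero.1 this).resolve_right hDne
end RD
end U3sec

section U4sec
theorem Liou.swap {e1 e2 nu de : ℝ} {h : ℕ} (H : Liou e1 e2 nu de h) : Liou e2 e1 nu de h := by
  intro s c a b f g B X Y h1 h2 h3 h4 h5
  have e : ∀ t, (c t:ℝ) * e2^(a t) * e1^(b t) * nu^(f t) * de^(g t) = (c t:ℝ) * e1^(b t) * e2^(a t) * nu^(f t) * de^(g t) := by
    intro t; ring
  simp only [e] at h5 ⊢
  exact H s c b a f g B X Y h1 h2 (fun t ht => by rw [add_comm]; exact h3 t ht) h4 h5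

theorem log_near (e : ℝ) (h : |e| ≤ 1/2) : |Real.log (|1 + e|)| ≤ 2 * |e| := by
  have h' := abs_le.1 h
  have hp : 0 < 1 + e := by linarith
  rw [abs_of_pos hp, abs_le]
  have h1 := Real.log_le_sub_one_of_pos hp
  have h2 := Real.one_sub_inv_le_log_of_pos hp
  have ha := abs_le.1 (le_refl |e|)
  refine ⟨?_, by linarith [abs_nonneg e]⟩
  refine le_trans ?_ h2
  have : 1 - (1+e)⁻¹ = e / (1+e) := by field_simp; ring
  rw [this, le_div_iff₀ hp]
  nlinarith [abs_nonneg e]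

/-- key estimate -/
theorem link_eps (bj bi bk wi wk y : ℝ) (hp : |bj| * |bi| * |bk| = 1) (hi : bi = bj + wi) (hk : bk = bj + wk)
    (hji : |bj| ≤ |bi|) (hjk : |bj| ≤ |bk|) (hy : 1 ≤ y) (hwi : 100000 * y ≤ |wi|) (hwk : 100000 * y ≤ |wk|) :
    |Real.log (|bi|) - Real.log (|wi|)| ≤ 1 / (2 * y^3) := by
  have ti : |wi| ≤ 2 * |bi| := by
    have : |wi| ≤ |bi| + |bj| := by
      have : wi = bi - bj := by linarith
      rw [this]; exact abs_sub _ _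
    linarith
  have tk : |wk| ≤ 2 * |bk| := by
    have : |wk| ≤ |bk| + |bj| := by
      have : wk = bk - bj := by linarith
      rw [this]; exact abs_sub _ _
    linarith
  have wipos : 0 < |wi| := by linarith
  have wkpos : 0 < |wk| := by linarith
  have hbj : |bj| * (|wi| * |wk|) ≤ 4 := by
    have h1 : |wi| * |wk| ≤ (2 * |bi|) * (2 * |bk|) := by
      apply mul_le_mul ti tk wkpos.le; positivity
    have := mul_le_mul_of_nonneg_left h1 (abs_nonneg bj)
    nlinarith
  have wine : wi ≠ 0 := abs_pos.1 wipos
  have hbi : bi = wi * (1 + bj / wi) := by rw [hi]; field_simp; ring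
  have hq : |bj / wi| ≤ 1 / (4 * y^3) := by
    rw [abs_div, div_le_div_iff₀ wipos (by positivity)]
    have h2 : (100000 * y) * (100000 * y) ≤ |wi| * |wk| := by
      apply mul_le_mul hwi hwk <;> positivity
    have h3 : |bj| * ((100000 * y) * (100000 * y)) ≤ 4 :=
      (mul_le_mul_of_nonneg_left h2 (abs_nonneg bj)).trans hbj
    nlinarith
  have hy3 : 1 ≤ y^3 := one_le_pow₀ hy
  have hq2 : 1 / (4 * y^3) ≤ 1/2 := by
    rw [div_le_div_iff₀ (by positivity) (by norm_num)]; linarith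
  have hne : 1 + bj / wi ≠ 0 := by
    intro h0
    have := abs_le.1 (hq.trans hq2)
    linarith
  have := log_near (bj/wi) (hq.trans hq2)
  rw [hbi, abs_mul, Real.log_mul wipos.ne' (abs_ne_zero.2 hne)]
  have e : 1 / (2 * y^3) = 2 * (1 / (4 * y^3)) := by field_simp; ring
  rw [e]
  calc |Real.log |wi| + Real.log |1 + bj / wi| - Real.log (|wi|)| = |Real.log (|1 + bj / wi|)| := by congr 1; ring
    _ ≤ _ := by linarith

theorem cramer_bd (D L M L' M' B B' u v Z lam : ℝ) (hB : B = u * L + v * M) (hB' : B' = u * L' + v * M')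
    (hD : D = |L * M' - L' * M|) (hlam : 19 ≤ lam) (hD2 : 19/10 * lam^2 ≤ D) (b1 : |B| ≤ Z) (b2 : |B'| ≤ Z)
    (m : |M| + |M'| ≤ 3 * lam) (l : |L| + |L'| ≤ 3 * lam + 1/10) :
    19/10 * lam * |u| ≤ 302/100 * Z ∧ 19/10 * lam * |v| ≤ 302/100 * Z := by
  have hZ : 0 ≤ Z := (abs_nonneg B).trans b1
  have eu : |u| * D ≤ Z * (|M| + |M'|) := by
    have : |u| * D = |B * M' - B' * M| := by
      rw [hD, ← abs_mul, hB, hB']; congr 1; ring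
    rw [this]
    refine (abs_sub _ _).trans ?_
    rw [abs_mul, abs_mul]
    have := mul_le_mul_of_nonneg_right b1 (abs_nonneg M')
    have := mul_le_mul_of_nonneg_right b2 (abs_nonneg M)
    linarith
  have ev : |v| * D ≤ Z * (|L| + |L'|) := by
    have : |v| * D = |L * B' - L' * B| := by
      rw [hD, ← abs_mul, hB, hB']; congr 1; ring
    rw [this]
    refine (abs_sub _ _).trans ?_
    rw [abs_mul, abs_mul]
    have := mul_le_mul_of_nonneg_left b1 (abs_nonneg L')
    have := mul_le_mul_of_nonneg_left b2 (abs_nonneg L)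
    linarith
  have key : ∀ w S : ℝ, 0 ≤ w → S ≤ 302/100 * lam → w * D ≤ Z * S → 19/10 * lam * w ≤ 302/100 * Z := by
    intro w S hw hS h
    have h1 : w * (19/10*lam^2) ≤ w * D := mul_le_mul_of_nonneg_left hD2 hw
    have h2 : Z * S ≤ Z * (302/100*lam) := mul_le_mul_of_nonneg_left hS hZ
    have h3 : (19/10 * lam * w) * lam ≤ (302/100 * Z) * lam := by nlinarith
    exact le_of_mul_le_mul_right h3 (by linarith)
  exact ⟨key _ _ (abs_nonneg u) (by linarith) eu, key _ _ (abs_nonneg v) (by linarith) ev⟩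
end U4sec

section U5sec
theorem prod_perm (f : Fin 3 → ℝ) (i j k : Fin 3) (hij : i ≠ j) (hik : i ≠ k) (hjk : j ≠ k) :
    f j * f i * f k = f 0 * f 1 * f 2 := by
  fin_cases i <;> fin_cases j <;> fin_cases k <;> 
    simp only [Fin.zero_eta, Fin.mk_one, Fin.reduceFinMk, ne_eq, not_true] at hij hik hjk ⊢ <;> ring

namespace RD
variable {a b : ℤ} {th : Fin 3 → ℝ}

theorem logs2 (H : RD a b th) (i k : Fin 3) (hik : i ≠ k) : 19 ≤ Real.log b ∧
    |Real.log (|th i|)| + |Real.log (|th k|)| ≤ 3 * Real.log b + 1/10 ∧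
    |Real.log (|th i - a|)| + |Real.log (|th k - a|)| ≤ 3 * Real.log b ∧
    19/10 * (Real.log b)^2 ≤ |Real.log (|th i|) * Real.log (|th k - a|) - Real.log (|th k|) * Real.log (|th i - a|)| := by
  obtain ⟨lam, L0, L1, L2, M0, M1, M2, hlam, hL0, hL1, hL2, hM0, hM1, hM2, sL, sM, k1, k2, k3, k4, k5, k6, k7, k8, k9⟩ := H.logs
  have hD := detpos lam L0 L1 L2 M0 M1 M2 sL sM k1 k2 k4 k6 k8
  have aL0 : |L0| = L1 + L2 := by rw [abs_of_nonpos] <;> linarith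
  have aL1 : |L1| = L1 := abs_of_nonneg (by linarith)
  have aL2 : |L2| = L2 := abs_of_nonneg (by linarith)
  have aM0 : |M0| = M0 := abs_of_nonneg (by linarith)
  have aM1 : |M1| = M0 + M2 := by rw [abs_of_nonpos] <;> linarith
  have aM2 : |M2| = M2 := abs_of_nonneg (by linarith)
  have eL : L2 = -L0-L1 := by linarith
  have eM : M2 = -M0-M1 := by linarith
  have d1 : L1 * M2 - L2 * M1 = L0 * M1 - L1 * M0 := by rw [eL, eM]; ring
  have d2 : L0 * M2 - L2 * M0 = -(L0 * M1 - L1 * M0) := by rw [eL, eM]; ring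
  rw [← hlam]
  refine ⟨k1, ?_, ?_, ?_⟩
  · fin_cases i <;> fin_cases k <;> simp only [Fin.zero_eta, Fin.mk_one, Fin.reduceFinMk, ne_eq, not_true] at hik ⊢ <;>
      simp only [← hL0, ← hL1, ← hL2, aL0, aL1, aL2] <;> linarith
  · fin_cases i <;> fin_cases k <;> simp only [Fin.zero_eta, Fin.mk_one, Fin.reduceFinMk, ne_eq, not_true] at hik ⊢ <;>
      simp only [← hM0, ← hM1, ← hM2, aM0, aM1, aM2] <;> linarith
  · rw [le_abs]
    fin_cases i <;> fin_cases k <;> simp only [Fin.zero_eta, Fin.mk_one, Fin.reduceFinMk, ne_eq, not_true] at hik ⊢ <;>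
      simp only [← hL0, ← hL1, ← hL2, ← hM0, ← hM1, ← hM2]
    · left; linarith
    · right; linarith
    · right; linarith
    · left; linarith
    · left; linarith
    · right; linarith

theorem gap_le (H : RD a b th) (i k : Fin 3) : |th i - th k| ≤ 2 * b := by
  have ha := H.haR
  have hab := H.habR
  have hs := H.hsmall
  have p0 := H.p0
  have q0 := H.q0
  have p1 := H.p1
  have q1 := H.q1
  have p2 := H.p2
  have q2 := H.q2
  rw [abs_le]
  fin_cases i <;> fin_cases k <;> simp only [Fin.zero_eta, Fin.mk_one, Fin.reduceFinMk] <;> constructor <;> linarith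

theorem log_gap (H : RD a b th) (i k : Fin 3) (hik : i ≠ k) :
    0 ≤ Real.log (|th i - th k|) ∧ Real.log (|th i - th k|) ≤ Real.log b + 7/10 := by
  have h1 := H.gap i k hik
  have h2 := H.gap_le i k
  have ha := H.haR
  have hab := H.habR
  refine ⟨Real.log_nonneg (by linarith), ?_⟩
  have := Real.log_le_log (by linarith) h2
  rw [Real.log_mul (by norm_num) (by linarith)] at this
  have := Real.log_two_lt_d9
  linarith

theorem link1 (H : RD a b th) (x y : ℤ) (hy : (a:ℝ) * b ≤ 10 * |(y:ℝ)|)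
    (h : x*(x-a*y)*(x-b*y) - y^3 = 1 ∨ x*(x-a*y)*(x-b*y) - y^3 = -1)
    (u v : ℤ) (huv : ∀ i, |(x:ℝ) - th i * y| = |th i|^u * |th i - a|^v) (i j k : Fin 3)
    (hij : i ≠ j) (hik : i ≠ k) (hjk : j ≠ k) (mi : |(x:ℝ) - th j * y| ≤ |(x:ℝ) - th i * y|)
    (mk : |(x:ℝ) - th j * y| ≤ |(x:ℝ) - th k * y|) :
    |Lam a th i k j u v| ≤ 1 / |(y:ℝ)|^3 ∧
    19/10 * Real.log b * |(u:ℝ)| ≤ 302/100 * (Real.log |(y:ℝ)| + Real.log b + 1) ∧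
    19/10 * Real.log b * |(v:ℝ)| ≤ 302/100 * (Real.log |(y:ℝ)| + Real.log b + 1) := by
  have ha := H.haR
  have hab := H.habR
  have hP : |((x:ℝ) - th 0 * y) * (x - th 1 * y) * (x - th 2 * y)| = 1 := by
    rw [H.form]
    rcases h with h | h
    · have : (x:ℝ)*(x-a*y)*(x-b*y) - (y:ℝ)^3 = 1 := by exact_mod_cast h
      rw [this]; simp
    · have : (x:ℝ)*(x-a*y)*(x-b*y) - (y:ℝ)^3 = -1 := by exact_mod_cast h
      rw [this]; simp
  rw [← prod_perm (fun i => (x:ℝ) - th i * y) i j k hij hik hjk, abs_mul, abs_mul] at hP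
  have hy1 : 1 ≤ |(y:ℝ)| := by nlinarith
  have hypos : 0 < |(y:ℝ)| := by linarith
  have gi := H.gap j i hij.symm
  have gk := H.gap j k hjk
  have wi : 100000 * |(y:ℝ)| ≤ |(th j - th i) * y| := by
    rw [abs_mul]; exact mul_le_mul_of_nonneg_right gi hypos.le
  have wk : 100000 * |(y:ℝ)| ≤ |(th j - th k) * y| := by
    rw [abs_mul]; exact mul_le_mul_of_nonneg_right gk hypos.le
  have Ei := link_eps _ _ _ ((th j - th i) * y) ((th j - th k) * y) |(y:ℝ)| hP (by ring) (by ring) mi mk hy1 wi wk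
  have Ek := link_eps ((x:ℝ) - th j * y) (x - th k * y) (x - th i * y) ((th j - th k) * y) ((th j - th i) * y) |(y:ℝ)|
    (by linarith) (by ring) (by ring) mk mi hy1 wk wi
  rw [abs_mul, Real.log_mul (by linarith) hypos.ne'] at Ei Ek
  have hlog : ∀ l, Real.log (|(x:ℝ) - th l * y|) = u * Real.log (|th l|) + v * Real.log (|th l - a|) := by
    intro l
    have n0 := abs_ne_zero.2 (H.ne0 l)
    have na := abs_ne_zero.2 (H.nea l)
    rw [huv, Real.log_mul (zpow_ne_zero _ n0) (zpow_ne_zero _ na), Real.log_zpow, Real.log_zpow]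
  have hY : 0 ≤ Real.log |(y:ℝ)| := Real.log_nonneg hy1
  obtain ⟨gi0, gi1⟩ := H.log_gap j i hij.symm
  obtain ⟨gk0, gk1⟩ := H.log_gap j k hjk
  have half : 1 / (2 * |(y:ℝ)|^3) = (1 / |(y:ℝ)|^3)/2 := by field_simp
  have hle : 1 / |(y:ℝ)|^3 ≤ 1/10 := by
    rw [div_le_div_iff₀ (by positivity) (by norm_num)]
    have : 10 ≤ |(y:ℝ)| := by nlinarith
    have : |(y:ℝ)|^1 ≤ |(y:ℝ)|^3 := pow_le_pow_right₀ hy1 (by norm_num)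
    linarith
  rw [half] at Ei Ek
  have Ei' := abs_le.1 Ei
  have Ek' := abs_le.1 Ek
  obtain ⟨c1, c2, c3, c4⟩ := H.logs2 i k hik
  have hi := hlog i
  have hk := hlog k
  refine ⟨?_, ?_⟩
  · have : Lam a th i k j u v = (Real.log (|(x:ℝ) - th i * y|) - (Real.log |th j - th i| + Real.log |(y:ℝ)|)) -
      (Real.log (|(x:ℝ) - th k * y|) - (Real.log |th j - th k| + Real.log |(y:ℝ)|)) := by
      rw [hi, hk, Lam]; ring
    rw [this]
    refine (abs_sub _ _).trans ?_
    linarith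
  · exact cramer_bd _ _ _ _ _ _ _ u v _ _ hi hk rfl c1 c4 (by rw [abs_le]; constructor <;> linarith)
      (by rw [abs_le]; constructor <;> linarith) c3 c2
end RD
end U5sec

section U6sec
theorem nU_le (n U Y lam l2 : ℝ) (hn : 29 ≤ n) (hU : 10 ≤ U) (hlam : lam = n * l2) (hl : 0.6931471803 < l2)
    (h : 19/10 * lam * U ≤ 302/100 * (Y + lam + 1)) : n * U ≤ 3 * Y := by
  have hnl : n * (693/1000) ≤ lam := by rw [hlam]; nlinarith
  have h19 : 20 ≤ lam := by linarith
  have h1 : lam * 10 ≤ lam * U := by nlinarith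
  have h2 : n * (693/1000) * U ≤ lam * U := by nlinarith
  have h3 : 19/10 * (lam * U) ≤ 302/100 * (Y + lam + 1) := by linarith
  nlinarith

theorem pow_le_exp (m : ℕ) (hm : m ≤ 640) (t : ℝ) (ht : 29000 ≤ t) : ((2^m : ℕ) : ℝ) ≤ Real.exp t := by
  rw [Nat.cast_pow, Nat.cast_ofNat, ← Real.log_le_iff_le_exp (by positivity), Real.log_pow]
  have := Real.log_two_lt_d9
  have h2 := Real.log_two_gt_d9
  have h1 : (m:ℝ) ≤ 640 := by exact_mod_cast hm
  nlinarith

theorem SS_form : ∃ m : ℕ, m ≤ 640 ∧ SS = 2^m := ⟨640, le_rfl, by decide +kernel⟩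

theorem SS_le_exp (t : ℝ) (ht : 29000 ≤ t) : (SS : ℝ) ≤ Real.exp t := by
  obtain ⟨m, hm, hS⟩ := SS_form
  rw [hS]
  exact pow_le_exp m hm t ht

namespace RD
variable {a b : ℤ} {th : Fin 3 → ℝ}

theorem transc_use (H : RD a b th) (n : ℕ) (hn : 28 < n) (hn' : n ≤ 1000) (hb : (b:ℝ) = 2^n) (i j k : Fin 3)
    (hij : i ≠ j) (hik : i ≠ k) (hjk : j ≠ k) (u v : ℤ) (U : ℤ) (hu : |u| ≤ U) (hv : |v| ≤ U) (hmax : |u| = U ∨ |v| = U)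
    (hU : (8:ℤ)^84 ≤ U) (hL : |Lam a th i k j u v| ≤ Real.exp (-(n * (U:ℝ)))) : False := by
  have ha := H.haR
  have hab := H.habR
  have hbpos : (0:ℝ) < b := by linarith
  have hlb : Real.log b = n * Real.log 2 := by rw [hb, Real.log_pow]
  have l2 := Real.log_two_lt_d9
  have l2' := Real.log_two_gt_d9
  have hnR : (29:ℝ) ≤ n := by exact_mod_cast hn
  have hlbn : Real.log b ≤ 7/10 * n := by rw [hlb]; nlinarith
  have n0i := abs_pos.2 (H.ne0 i)
  have n0k := abs_pos.2 (H.ne0 k)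
  have nai := abs_pos.2 (H.nea i)
  have nak := abs_pos.2 (H.nea k)
  have gi := H.gap j i hij.symm
  have gk := H.gap j k hjk
  obtain ⟨gi0, gi1⟩ := H.log_gap j i hij.symm
  obtain ⟨gk0, gk1⟩ := H.log_gap j k hjk
  obtain ⟨c1, c2, c3, c4⟩ := H.logs2 i k hik
  have e1 : 0 < |th i / th k| := by rw [abs_div]; positivity
  have e2 : 0 < |(th i - a) / (th k - a)| := by rw [abs_div]; positivity
  have hab2 : (a:ℝ) * b ≤ Real.exp ((2*n : ℕ) : ℝ) := by
    have h1 : (a:ℝ) * b ≤ b * b := by apply mul_le_mul_of_nonneg_right _ hbpos.le; linarith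
    have h2 : (b:ℝ) * b ≤ Real.exp ((2*n : ℕ) : ℝ) := by
      rw [← Real.log_le_iff_le_exp (by positivity), Real.log_mul hbpos.ne' hbpos.ne']
      push_cast; linarith
    linarith
  have hde : |th j - th k| ≤ Real.exp ((2*n : ℕ) : ℝ) := (H.bdd j k).trans hab2
  have hLi := liou_RD H (2*n) hab2 j i k
  have le1 : Real.log (|th i / th k|) = Real.log (|th i|) - Real.log (|th k|) := by
    rw [abs_div, Real.log_div n0i.ne' n0k.ne']
  have le2 : Real.log (|(th i - a) / (th k - a)|) = Real.log (|th i - a|) - Real.log (|th k - a|) := by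
    rw [abs_div, Real.log_div nai.ne' nak.ne']
  have le3 : Real.log (|th j - th i| / |th j - th k|) = Real.log (|th j - th i|) - Real.log (|th j - th k|) := by
    rw [Real.log_div (by linarith) (by linarith)]
  have hl1 : |Real.log (|th i / th k|)| ≤ 2 * ((2*n:ℕ):ℝ) := by
    rw [le1]
    refine (abs_sub _ _).trans ?_
    push_cast; linarith
  have hl2 : |Real.log (|(th i - a) / (th k - a)|)| ≤ 2 * ((2*n:ℕ):ℝ) := by
    rw [le2]
    refine (abs_sub _ _).trans ?_
    push_cast; linarith
  have hl3 : |Real.log (|th j - th i| / |th j - th k|)| ≤ 2 * ((2*n:ℕ):ℝ) := by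
    rw [le3, abs_le]
    push_cast; constructor <;> linarith
  have hind := H.ind i k hik
  rcases hmax with hm | hm
  · refine transc _ _ _ _ (2*n) e2 e1 (by linarith) (by linarith) hde hLi.swap (by omega) (by omega) hl2 hl3 ?_ v u
      (by rw [hm]; exact hv) (by rw [hm]; exact hU) ?_
    · intro A B h
      exact (hind B A (by rw [← h]; ring)).1
    · have hm' : |(u:ℝ)| = U := by exact_mod_cast hm
      have e : ((v:ℝ) * Real.log (|(th i - a) / (th k - a)|) + u * Real.log (|th i / th k|) - Real.log (|th j - th i| / |th j - th k|))
        = Lam a th i k j u v := by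
        rw [le1, le2, le3, Lam]; ring
      rw [e, hm']
      refine hL.trans (le_of_eq ?_)
      congr 1; push_cast; ring
  · refine transc _ _ _ _ (2*n) e1 e2 (by linarith) (by linarith) hde hLi (by omega) (by omega) hl1 hl3 ?_ u v
      (by rw [hm]; exact hu) (by rw [hm]; exact hU) ?_
    · intro A B h
      exact (hind A B h).2
    · have hm' : |(v:ℝ)| = U := by exact_mod_cast hm
      have e : ((u:ℝ) * Real.log (|th i / th k|) + v * Real.log (|(th i - a) / (th k - a)|) - Real.log (|th j - th i| / |th j - th k|))
        = Lam a th i k j u v := by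
        rw [le1, le2, le3, Lam]
      rw [e, hm']
      refine hL.trans (le_of_eq ?_)
      congr 1; push_cast; ring

theorem link2 (H : RD a b th) (n : ℕ) (hn : 28 < n) (hn' : n ≤ 1000) (hb : (b:ℝ) = 2^n) (i j k : Fin 3)
    (hij : i ≠ j) (hik : i ≠ k) (hjk : j ≠ k) (u v : ℤ) (Y : ℝ)
    (hL : |Lam a th i k j u v| ≤ Real.exp (-(3*Y)))
    (hu : 19/10 * Real.log b * |(u:ℝ)| ≤ 302/100 * (Y + Real.log b + 1))
    (hv : 19/10 * Real.log b * |(v:ℝ)| ≤ 302/100 * (Y + Real.log b + 1)) :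
    |u| ≤ UU ∧ (1000 ≤ |u| → SS * Real.exp (-(3*Y)) ≤ 1) := by
  have hlb : Real.log b = n * Real.log 2 := by rw [hb, Real.log_pow]
  have l2' := Real.log_two_gt_d9
  have hnR : (29:ℝ) ≤ n := by exact_mod_cast hn
  constructor
  · by_contra hc
    push Not at hc
    have hUU : (UU:ℤ) = 8^84 := by rw [UU]; norm_num
    rw [hUU] at hc
    obtain ⟨U, hU⟩ : ∃ U : ℤ, U = max |u| |v| := ⟨_, rfl⟩
    have h1 : |u| ≤ U := by rw [hU]; exact le_max_left _ _
    have h2 : |v| ≤ U := by rw [hU]; exact le_max_right _ _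
    have h3 : |u| = U ∨ |v| = U := by
      rcases le_total |u| |v| with h | h
      · right; rw [hU, max_eq_right h]
      · left; rw [hU, max_eq_left h]
    have h4 : (8:ℤ)^84 ≤ U := by linarith
    have h5 : (10:ℝ) ≤ (U:ℝ) := by
      have : (10:ℤ) ≤ U := by
        refine le_trans ?_ h4
        norm_num
      exact_mod_cast this
    have h6 : 19/10 * Real.log b * (U:ℝ) ≤ 302/100 * (Y + Real.log b + 1) := by
      rcases h3 with h | h
      · rw [← h]; push_cast; exact hu
      · rw [← h]; push_cast; exact hv
    have h7 := nU_le n U Y _ _ hnR h5 hlb l2' h6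
    refine H.transc_use n hn hn' hb i j k hij hik hjk u v U h1 h2 h3 h4 (hL.trans ?_)
    exact Real.exp_le_exp.2 (by linarith)
  · intro h
    have hR : (1000:ℝ) ≤ |(u:ℝ)| := by exact_mod_cast h
    have h7 := nU_le n |(u:ℝ)| Y _ _ hnR (by linarith) hlb l2' hu
    have h8 : 29000 ≤ 3 * Y := by nlinarith
    have hS := SS_le_exp (3*Y) h8
    rw [Real.exp_neg, ← div_eq_mul_inv, div_le_one (Real.exp_pos _)]
    exact hS

/-- the units that remain are too small -/
theorem too_small (H : RD a b th) (x y : ℤ) (hy : (a:ℝ) * b ≤ 10 * |(y:ℝ)|) (u v : ℤ)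
    (huv : ∀ i, |(x:ℝ) - th i * y| = |th i|^u * |th i - a|^v)
    (h : (u = 1 ∧ v = 0) ∨ (u = 0 ∧ v = 1) ∨ (u = -1 ∧ v = -1)) : False := by
  have ha := H.haR
  have hab := H.habR
  have hs := H.hsmall
  have p0 := H.p0
  have q0 := H.q0
  have p1 := H.p1
  have q1 := H.q1
  have p2 := H.p2
  have q2 := H.q2
  have hbig : ∀ l, |th l| ≤ 2*b ∧ |th l - a| ≤ 2*b ∧ |th l - b| ≤ 2*b := by
    intro l
    simp only [abs_le]
    fin_cases l <;> simp only [Fin.zero_eta, Fin.mk_one, Fin.reduceFinMk] <;> refine ⟨⟨?_, ?_⟩, ⟨?_, ?_⟩, ⟨?_, ?_⟩⟩ <;> linarith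
  have hle : ∀ l, |(x:ℝ) - th l * y| ≤ 2*b := by
    intro l
    rw [huv]
    obtain ⟨b1, b2, b3⟩ := hbig l
    rcases h with ⟨rfl, rfl⟩ | ⟨rfl, rfl⟩ | ⟨rfl, rfl⟩
    · simpa using b1
    · simpa using b2
    · have n0 := abs_pos.2 (H.ne0 l)
      have na := abs_pos.2 (H.nea l)
      have hroot : |th l| * |th l - a| * |th l - b| = 1 := by
        rw [← abs_mul, ← abs_mul, H.root]; simp
      have : |th l|^(-1:ℤ) * |th l - a|^(-1:ℤ) = |th l - b| := by
        simp only [zpow_neg, zpow_one]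
        field_simp
        linarith
      rw [this]; exact b3
  have e : |(y:ℝ)| * (th 2 - th 0) ≤ 4*b := by
    have : |(y:ℝ)| * (th 2 - th 0) = |((x:ℝ) - th 0 * y) - (x - th 2 * y)| := by
      have e2 : ((x:ℝ) - th 0 * y) - (x - th 2 * y) = y * (th 2 - th 0) := by ring
      rw [e2, abs_mul, abs_of_pos (by linarith : 0 < th 2 - th 0)]
    rw [this]
    refine (abs_sub _ _).trans ?_
    have := hle 0
    have := hle 2
    linarith
  generalize |(y:ℝ)| = Q at *
  have hQ : 0 ≤ Q := by
    have := H.habpos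
    linarith
  have : Q * (b * (9/10)) ≤ Q * (th 2 - th 0) := by
    apply mul_le_mul_of_nonneg_left _ hQ; linarith
  have hbpos : (0:ℝ) < b := by linarith
  have : (Q * (9/10)) * b ≤ 4 * b := by linarith
  have := le_of_mul_le_mul_right this hbpos
  nlinarith

theorem solve (n f : ℕ) (hn : 28 < n) (hn' : n ≤ 1000) (hck : ck n f = true) (H : RD f ((2^n:ℕ):ℤ) th) (x y : ℤ)
    (h : x*(x-f*y)*(x-((2^n:ℕ):ℤ)*y) - y^3 = 1 ∨ x*(x-f*y)*(x-((2^n:ℕ):ℤ)*y) - y^3 = -1) :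
    Triv f ((2^n:ℕ):ℤ) x y := by
  by_contra hT
  have hy := small_sol _ _ x y H.ha H.hab h hT
  obtain ⟨u, v, huv⟩ := H.units x y h
  have hab := H.habpos
  have hypos : 0 < |(y:ℝ)| := by linarith
  have hexp : 1 / |(y:ℝ)|^3 = Real.exp (-(3 * Real.log |(y:ℝ)|)) := by
    rw [Real.exp_neg, one_div]
    congr 1
    have : (3:ℝ) * Real.log |(y:ℝ)| = ((3:ℕ):ℝ) * Real.log |(y:ℝ)| := by norm_num
    rw [this, Real.exp_nat_mul, Real.exp_log hypos]
  have hb : (((2^n:ℕ):ℤ):ℝ) = 2^n := by push_cast; rfl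
  have hLm : SS * (1 / |(y:ℝ)|^3) ≤ 1000 * SS / ((f:ℝ) * 2^n)^3 := by
    rw [hb] at hy hab
    push_cast at hy hab
    have hS := SS_pos
    rw [mul_one_div, div_le_div_iff₀ (by positivity) (by positivity)]
    have : ((f:ℝ) * 2^n)^3 ≤ (10 * |(y:ℝ)|)^3 := pow_le_pow_left₀ hab.le hy 3
    nlinarith
  have key : ∀ i j k : Fin 3, i ≠ j → i ≠ k → j ≠ k → |(x:ℝ) - th j * y| ≤ |(x:ℝ) - th i * y| →
      |(x:ℝ) - th j * y| ≤ |(x:ℝ) - th k * y| → |Lam f th i k j u v| ≤ 1 / |(y:ℝ)|^3 ∧ |u| ≤ UU ∧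
        (1000 ≤ |u| → SS * (1 / |(y:ℝ)|^3) ≤ 1) := by
    intro i j k hij hik hjk mi mk
    obtain ⟨r1, r2, r3⟩ := H.link1 x y hy h u v huv i j k hij hik hjk mi mk
    refine ⟨r1, ?_⟩
    rw [hexp] at r1 ⊢
    exact H.link2 n hn hn' hb i j k hij hik hjk u v _ r1 r2 r3
  apply H.too_small x y hy u v huv
  rcases le_total |(x:ℝ) - th 0 * y| |(x:ℝ) - th 1 * y| with h01 | h01
  · rcases le_total |(x:ℝ) - th 0 * y| |(x:ℝ) - th 2 * y| with h02 | h02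
    · obtain ⟨t1, t2, t3⟩ := key 2 0 1 (by decide) (by decide) (by decide) h02 h01
      exact Or.inl ((ck_sound n f hn' hck th H u v t2 _ hLm t3).1 t1)
    · obtain ⟨t1, t2, t3⟩ := key 0 2 1 (by decide) (by decide) (by decide) h02 (h02.trans h01)
      exact Or.inr (Or.inr ((ck_sound n f hn' hck th H u v t2 _ hLm t3).2.2 t1))
  · rcases le_total |(x:ℝ) - th 1 * y| |(x:ℝ) - th 2 * y| with h12 | h12
    · obtain ⟨t1, t2, t3⟩ := key 2 1 0 (by decide) (by decide) (by decide) h12 h01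
      exact Or.inr (Or.inl ((ck_sound n f hn' hck th H u v t2 _ hLm t3).2.1 t1))
    · obtain ⟨t1, t2, t3⟩ := key 0 2 1 (by decide) (by decide) (by decide) (h12.trans h01) h12
      exact Or.inr (Or.inr ((ck_sound n f hn' hck th H u v t2 _ hLm t3).2.2 t1))
end RD
end U6sec

/-- For `28 < n ≤ 1000`, the only solutions of the Thue equation
`x(x - Fₙ y)(x - 2ⁿ y) - y³ = ±1` are the trivial ones. -/
theorem thue_fib_pow2_solutions_n_le_1000 (n : ℕ) (hn : 28 < n) (hn' : n ≤ 1000) :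
    {p : ℤ × ℤ |
        p.1 * (p.1 - (Nat.fib n : ℤ) * p.2) * (p.1 - 2 ^ n * p.2) - p.2 ^ 3 = 1 ∨
        p.1 * (p.1 - (Nat.fib n : ℤ) * p.2) * (p.1 - 2 ^ n * p.2) - p.2 ^ 3 = -1} =
      {(1, 0), (-1, 0), (0, 1), (0, -1), ((Nat.fib n : ℤ), 1), (-(Nat.fib n : ℤ), -1),
        ((2 : ℤ) ^ n, 1), (-((2 : ℤ) ^ n), -1)} := by
  obtain ⟨f1, f2, f3⟩ := fib_facts n hn
  have hck := ck_all n hn hn'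
  obtain ⟨th, H⟩ := RD_exists (Nat.fib n : ℤ) ((2^n : ℕ) : ℤ) (by exact_mod_cast f1) (by exact_mod_cast f2)
    (by exact_mod_cast f3)
  have main := RD.solve n (Nat.fib n) hn hn' hck H
  have hb : ((2^n : ℕ) : ℤ) = 2^n := by push_cast; rfl
  rw [hb] at main
  clear hck H f1 f2 f3 hb
  generalize (2:ℤ)^n = b at *
  generalize (Nat.fib n : ℤ) = a at *
  ext ⟨x, y⟩
  simp only [Set.mem_setOf_eq, Set.mem_insert_iff, Set.mem_singleton_iff, Prod.mk.injEq]
  constructor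
  · intro h
    rcases main x y h with ⟨h1, h2 | h2⟩ | ⟨h1 | h1, h2 | h2 | h2⟩ <;> subst h1 <;> subst h2 <;> simp
  · rintro (⟨rfl, rfl⟩ | ⟨rfl, rfl⟩ | ⟨rfl, rfl⟩ | ⟨rfl, rfl⟩ | ⟨rfl, rfl⟩ | ⟨rfl, rfl⟩ | ⟨rfl, rfl⟩ | ⟨rfl, rfl⟩)
    · left; ring
    · right; ring
    · right; ring
    · left; ring
    · right; ring
    · left; ring
    · right; ring
    · left; ring
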